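/- (Symplectic camel theorem.) Let n ≥ 2 and r, R > 0. Suppose there exist a smooth family (ψ_t)_{t∈[0,1]} of diffeomorphisms of ℝ^{2n} (i.e. (t,x) ↦ ψ_t(x) is smooth and each ψ_t is a diffeomorphism) such that for every t and every x the derivative Dψ_t(x) preserves the standard symplectic form ω, and an open Euclidean ball B ⊂ ℝ^{2n} of radius R, such that: ψ₀(B) ⊂ P₋ = {qₙ < 0}, ψ₁(B) ⊂ P₊ = {qₙ > 0}, and for every t ∈ [0,1] and every x ∈ B, if the qₙ-coordinate of ψ_t(x) equals 0 then ‖ψ_t(x)‖ < r. Then R ≤ r. -/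

import Mathlib

noncomputable section

open Set

/-- The standard symplectic form `ω = Σᵢ dqᵢ∧dpᵢ` on `ℝ^{2n}`, where the coordinates are
interleaved: `qᵢ ↔` index `2i`, `pᵢ ↔` index `2i+1` (for `i = 1,…,n`).  Explicitly
`ω(v,w) = Σᵢ (v_{pᵢ}·w_{qᵢ} − w_{pᵢ}·v_{qᵢ}) = ⟪p(v),q(w)⟫ − ⟪p(w),q(v)⟫`. -/
def stdSymplecticForm (n : ℕ) (v w : EuclideanSpace ℝ (Fin (2 * n))) : ℝ :=
  ∑ i : Fin n,
    (v ⟨2 * i.val + 1, by have := i.isLt; omega⟩ * w ⟨2 * i.val, by have := i.isLt; omega⟩ -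
      w ⟨2 * i.val + 1, by have := i.isLt; omega⟩ * v ⟨2 * i.val, by have := i.isLt; omega⟩)

section
namespace Camel
open Metric MeasureTheory

/-! ### The theorem of Brouwer -/

lemma lagrange_coeffs (d : ℕ) (τ : ℝ) (hτ : 0 < τ) :
    ∃ (c : ℕ → ℝ) (v : ℕ → ℝ), (∀ i ∈ Finset.range (d+1), 0 ≤ v i ∧ v i ≤ τ) ∧
      ∀ P : Polynomial ℝ, P.natDegree ≤ d →
        P.eval 1 = ∑ i ∈ Finset.range (d+1), c i * P.eval (v i) := by
  let v : ℕ → ℝ := fun i => τ * (i / (d+1 : ℝ))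
  have hv : Set.InjOn v (Finset.range (d+1) : Finset ℕ) := by
    intro i _ j _ h
    have h1 : (d+1 : ℝ) ≠ 0 := by positivity
    have h2 : (i / (d+1 : ℝ)) = j / (d+1 : ℝ) := mul_left_cancel₀ hτ.ne' h
    field_simp at h2
    exact_mod_cast h2
  refine ⟨fun i => (Lagrange.basis (Finset.range (d+1)) v i).eval 1, v, ?_, ?_⟩
  · intro i hi
    have h1 : (i:ℝ) ≤ d + 1 := by
      have := Finset.mem_range.1 hi
      exact_mod_cast this.le
    refine ⟨by positivity, ?_⟩
    have : (i / (d+1 : ℝ)) ≤ 1 := by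
      rw [div_le_one (by positivity)]; exact h1
    calc v i ≤ τ * 1 := mul_le_mul_of_nonneg_left this hτ.le
      _ = τ := mul_one _
  · intro P hP
    have hdeg : P.degree < (Finset.range (d+1)).card := by
      rw [Finset.card_range]
      refine lt_of_le_of_lt Polynomial.degree_le_natDegree ?_
      exact_mod_cast Nat.lt_succ_of_le hP
    have := Lagrange.eq_interpolate hv hdeg
    conv_lhs => rw [this]
    rw [Lagrange.interpolate_apply, Polynomial.eval_finsetSum]
    refine Finset.sum_congr rfl fun i _ => ?_
    rw [Polynomial.eval_mul, Polynomial.eval_C, mul_comm]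

/-- `t ↦ det (1 + t A)` is polynomial of degree at most `d`. -/
lemma det_poly {d : ℕ} (A : EuclideanSpace ℝ (Fin d) →L[ℝ] EuclideanSpace ℝ (Fin d)) :
    ∃ P : Polynomial ℝ, P.natDegree ≤ d ∧
      ∀ t : ℝ, P.eval t = (ContinuousLinearMap.id ℝ _ + t • A).det := by
  let b := (EuclideanSpace.basisFun (Fin d) ℝ).toBasis
  let M := LinearMap.toMatrix b b (A : EuclideanSpace ℝ (Fin d) →ₗ[ℝ] EuclideanSpace ℝ (Fin d))
  refine ⟨Matrix.det ((Polynomial.X : Polynomial ℝ) • M.map Polynomial.C +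
    (1 : Matrix (Fin d) (Fin d) ℝ).map Polynomial.C), ?_, ?_⟩
  · simpa using Polynomial.natDegree_det_X_add_C_le M 1
  · intro t
    have h1 : Polynomial.eval t (Matrix.det ((Polynomial.X : Polynomial ℝ) • M.map Polynomial.C +
        (1 : Matrix (Fin d) (Fin d) ℝ).map Polynomial.C)) = Matrix.det (t • M + 1) := by
      rw [← Polynomial.coe_evalRingHom, RingHom.map_det]
      congr 1
      ext i j
      by_cases hij : i = j <;> simp [hij, Polynomial.eval_add, Polynomial.eval_mul] <;> ring
    rw [h1, ContinuousLinearMap.det, ← LinearMap.det_toMatrix b]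
    congr 1
    have : ((ContinuousLinearMap.id ℝ (EuclideanSpace ℝ (Fin d)) + t • A :
        EuclideanSpace ℝ (Fin d) →L[ℝ] EuclideanSpace ℝ (Fin d)) :
        EuclideanSpace ℝ (Fin d) →ₗ[ℝ] EuclideanSpace ℝ (Fin d)) = LinearMap.id + t •
        (A : EuclideanSpace ℝ (Fin d) →ₗ[ℝ] EuclideanSpace ℝ (Fin d)) := by
      ext x; simp
    rw [this, map_add, LinearMap.toMatrix_id, map_smul, add_comm]

/-- A map which is Lipschitz on a closed ball and vanishes off the open ball is Lipschitz. -/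
lemma lipschitz_glue {E : Type*} [NormedAddCommGroup E] [NormedSpace ℝ E] {ρ : ℝ}
    {u : E → E} {K : ℝ} (hK : 0 ≤ K)
    (hu : ∀ x ∈ closedBall (0:E) ρ, ∀ y ∈ closedBall (0:E) ρ, ‖u x - u y‖ ≤ K * ‖x - y‖)
    (h0 : ∀ x, ρ ≤ ‖x‖ → u x = 0) (x y : E) : ‖u x - u y‖ ≤ K * ‖x - y‖ := by
  have key : ∀ x y : E, ‖x‖ ≤ ρ → ρ < ‖y‖ → ‖u x - u y‖ ≤ K * ‖x - y‖ := by
    intro x y hx hy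
    have hc : ContinuousOn (fun s : ℝ => ‖x + s • (y - x)‖) (Icc 0 1) := by fun_prop
    have := intermediate_value_Icc (zero_le_one' ℝ) hc
    have hmem : ρ ∈ Icc ‖x + (0:ℝ) • (y - x)‖ ‖x + (1:ℝ) • (y - x)‖ := by
      simp only [zero_smul, add_zero, one_smul, add_sub_cancel]
      exact ⟨hx, hy.le⟩
    obtain ⟨s, hs, hs'⟩ := this hmem
    simp only at hs'
    set c := x + s • (y - x) with hcdef
    rw [h0 y hy.le, ← h0 c hs'.ge]
    refine (hu x (by simpa using hx) c (by simpa using hs'.le)).trans ?_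
    refine mul_le_mul_of_nonneg_left ?_ hK
    have : x - c = s • (x - y) := by rw [hcdef]; module
    rw [this, norm_smul, Real.norm_eq_abs, abs_of_nonneg hs.1]
    nlinarith [norm_nonneg (x - y), hs.2]
  rcases le_or_gt ‖x‖ ρ with hx | hx <;> rcases le_or_gt ‖y‖ ρ with hy | hy
  · exact hu x (by simpa using hx) y (by simpa using hy)
  · exact key x y hx hy
  · rw [norm_sub_rev, norm_sub_rev x]; exact key y x hy hx
  · rw [h0 x hx.le, h0 y hy.le]; simp; positivity

open scoped NNReal in
/-- No-retraction type statement: a smooth map which is the identity far away has a zero. -/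
lemma exists_zero_of_eq_id {d : ℕ} {ρ : ℝ} (hρ : 0 < ρ)
    (f : EuclideanSpace ℝ (Fin d) → EuclideanSpace ℝ (Fin d)) (hf : ContDiff ℝ 1 f)
    (hid : ∀ x, ρ ≤ ‖x‖ → f x = x) : ∃ x, f x = 0 := by
  by_contra hne
  push Not at hne
  let E := EuclideanSpace ℝ (Fin d)
  let r : E → E := fun x => (ρ / ‖f x‖) • f x
  have hr : ContDiff ℝ 1 r := by
    refine ContDiff.smul (contDiff_const.div (hf.norm ℝ hne) fun x => norm_ne_zero_iff.2 (hne x)) hf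
  have hrn : ∀ x, ‖r x‖ = ρ := by
    intro x
    have := norm_ne_zero_iff.2 (hne x)
    simp only [r, norm_smul, norm_div, norm_norm, Real.norm_eq_abs, abs_of_pos hρ, abs_norm]
    field_simp
  have hrs : ∀ x, ‖x‖ = ρ → r x = x := by
    intro x hx
    simp only [r]
    rw [hid x hx.ge, hx, div_self hρ.ne', one_smul]
  -- the perturbation
  let u : E → E := fun x => if ‖x‖ ≤ ρ then r x - x else 0
  have hu0 : ∀ x, ρ ≤ ‖x‖ → u x = 0 := by
    intro x hx
    simp only [u]
    split_ifs with h
    · rw [hrs x (le_antisymm h hx), sub_self]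
    · rfl
  have hw : ContDiff ℝ 1 (fun x => r x - x) := hr.sub contDiff_id
  have hwd : Continuous (fderiv ℝ (fun x => r x - x)) := hw.continuous_fderiv one_ne_zero
  obtain ⟨K, hK⟩ := (isCompact_closedBall (0:E) ρ).exists_bound_of_continuousOn hwd.continuousOn
  have hK0 : 0 ≤ K := (norm_nonneg _).trans (hK 0 (by simp [hρ.le]))
  have hlip : ∀ x y, ‖u x - u y‖ ≤ K * ‖x - y‖ := by
    refine lipschitz_glue (ρ := ρ) hK0 ?_ hu0
    intro x hx y hy
    have hx' : ‖x‖ ≤ ρ := by simpa using hx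
    have hy' : ‖y‖ ≤ ρ := by simpa using hy
    simp only [u, hx', hy', if_true]
    exact (convex_closedBall (0:E) ρ).norm_image_sub_le_of_norm_fderiv_le
      (fun z _ => (hw.differentiable one_ne_zero) z) hK hy hx
  let W : E → E →L[ℝ] E := fderiv ℝ (fun x => r x - x)
  have hud : ∀ x ∈ ball (0:E) ρ, HasFDerivAt u (W x) x := by
    intro x hx
    have h1 : HasFDerivAt (fun x => r x - x) (W x) x :=
      ((hw.differentiable one_ne_zero) x).hasFDerivAt
    refine h1.congr_of_eventuallyEq ?_
    filter_upwards [isOpen_ball.mem_nhds hx] with y hy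
    have hy' : ‖y‖ ≤ ρ := by simpa using (mem_ball_zero_iff.1 hy).le
    simp [u, hy']
  -- small parameter
  let τ : ℝ := 1 / (2 * (K + 1))
  have hτ : 0 < τ := by positivity
  have hτK : τ * K < 1 := by
    simp only [τ]
    rw [div_mul_eq_mul_div, div_lt_one (by positivity)]; linarith
  obtain ⟨c, v, hv, hc⟩ := lagrange_coeffs d τ hτ
  have hvol : ∀ t, 0 ≤ t → t ≤ τ →
      ∫ x in ball (0:E) ρ, (ContinuousLinearMap.id ℝ E + t • W x).det = volume.real (ball (0:E) ρ) := by
    intro t ht0 htτ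
    have htK : t * K < 1 := lt_of_le_of_lt (mul_le_mul_of_nonneg_right htτ hK0) hτK
    let g : E → E := fun x => x + t • u x
    have hgl : ∀ x y, ‖g x - g y - (x - y)‖ ≤ t * K * ‖x - y‖ := by
      intro x y
      have : g x - g y - (x - y) = t • (u x - u y) := by simp only [g]; module
      rw [this, norm_smul, Real.norm_eq_abs, abs_of_nonneg ht0, mul_assoc]
      exact mul_le_mul_of_nonneg_left (hlip x y) ht0
    have hginj : Function.Injective g := by
      intro x y hxy
      have := hgl x y
      rw [hxy, sub_self, zero_sub, norm_neg] at this
      have h2 : ‖x - y‖ = 0 := by nlinarith [norm_nonneg (x - y)]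
      exact sub_eq_zero.1 (norm_eq_zero.1 h2)
    have hgsurj : Function.Surjective g := by
      have happ : ApproximatesLinearOn g ((ContinuousLinearEquiv.refl ℝ E : E ≃L[ℝ] E) : E →L[ℝ] E)
          univ ⟨t * K, by positivity⟩ := by
        intro x _ y _
        exact hgl x y
      refine happ.surjective ?_
      rcases subsingleton_or_nontrivial E with h | h
      · exact Or.inl h
      · right
        have : ‖((ContinuousLinearEquiv.refl ℝ E).symm : E →L[ℝ] E)‖₊ = 1 := by
          have : ((ContinuousLinearEquiv.refl ℝ E).symm : E →L[ℝ] E) = ContinuousLinearMap.id ℝ E := rfl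
          rw [this]
          ext
          simp
        rw [this, inv_one]
        exact_mod_cast htK
    have himg : g '' ball (0:E) ρ = ball (0:E) ρ := by
      have hout : ∀ x, ρ ≤ ‖x‖ → g x = x := by
        intro x hx; simp [g, hu0 x hx]
      ext y
      constructor
      · rintro ⟨x, hx, rfl⟩
        by_contra hcon
        have h1 : ρ ≤ ‖g x‖ := by simpa using hcon
        have h2 := hginj (hout _ h1)
        rw [h2] at h1
        exact absurd (mem_ball_zero_iff.1 hx) (not_lt.2 h1)
      · intro hy
        obtain ⟨x, rfl⟩ := hgsurj y
        refine ⟨x, ?_, rfl⟩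
        by_contra hcon
        have h1 : ρ ≤ ‖x‖ := by simpa using hcon
        rw [hout x h1] at hy
        exact hcon hy
    have hgd : ∀ x ∈ ball (0:E) ρ,
        HasFDerivWithinAt g (ContinuousLinearMap.id ℝ E + t • W x) (ball (0:E) ρ) x := by
      intro x hx
      exact ((hasFDerivAt_id x).add ((hud x hx).const_smul t)).hasFDerivWithinAt
    have h1 := integral_image_eq_integral_abs_det_fderiv_smul volume (measurableSet_ball)
      hgd hginj.injOn (fun _ => (1:ℝ))
    rw [himg] at h1
    have hpos : ∀ x ∈ ball (0:E) ρ, 0 ≤ (ContinuousLinearMap.id ℝ E + t • W x).det := by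
      intro x hx
      obtain ⟨P, -, hP⟩ := det_poly (W x)
      by_contra hneg
      push Not at hneg
      have hcont : ContinuousOn (fun s => P.eval s) (Icc 0 t) := P.continuous.continuousOn
      have := intermediate_value_Icc' ht0 hcont
      have hmem : (0:ℝ) ∈ Icc (P.eval t) (P.eval 0) := by
        rw [hP, hP]
        refine ⟨hneg.le, ?_⟩
        simp [ContinuousLinearMap.det]
      obtain ⟨s, hs, hs0⟩ := this hmem
      simp only [hP] at hs0
      have : ¬ Function.Injective (ContinuousLinearMap.id ℝ E + s • W x) := by
        intro hinj
        have hu : IsUnit (LinearMap.det ((ContinuousLinearMap.id ℝ E + s • W x : E →L[ℝ] E) : E →ₗ[ℝ] E)) := by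
          rw [← LinearMap.isUnit_iff_isUnit_det]
          rw [LinearMap.isUnit_iff_ker_eq_bot, LinearMap.ker_eq_bot]
          exact hinj
        rw [ContinuousLinearMap.det] at hs0
        rw [hs0] at hu
        exact not_isUnit_zero hu
      apply this
      rw [injective_iff_map_eq_zero]
      intro y hy
      have h3 : y = - (s • W x y) := by
        have : y + s • W x y = 0 := by simpa using hy
        exact eq_neg_of_add_eq_zero_left this
      have h4 : ‖y‖ ≤ s * K * ‖y‖ := by
        conv_lhs => rw [h3]
        rw [norm_neg, norm_smul, Real.norm_eq_abs, abs_of_nonneg hs.1, mul_assoc]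
        refine mul_le_mul_of_nonneg_left ?_ hs.1
        exact (W x).le_of_opNorm_le (hK x (ball_subset_closedBall hx)) y
      have h5 : s * K < 1 := lt_of_le_of_lt (mul_le_mul_of_nonneg_right hs.2 hK0) htK
      have h6 : ‖y‖ = 0 := by nlinarith [norm_nonneg y]
      exact norm_eq_zero.1 h6
    have h2 : ∫ x in ball (0:E) ρ, (ContinuousLinearMap.id ℝ E + t • W x).det =
        ∫ x in ball (0:E) ρ, |(ContinuousLinearMap.id ℝ E + t • W x).det| • (1:ℝ) := by
      refine setIntegral_congr_fun measurableSet_ball fun x hx => ?_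
      simp [abs_of_nonneg (hpos x hx)]
    rw [h2, ← h1]
    simp
  have hinteg : ∀ t : ℝ, IntegrableOn (fun x => (ContinuousLinearMap.id ℝ E + t • W x).det)
      (ball (0:E) ρ) := by
    intro t
    have hcont : Continuous fun x => (ContinuousLinearMap.id ℝ E + t • W x).det := by
      refine ContinuousLinearMap.continuous_det.comp ?_
      exact continuous_const.add (hwd.const_smul t)
    exact (hcont.continuousOn.integrableOn_compact (isCompact_closedBall (0:E) ρ)).mono_set
      ball_subset_closedBall
  have hW1 : ∫ x in ball (0:E) ρ, (ContinuousLinearMap.id ℝ E + (1:ℝ) • W x).det =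
      volume.real (ball (0:E) ρ) := by
    have h1 : ∀ x, (ContinuousLinearMap.id ℝ E + (1:ℝ) • W x).det =
        ∑ i ∈ Finset.range (d+1), c i * (ContinuousLinearMap.id ℝ E + v i • W x).det := by
      intro x
      obtain ⟨P, hPd, hP⟩ := det_poly (W x)
      simpa only [hP] using hc P hPd
    simp_rw [h1]
    rw [integral_finsetSum _ fun i _ => (hinteg (v i)).const_mul (c i)]
    simp_rw [integral_const_mul]
    rw [Finset.sum_congr rfl fun i hi => by rw [hvol (v i) (hv i hi).1 (hv i hi).2]]
    rw [← Finset.sum_mul]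
    have := hc 1 (by simp)
    simp only [Polynomial.eval_one, mul_one] at this
    rw [← this, one_mul]
  have hdet0 : ∀ x, (ContinuousLinearMap.id ℝ E + (1:ℝ) • W x).det = 0 := by
    intro x
    by_contra hdet
    have hr' : HasFDerivAt r (ContinuousLinearMap.id ℝ E + (1:ℝ) • W x) x := by
      have h1 : HasFDerivAt (fun x => r x - x) (W x) x :=
        ((hw.differentiable one_ne_zero) x).hasFDerivAt
      have h2 := (hasFDerivAt_id x).add h1
      rw [one_smul]
      refine h2.congr_of_eventuallyEq (Filter.Eventually.of_forall fun y => ?_)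
      simp
    have hunit : IsUnit (LinearMap.det ((ContinuousLinearMap.id ℝ E + (1:ℝ) • W x : E →L[ℝ] E) : E →ₗ[ℝ] E)) :=
      isUnit_iff_ne_zero.2 hdet
    rw [← LinearMap.isUnit_iff_isUnit_det, LinearMap.isUnit_iff_range_eq_top, LinearMap.range_eq_top] at hunit
    obtain ⟨y, hy⟩ := hunit (r x)
    have h3 := hr'.norm_sq
    have h4 : HasFDerivAt (fun x => ‖r x‖ ^ 2) (0 : E →L[ℝ] ℝ) x := by
      simp_rw [hrn]; exact hasFDerivAt_const _ _
    have h5 := congrArg (fun L => L y) (h3.unique h4)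
    have hy' : (ContinuousLinearMap.id ℝ E + (1:ℝ) • W x) y = r x := hy
    simp only [_root_.smul_apply, ContinuousLinearMap.comp_apply, hy',
      innerSL_apply_apply, _root_.zero_apply] at h5
    rw [real_inner_self_eq_norm_sq, hrn] at h5
    simp at h5
    exact hρ.ne' h5
  simp_rw [hdet0] at hW1
  have hpos : 0 < volume.real (ball (0:E) ρ) :=
    ENNReal.toReal_pos (measure_ball_pos volume 0 hρ).ne' measure_ball_lt_top.ne
  simp at hW1
  exact hpos.ne hW1

end Camel
end

section
namespace Camel
open Metric MeasureTheory

lemma brouwer_euclidean {d : ℕ} (F : EuclideanSpace ℝ (Fin d) → EuclideanSpace ℝ (Fin d))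
    (hF : Continuous F) (ρ : ℝ) (hb : ∀ x, ‖F x‖ ≤ ρ) : ∃ x, F x = x := by
  have hρ : 0 ≤ ρ := (norm_nonneg _).trans (hb 0)
  -- approximate fixed points
  have key : ∀ ε : ℝ, 0 < ε → ε ≤ 1 → ∃ x, ‖x‖ ≤ ρ + 1 ∧ ‖F x - x‖ ≤ ε := by
    intro ε hε hε1
    obtain ⟨G, hG, hGd⟩ := hF.exists_contDiff_approx 1 (ε := fun _ => ε) continuous_const
      (fun _ => hε)
    let χ : ContDiffBump (0 : EuclideanSpace ℝ (Fin d)) := ⟨ρ + 2, ρ + 3, by linarith, by linarith⟩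
    obtain ⟨x, hx⟩ := exists_zero_of_eq_id (ρ := ρ + 3) (by linarith)
      (fun x => x - χ x • G x) (contDiff_id.sub (χ.contDiff.smul hG)) (by
        intro x hx
        have : χ x = 0 := χ.zero_of_le_dist (by simpa using hx)
        simp [this])
    have hx' : x = χ x • G x := sub_eq_zero.1 hx
    have hGb : ∀ x, ‖G x‖ ≤ ρ + 1 := by
      intro x
      have h1 := (hGd.1 x)
      rw [dist_eq_norm] at h1
      have := norm_add_le (G x - F x) (F x)
      rw [sub_add_cancel] at this
      linarith [hb x]
    have hxn : ‖x‖ ≤ ρ + 1 := by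
      rw [hx', norm_smul, Real.norm_eq_abs, abs_of_nonneg χ.nonneg]
      calc χ x * ‖G x‖ ≤ 1 * ‖G x‖ := mul_le_mul_of_nonneg_right χ.le_one (norm_nonneg _)
        _ ≤ ρ + 1 := by rw [one_mul]; exact hGb x
    have hχ : χ x = 1 := χ.one_of_mem_closedBall (by
      simp only [mem_closedBall, dist_zero_right, χ]; linarith)
    refine ⟨x, hxn, ?_⟩
    rw [hχ, one_smul] at hx'
    have h1 := hGd.1 x
    rw [dist_eq_norm, ← hx', norm_sub_rev] at h1
    exact h1.le
  by_contra hne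
  push Not at hne
  have hcont : ContinuousOn (fun x => ‖F x - x‖) (closedBall (0:EuclideanSpace ℝ (Fin d)) (ρ+1)) := by
    fun_prop
  obtain ⟨x0, -, hmin⟩ := (isCompact_closedBall (0:EuclideanSpace ℝ (Fin d)) (ρ+1)).exists_isMinOn
    ⟨0, by simp; linarith⟩ hcont
  have hpos : 0 < ‖F x0 - x0‖ := norm_pos_iff.2 (sub_ne_zero.2 (hne x0))
  obtain ⟨x, hx, hx2⟩ := key (min (‖F x0 - x0‖ / 2) 1) (by positivity) (min_le_right _ _)
  have h1 : ‖F x0 - x0‖ ≤ ‖F x - x‖ := hmin (by simpa using hx)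
  have := min_le_left (‖F x0 - x0‖ / 2) 1
  linarith

variable {E : Type*} [NormedAddCommGroup E] [NormedSpace ℝ E] [FiniteDimensional ℝ E]

lemma brouwer (F : E → E) (hF : Continuous F) (ρ : ℝ) (hb : ∀ x, ‖F x‖ ≤ ρ) : ∃ x, F x = x := by
  let e : E ≃L[ℝ] EuclideanSpace ℝ (Fin (Module.finrank ℝ E)) := toEuclidean
  obtain ⟨x, hx⟩ := brouwer_euclidean (fun y => e (F (e.symm y)))
    (e.continuous.comp (hF.comp e.symm.continuous)) (‖e.toContinuousLinearMap‖ * ρ) (by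
      intro y
      refine (e.toContinuousLinearMap.le_opNorm _).trans ?_
      exact mul_le_mul_of_nonneg_left (hb _) (norm_nonneg _))
  refine ⟨e.symm x, ?_⟩
  apply e.injective
  simpa using hx

/-- Continuation of zeros (a form of homotopy invariance of the degree). -/
lemma continuation (h : ℝ → E → E) (hc : Continuous fun p : ℝ × E => h p.1 p.2) (x0 : E)
    (h0 : ∀ x, h 0 x = x - x0) (U : Set E) (hU : IsOpen U) (hUb : Bornology.IsBounded U)
    (hne : ∀ τ ∈ Icc (0:ℝ) 2, ∀ x ∈ frontier U, h τ x ≠ 0) (hx0 : x0 ∈ U) :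
    ∃ x ∈ U, h 2 x = 0 := by
  have hcl : IsCompact (closure U) := hUb.isCompact_closure
  let A : Set E := Prod.snd '' ((Icc (0:ℝ) 2 ×ˢ closure U) ∩ {p : ℝ × E | h p.1 p.2 = 0})
  have hA : IsClosed A := by
    refine IsCompact.isClosed ?_
    refine IsCompact.image ?_ continuous_snd
    exact (isCompact_Icc.prod hcl).inter_right (isClosed_eq hc continuous_const)
  have hAU : A ⊆ U := by
    rintro _ ⟨⟨τ, x⟩, ⟨⟨hτ, hx⟩, hz⟩, rfl⟩
    by_contra hcon
    refine hne τ hτ x ?_ hz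
    rw [hU.frontier_eq]; exact ⟨hx, hcon⟩
  obtain ⟨lam, hl0, hl1, hl⟩ := exists_continuous_zero_one_of_isClosed (s := Uᶜ) (t := A)
    hU.isClosed_compl hA (disjoint_left.2 fun x hx hx' => hx (hAU hx'))
  let F : E → E := fun x => x - h (2 * lam x) x
  have hFc : Continuous F := by
    refine continuous_id.sub (hc.comp (f := fun x => (2 * lam x, x)) ?_)
    exact (continuous_const.mul lam.continuous).prodMk continuous_id
  have hFo : ∀ x, x ∉ U → F x = x0 := by
    intro x hx
    have : lam x = 0 := hl0 hx
    simp [F, this, h0]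
  obtain ⟨C, hC⟩ := hcl.exists_bound_of_continuousOn hFc.continuousOn
  obtain ⟨x, hx⟩ := brouwer F hFc (max C ‖x0‖) (by
    intro x
    by_cases hxU : x ∈ U
    · exact (hC x (subset_closure hxU)).trans (le_max_left _ _)
    · rw [hFo x hxU]; exact le_max_right _ _)
  have hxU : x ∈ U := by
    by_contra hcon
    rw [hFo x hcon] at hx
    exact hcon (hx ▸ hx0)
  have hz : h (2 * lam x) x = 0 := by
    have : x - h (2 * lam x) x = x := hx
    simpa using this
  have hxA : x ∈ A := by
    refine ⟨(2 * lam x, x), ⟨⟨⟨?_, ?_⟩, subset_closure hxU⟩, hz⟩, rfl⟩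
    · have := (hl x).1; linarith
    · have := (hl x).2; linarith
  have : lam x = 1 := hl1 hxA
  rw [this, mul_one] at hz
  exact ⟨x, hxU, hz⟩

/-- Linking argument: existence of almost critical points. -/
lemma link {V : Type*} [AddCommGroup V] [Module ℝ V] [TopologicalSpace V] [IsTopologicalAddGroup V]
    [ContinuousSMul ℝ V]
    (A : ℝ → V → ℝ) (D : ℝ → V → V) (hD : Continuous fun p : ℝ × V => D p.1 p.2)
    (Q : V → ℝ) (hQ : ∀ z, 0 ≤ Q z) (η : ℝ) (hη : 0 < η)
    (hdesc : ∀ t ∈ Icc (0:ℝ) 1, ∀ z, ∀ σ ∈ Icc (0:ℝ) 1,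
      A t (z - (σ * η) • D t z) ≤ A t z - σ * (η / 2) * Q (D t z))
    (θ : E → ℝ) (hθ : Continuous θ) (hθI : ∀ x, θ x ∈ Icc (0:ℝ) 1)
    (ζ : E → V) (hζ : Continuous ζ)
    (Pr : ℝ → V → E) (hPr : Continuous fun p : ℝ × V => Pr p.1 p.2)
    (U : Set E) (hU : IsOpen U) (hUb : Bornology.IsBounded U) (x0 : E) (hx0 : x0 ∈ U)
    (β M : ℝ) (hβ : 0 < β)
    (H1 : ∀ x ∈ frontier U, A (θ x) (ζ x) ≤ 0)
    (H1' : ∀ x ∈ frontier U, ∀ c ∈ Icc (0:ℝ) 1, (1 - c) • (x - x0) + c • Pr (θ x) (ζ x) ≠ 0)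
    (H2 : ∀ t ∈ Icc (0:ℝ) 1, ∀ z, Pr t z = 0 → β ≤ A t z)
    (H3 : ∀ x ∈ U, A (θ x) (ζ x) ≤ M) (δ : ℝ) (hδ : 0 < δ) :
    ∃ t ∈ Icc (0:ℝ) 1, ∃ z, Q (D t z) ≤ δ ∧ β ≤ A t z ∧ A t z ≤ M := by
  by_contra hcon
  push Not at hcon
  have hcon' : ∀ t ∈ Icc (0:ℝ) 1, ∀ z, β ≤ A t z → A t z ≤ M → δ < Q (D t z) := by
    intro t ht z h1 h2
    by_contra h3
    exact absurd (hcon t ht z (not_lt.1 h3) h1) (not_lt.2 h2)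
  obtain ⟨k, hk⟩ := exists_nat_gt ((M - β) / (η / 2 * δ))
  have hk' : M - β < k * (η / 2 * δ) := by
    rwa [div_lt_iff₀ (by positivity)] at hk
  let T : ℝ → ℝ → V → V := fun σ t z => z - (σ * η) • D t z
  have hTc : ∀ m : ℕ, Continuous fun p : ℝ × ℝ × V => (T p.1 p.2.1)^[m] p.2.2 := by
    intro m
    induction m with
    | zero => exact continuous_snd.comp continuous_snd
    | succ m ih =>
      simp only [Function.iterate_succ_apply', T] at ih ⊢
      refine ih.sub ?_
      refine (continuous_fst.mul continuous_const).smul ?_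
      exact hD.comp ((continuous_fst.comp continuous_snd).prodMk ih)
  have hmono : ∀ σ ∈ Icc (0:ℝ) 1, ∀ t ∈ Icc (0:ℝ) 1, ∀ z, A t (T σ t z) ≤ A t z := by
    intro σ hσ t ht z
    refine (hdesc t ht z σ hσ).trans ?_
    have : 0 ≤ σ * (η / 2) * Q (D t z) := mul_nonneg (mul_nonneg hσ.1 (by positivity)) (hQ _)
    linarith
  have hmono' : ∀ σ ∈ Icc (0:ℝ) 1, ∀ t ∈ Icc (0:ℝ) 1, ∀ z, ∀ m : ℕ,
      A t ((T σ t)^[m] z) ≤ A t z := by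
    intro σ hσ t ht z m
    induction m with
    | zero => exact le_rfl
    | succ m ih =>
      rw [Function.iterate_succ_apply']
      exact (hmono σ hσ t ht _).trans ih
  have hT0 : ∀ t z, ∀ m : ℕ, (T 0 t)^[m] z = z := by
    intro t z m
    have : T 0 t = id := by ext z; simp [T]
    rw [this]; simp
  let h : ℝ → E → E := fun τ x => (1 - min τ 1) • (x - x0) +
    (min τ 1) • Pr (θ x) ((T (max (τ - 1) 0) (θ x))^[k] (ζ x))
  have hcont : Continuous fun p : ℝ × E => h p.1 p.2 := by
    simp only [h]
    have hc2 : Continuous fun p : ℝ × E => (T (max (p.1 - 1) 0) (θ p.2))^[k] (ζ p.2) :=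
      (hTc k).comp (f := fun p : ℝ × E => (max (p.1 - 1) 0, θ p.2, ζ p.2)) (by fun_prop)
    have hc3 : Continuous fun p : ℝ × E => Pr (θ p.2) ((T (max (p.1 - 1) 0) (θ p.2))^[k] (ζ p.2)) :=
      hPr.comp ((hθ.comp continuous_snd).prodMk hc2)
    fun_prop
  have hstart : ∀ x, h 0 x = x - x0 := by
    intro x
    simp [h]
  have hfr : ∀ τ ∈ Icc (0:ℝ) 2, ∀ x ∈ frontier U, h τ x ≠ 0 := by
    intro τ hτ x hx
    rcases le_total τ 1 with h1 | h1
    · simp only [h, min_eq_left h1, max_eq_right (show τ - 1 ≤ 0 by linarith), hT0]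
      exact H1' x hx τ ⟨hτ.1, h1⟩
    · simp only [h, min_eq_right h1, sub_self, zero_smul, one_smul, zero_add]
      intro h0
      have h2 := H2 _ (hθI x) _ h0
      have h3 := hmono' (max (τ - 1) 0) ⟨le_max_right _ _, max_le (by linarith [hτ.2]) zero_le_one⟩
        _ (hθI x) (ζ x) k
      linarith [H1 x hx]
  obtain ⟨x, hxU, hx⟩ := continuation h hcont x0 hstart U hU hUb hfr hx0
  have hx' : Pr (θ x) ((T 1 (θ x))^[k] (ζ x)) = 0 := by
    have h2 : min (2:ℝ) 1 = 1 := by norm_num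
    have h3 : max ((2:ℝ) - 1) 0 = 1 := by norm_num
    simp only [h, h2, h3, sub_self, zero_smul, one_smul, zero_add] at hx
    exact hx
  have hend := H2 _ (hθI x) _ hx'
  have h01 : (1:ℝ) ∈ Icc (0:ℝ) 1 := ⟨zero_le_one, le_rfl⟩
  have hlow : ∀ m ≤ k, β ≤ A (θ x) ((T 1 (θ x))^[m] (ζ x)) := by
    intro m hm
    refine hend.trans ?_
    obtain ⟨j, rfl⟩ := Nat.exists_eq_add_of_le hm
    rw [Nat.add_comm m j, Function.iterate_add_apply]
    exact hmono' 1 h01 _ (hθI x) _ _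
  have hdec : ∀ m ≤ k, A (θ x) ((T 1 (θ x))^[m] (ζ x)) ≤ M - m * (η / 2 * δ) := by
    intro m
    induction m with
    | zero => intro _; simpa using H3 x hxU
    | succ m ih =>
      intro hm
      have h4 := ih (by omega)
      have h5 := hlow m (by omega)
      have h6 : A (θ x) ((T 1 (θ x))^[m] (ζ x)) ≤ M := by
        refine h4.trans ?_
        have : 0 ≤ (m:ℝ) * (η / 2 * δ) := by positivity
        linarith
      have h7 := hcon' _ (hθI x) _ h5 h6
      rw [Function.iterate_succ_apply']
      have h8 := hdesc _ (hθI x) ((T 1 (θ x))^[m] (ζ x)) 1 h01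
      simp only [T] at h8 h7 h4 ⊢
      refine h8.trans ?_
      push_cast
      have h9 := mul_le_mul_of_nonneg_left h7.le (show 0 ≤ η / 2 by positivity)
      linarith
  have := hdec k le_rfl
  linarith [hlow k le_rfl]

end Camel
end

section
namespace Camel
open Metric MeasureTheory
set_option linter.unusedSectionVars false
set_option linter.unusedSimpArgs false

/-! ### Trigonometric loops -/

/-- The exponentials. -/
def ee (k : ℤ) (s : ℝ) : ℂ := Complex.exp (2 * Real.pi * Complex.I * k * s)

lemma ee_continuous (k : ℤ) : Continuous (ee k) := by
  unfold ee; fun_prop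

lemma ee_norm (k : ℤ) (s : ℝ) : ‖ee k s‖ = 1 := by
  unfold ee
  have : (2 * Real.pi * Complex.I * k * s : ℂ) = ((2 * Real.pi * k * s : ℝ) : ℂ) * Complex.I := by
    push_cast; ring
  rw [this, Complex.norm_exp_ofReal_mul_I]

lemma ee_zero (s : ℝ) : ee 0 s = 1 := by simp [ee]

lemma ee_add (k l : ℤ) (s : ℝ) : ee (k + l) s = ee k s * ee l s := by
  unfold ee
  rw [← Complex.exp_add]
  congr 1
  push_cast; ring

lemma ee_conj (k : ℤ) (s : ℝ) : (starRingEnd ℂ) (ee k s) = ee (-k) s := by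
  unfold ee
  rw [← Complex.exp_conj]
  congr 1
  have h2 : (starRingEnd ℂ) (2:ℂ) = 2 := Complex.conj_ofNat 2
  simp [map_mul, h2]

lemma ee_integral (k : ℤ) : ∫ s in (0:ℝ)..1, ee k s = if k = 0 then 1 else 0 := by
  split_ifs with h
  · subst h; simp [ee_zero]
  · unfold ee
    have hk : (2 * Real.pi * Complex.I * k : ℂ) ≠ 0 := by
      simp [Real.pi_ne_zero, h]
    rw [integral_exp_mul_complex hk]
    have : Complex.exp (2 * Real.pi * Complex.I * k * (1:ℝ)) = 1 := by
      rw [Complex.exp_eq_one_iff]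
      exact ⟨k, by push_cast; ring⟩
    rw [this]
    simp

variable {X : Type*} [NormedAddCommGroup X] [InnerProductSpace ℂ X]

/-- Real part of the hermitian product. -/
def rip (x y : X) : ℝ := (inner ℂ x y).re

lemma rip_self (x : X) : rip x x = ‖x‖ ^ 2 := by
  unfold rip; exact inner_self_eq_norm_sq (𝕜 := ℂ) x

lemma rip_comm (x y : X) : rip x y = rip y x := by
  unfold rip; rw [← inner_conj_symm, Complex.conj_re]

lemma rip_add_left (x y z : X) : rip (x + y) z = rip x z + rip y z := by
  simp [rip, inner_add_left]

lemma rip_add_right (x y z : X) : rip x (y + z) = rip x y + rip x z := by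
  simp [rip, inner_add_right]

lemma rip_sub_left (x y z : X) : rip (x - y) z = rip x z - rip y z := by
  simp [rip, inner_sub_left]

lemma rip_sub_right (x y z : X) : rip x (y - z) = rip x y - rip x z := by
  simp [rip, inner_sub_right]

lemma rip_neg_left (x y : X) : rip (-x) y = - rip x y := by simp [rip]

lemma rip_neg_right (x y : X) : rip x (-y) = - rip x y := by simp [rip]

lemma rip_zero_left (y : X) : rip 0 y = 0 := by simp [rip]

lemma rip_zero_right (y : X) : rip y 0 = 0 := by simp [rip]

lemma rip_smul_left (r : ℝ) (x y : X) : rip (r • x) y = r * rip x y := by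
  have : r • x = (r : ℂ) • x := (Complex.coe_smul r x).symm
  rw [this]
  simp [rip, inner_smul_left]

lemma rip_smul_right (r : ℝ) (x y : X) : rip x (r • y) = r * rip x y := by
  rw [rip_comm, rip_smul_left, rip_comm]

lemma rip_add_sq (x y : X) : ‖x + y‖ ^ 2 = ‖x‖ ^ 2 + 2 * rip x y + ‖y‖ ^ 2 :=
  norm_add_sq (𝕜 := ℂ) x y

lemma rip_sub_sq (x y : X) : ‖x - y‖ ^ 2 = ‖x‖ ^ 2 - 2 * rip x y + ‖y‖ ^ 2 :=
  norm_sub_sq (𝕜 := ℂ) x y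

lemma rip_le (x y : X) : |rip x y| ≤ ‖x‖ * ‖y‖ := by
  unfold rip
  exact (Complex.abs_re_le_norm _).trans (norm_inner_le_norm x y)

lemma rip_I_self (x : X) : rip (Complex.I • x) x = 0 := by
  unfold rip
  rw [inner_smul_left, inner_self_eq_norm_sq_to_K]
  simp [← Complex.ofReal_pow]

lemma rip_I_I (x y : X) : rip (Complex.I • x) (Complex.I • y) = rip x y := by
  unfold rip
  rw [inner_smul_left, inner_smul_right]
  simp [← mul_assoc]

lemma rip_continuous : Continuous fun p : X × X => rip p.1 p.2 := by
  unfold rip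
  fun_prop

lemma _root_.Continuous.rip' {T : Type*} [TopologicalSpace T] {f g : T → X} (hf : Continuous f)
    (hg : Continuous g) : Continuous fun t => rip (f t) (g t) :=
  rip_continuous.comp (hf.prodMk hg)

/-- Trigonometric polynomial with coefficients `z`. -/
def loop (N : ℕ) (z : ℤ → X) (s : ℝ) : X := ∑ k ∈ Finset.Icc (-(N:ℤ)) N, ee k s • z k

/-- Fourier coefficient. -/
def fc (k : ℤ) (y : ℝ → X) : X := ∫ s in (0:ℝ)..1, ee (-k) s • y s

lemma loop_continuous2 (N : ℕ) : Continuous fun p : (ℤ → X) × ℝ => loop N p.1 p.2 := by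
  unfold loop
  refine continuous_finsetSum _ fun k _ => ?_
  exact ((ee_continuous k).comp continuous_snd).smul ((continuous_apply k).comp continuous_fst)

lemma loop_continuous (N : ℕ) (z : ℤ → X) : Continuous (loop N z) :=
  (loop_continuous2 N).comp (f := fun s => (z, s)) (by fun_prop)

lemma loop_sub_smul (N : ℕ) (z w : ℤ → X) (c s : ℝ) :
    loop N (z - c • w) s = loop N z s - c • loop N w s := by
  unfold loop
  rw [Finset.smul_sum, ← Finset.sum_sub_distrib]
  refine Finset.sum_congr rfl fun k _ => ?_
  simp only [Pi.sub_apply, Pi.smul_apply, smul_sub]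
  rw [smul_comm]

variable [CompleteSpace X]

lemma fc_loop (N : ℕ) (z : ℤ → X) {k : ℤ} (hk : k ∈ Finset.Icc (-(N:ℤ)) N) :
    fc k (loop N z) = z k := by
  unfold fc loop
  have h1 : ∀ s : ℝ, ee (-k) s • ∑ l ∈ Finset.Icc (-(N:ℤ)) N, ee l s • z l =
      ∑ l ∈ Finset.Icc (-(N:ℤ)) N, ee (l - k) s • z l := by
    intro s
    rw [Finset.smul_sum]
    refine Finset.sum_congr rfl fun l _ => ?_
    rw [smul_smul, ← ee_add]; congr 2; ring
  simp_rw [h1]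
  rw [intervalIntegral.integral_finsetSum]
  · have h2 : ∀ l, ∫ s in (0:ℝ)..1, ee (l - k) s • z l = (if l = k then (1:ℂ) else 0) • z l := by
      intro l
      rw [intervalIntegral.integral_smul_const, ee_integral]
      simp [sub_eq_zero]
    simp_rw [h2]
    simp only [ite_smul, one_smul, zero_smul, Finset.sum_ite_eq', hk, if_true]
  · intro l _
    exact (((ee_continuous _).smul continuous_const).intervalIntegrable _ _)

lemma rip_fc (y : ℝ → X) (hy : Continuous y) (k : ℤ) (w : X) :
    ∫ s in (0:ℝ)..1, rip (y s) (ee k s • w) = rip (fc k y) w := by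
  unfold fc
  have h0 : ∀ s, rip (y s) (ee k s • w) = Complex.reCLM (innerSL ℂ w (ee (-k) s • y s)) := by
    intro s
    simp only [innerSL_apply_apply, Complex.reCLM_apply]
    rw [rip_comm, rip, inner_smul_left, inner_smul_right, ee_conj]
  simp_rw [h0]
  have hc : Continuous fun s => ee (-k) s • y s := (ee_continuous _).smul hy
  have hc2 : Continuous fun s => (innerSL ℂ w) (ee (-k) s • y s) := (innerSL ℂ w).continuous.comp hc
  rw [ContinuousLinearMap.intervalIntegral_comp_comm _ (hc2.intervalIntegrable _ _),
    ContinuousLinearMap.intervalIntegral_comp_comm _ (hc.intervalIntegrable _ _)]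
  rw [rip_comm, rip]
  rfl

lemma integral_rip_loop (N : ℕ) (y : ℝ → X) (hy : Continuous y) (w : ℤ → X) :
    ∫ s in (0:ℝ)..1, rip (y s) (loop N w s) =
      ∑ k ∈ Finset.Icc (-(N:ℤ)) N, rip (fc k y) (w k) := by
  have h0 : ∀ s, rip (y s) (loop N w s) =
      ∑ k ∈ Finset.Icc (-(N:ℤ)) N, rip (y s) (ee k s • w k) := by
    intro s
    simp [rip, loop, inner_sum]
  simp_rw [h0]
  rw [intervalIntegral.integral_finsetSum]
  · simp_rw [rip_fc y hy]
  · intro k _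
    exact (hy.rip' ((ee_continuous k).smul continuous_const)).intervalIntegrable _ _

lemma integral_norm_loop (N : ℕ) (w : ℤ → X) :
    ∫ s in (0:ℝ)..1, ‖loop N w s‖ ^ 2 = ∑ k ∈ Finset.Icc (-(N:ℤ)) N, ‖w k‖ ^ 2 := by
  simp_rw [← rip_self]
  rw [integral_rip_loop N _ (loop_continuous N w)]
  refine Finset.sum_congr rfl fun k hk => ?_
  rw [fc_loop N w hk]

lemma bessel (N : ℕ) (y : ℝ → X) (hy : Continuous y) :
    ∑ k ∈ Finset.Icc (-(N:ℤ)) N, ‖fc k y‖ ^ 2 ≤ ∫ s in (0:ℝ)..1, ‖y s‖ ^ 2 := by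
  let w : ℤ → X := fun k => fc k y
  have h0 : 0 ≤ ∫ s in (0:ℝ)..1, ‖y s - loop N w s‖ ^ 2 :=
    intervalIntegral.integral_nonneg zero_le_one fun s _ => by positivity
  have hl := loop_continuous N w
  simp_rw [rip_sub_sq] at h0
  rw [intervalIntegral.integral_add, intervalIntegral.integral_sub,
    intervalIntegral.integral_const_mul, integral_rip_loop N y hy, integral_norm_loop] at h0
  · simp only [w, rip_self] at h0
    linarith
  · exact (hy.norm.pow 2).intervalIntegrable _ _
  · exact (continuous_const.mul (hy.rip' hl)).intervalIntegrable _ _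
  · exact ((hy.norm.pow 2).sub (continuous_const.mul (hy.rip' hl))).intervalIntegrable _ _
  · exact (hl.norm.pow 2).intervalIntegrable _ _

/-! ### The action functional -/

/-- Galerkin approximation of the action. -/
def act (G : ℝ → X → ℝ) (N : ℕ) (t : ℝ) (z : ℤ → X) : ℝ :=
  Real.pi * ∑ k ∈ Finset.Icc (-(N:ℤ)) N, (k:ℝ) * ‖z k‖ ^ 2 - ∫ s in (0:ℝ)..1, G t (loop N z s)

/-- Its gradient. -/
def grd (Y : ℝ → X → X) (N : ℕ) (t : ℝ) (z : ℤ → X) (k : ℤ) : X :=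
  if k ∈ Finset.Icc (-(N:ℤ)) N then
    (2 * Real.pi * k : ℝ) • z k - fc k (fun s => Y t (loop N z s)) else 0

/-- Squared norm of the first modes. -/
def qn (N : ℕ) (z : ℤ → X) : ℝ := ∑ k ∈ Finset.Icc (-(N:ℤ)) N, ‖z k‖ ^ 2

lemma qn_nonneg (N : ℕ) (z : ℤ → X) : 0 ≤ qn N z := Finset.sum_nonneg fun _ _ => by positivity

lemma grd_continuous (Y : ℝ → X → X) (hY : Continuous fun p : ℝ × X => Y p.1 p.2) (N : ℕ) :
    Continuous fun p : ℝ × (ℤ → X) => grd Y N p.1 p.2 := by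
  refine continuous_pi fun k => ?_
  unfold grd
  split_ifs with h
  · refine Continuous.sub (by fun_prop) ?_
    unfold fc
    refine intervalIntegral.continuous_parametric_intervalIntegral_of_continuous' ?_ _ _
    unfold Function.uncurry
    refine ((ee_continuous _).comp continuous_snd).smul ?_
    refine hY.comp ((continuous_fst.comp continuous_fst).prodMk ?_)
    exact (loop_continuous2 N).comp ((continuous_snd.comp continuous_fst).prodMk continuous_snd)
  · exact continuous_const

lemma act_descent (G : ℝ → X → ℝ) (Y : ℝ → X → X) (hG : Continuous fun p : ℝ × X => G p.1 p.2)
    (hY : Continuous fun p : ℝ × X => Y p.1 p.2) (L : ℝ) (hL : 0 ≤ L) (t : ℝ)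
    (hsc : ∀ x y, G t x + rip (Y t x) y - L * ‖y‖ ^ 2 ≤ G t (x + y)) (N : ℕ) (η : ℝ)
    (hη : 0 < η) (hη2 : η * (Real.pi * N + L) ≤ 1 / 2) (z : ℤ → X) (σ : ℝ)
    (hσ : σ ∈ Icc (0:ℝ) 1) :
    act G N t (z - (σ * η) • grd Y N t z) ≤
      act G N t z - σ * (η / 2) * qn N (grd Y N t z) := by
  set D := grd Y N t z with hD
  set c := σ * η with hc
  have hc0 : 0 ≤ c := mul_nonneg hσ.1 hη.le
  have hGt : Continuous (G t) := hG.comp (f := fun x => (t, x)) (by fun_prop)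
  have hYt : Continuous (Y t) := hY.comp (f := fun x => (t, x)) (by fun_prop)
  have hz := loop_continuous N z
  have hd := loop_continuous N D
  -- the integral part
  have h1 : (∫ s in (0:ℝ)..1, G t (loop N z s)) -
      c * (∑ k ∈ Finset.Icc (-(N:ℤ)) N, rip (fc k fun s => Y t (loop N z s)) (D k)) -
      L * c ^ 2 * qn N D ≤ ∫ s in (0:ℝ)..1, G t (loop N (z - c • D) s) := by
    rw [← integral_rip_loop N (fun s => Y t (loop N z s)) (hYt.comp hz), qn, ← integral_norm_loop,
      ← intervalIntegral.integral_const_mul, ← intervalIntegral.integral_const_mul,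
      ← intervalIntegral.integral_sub, ← intervalIntegral.integral_sub]
    · refine intervalIntegral.integral_mono_on zero_le_one ?_ ?_ fun s _ => ?_
      · refine Continuous.intervalIntegrable ?_ _ _
        exact ((hGt.comp hz).sub (continuous_const.mul ((hYt.comp hz).rip' hd))).sub
          (continuous_const.mul (hd.norm.pow 2))
      · exact (hGt.comp (loop_continuous N _)).intervalIntegrable _ _
      · rw [loop_sub_smul]
        have h2 := hsc (loop N z s) (-(c • loop N D s))
        rw [← sub_eq_add_neg, rip_neg_right, rip_smul_right, norm_neg, norm_smul, Real.norm_eq_abs,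
          abs_of_nonneg hc0] at h2
        linarith
    · refine Continuous.intervalIntegrable ?_ _ _
      exact ((hGt.comp hz).sub (continuous_const.mul ((hYt.comp hz).rip' hd)))
    · exact (continuous_const.mul (hd.norm.pow 2)).intervalIntegrable _ _
    · exact (hGt.comp hz).intervalIntegrable _ _
    · exact (continuous_const.mul ((hYt.comp hz).rip' hd)).intervalIntegrable _ _
  -- the quadratic part
  have h2 : Real.pi * ∑ k ∈ Finset.Icc (-(N:ℤ)) N, (k:ℝ) * ‖(z - c • D) k‖ ^ 2 ≤
      Real.pi * ∑ k ∈ Finset.Icc (-(N:ℤ)) N, (k:ℝ) * ‖z k‖ ^ 2 -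
      c * (∑ k ∈ Finset.Icc (-(N:ℤ)) N, rip ((2 * Real.pi * k : ℝ) • z k) (D k)) +
      Real.pi * N * c ^ 2 * qn N D := by
    unfold qn
    simp only [Finset.mul_sum]
    rw [← Finset.sum_sub_distrib, ← Finset.sum_add_distrib]
    refine Finset.sum_le_sum fun k hk => ?_
    have hk' : (k:ℝ) ≤ N := by exact_mod_cast (Finset.mem_Icc.1 hk).2
    rw [Pi.sub_apply, Pi.smul_apply, rip_sub_sq, rip_smul_right, rip_smul_left, norm_smul,
      Real.norm_eq_abs, abs_of_nonneg hc0]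
    have h3 : Real.pi * k * (c ^ 2 * ‖D k‖ ^ 2) ≤ Real.pi * N * (c ^ 2 * ‖D k‖ ^ 2) := by
      have := Real.pi_pos
      gcongr
    linarith
  have h3 : (∑ k ∈ Finset.Icc (-(N:ℤ)) N, rip ((2 * Real.pi * k : ℝ) • z k) (D k)) -
      (∑ k ∈ Finset.Icc (-(N:ℤ)) N, rip (fc k fun s => Y t (loop N z s)) (D k)) = qn N D := by
    rw [← Finset.sum_sub_distrib]
    refine Finset.sum_congr rfl fun k hk => ?_
    rw [← rip_sub_left, ← rip_self]
    congr 1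
    rw [hD, grd, if_pos hk]
  have h4 : c ^ 2 * (Real.pi * N + L) ≤ c / 2 := by
    have h5 : c * (Real.pi * N + L) ≤ 1 / 2 := by
      refine le_trans ?_ hη2
      rw [hc, mul_assoc]
      refine mul_le_of_le_one_left ?_ hσ.2
      have := Real.pi_pos
      positivity
    nlinarith
  have h6 := mul_le_mul_of_nonneg_right h4 (qn_nonneg N D)
  unfold act
  have h7 : c * (∑ k ∈ Finset.Icc (-(N:ℤ)) N, rip ((2 * Real.pi * k : ℝ) • z k) (D k)) -
      c * (∑ k ∈ Finset.Icc (-(N:ℤ)) N, rip (fc k fun s => Y t (loop N z s)) (D k))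
      = c * qn N D := by rw [← mul_sub, h3]
  have h8 : σ * (η / 2) * qn N D = c / 2 * qn N D := by rw [hc]; ring
  rw [h8]
  linarith

end Camel
end

section
namespace Camel
open Metric MeasureTheory
set_option linter.unusedSectionVars false
set_option linter.unusedSimpArgs false

lemma sum_Icc_split {M : Type*} [AddCommMonoid M] (f : ℤ → M) (N : ℕ) :
    ∑ k ∈ Finset.Icc (-(N:ℤ)) N, f k =
      f 0 + ∑ m ∈ Finset.range N, (f ((m:ℤ) + 1) + f (-((m:ℤ) + 1))) := by
  induction N with
  | zero => simp
  | succ N ih =>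
    have : Finset.Icc (-((N+1:ℕ):ℤ)) ((N+1:ℕ):ℤ) =
        insert (-((N:ℤ) + 1)) (insert ((N:ℤ)+1) (Finset.Icc (-(N:ℤ)) N)) := by
      ext k; simp; omega
    rw [this, Finset.sum_insert (by simp; omega), Finset.sum_insert (by simp), ih,
      Finset.sum_range_succ]
    abel

variable {X : Type*} [NormedAddCommGroup X] [InnerProductSpace ℂ X]

/-- The loops of the linking family. -/
def zeta (ea eb : X) (y : ℕ → X) (s : ℝ) (k : ℤ) : X :=
  if k < 0 then y k.natAbs else
  if k = 0 then y 0 - ((inner ℂ eb (y 0)).re : ℂ) • eb else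
  (-(starRingEnd ℂ) (inner ℂ eb (y k.natAbs))) • eb + (if k = 1 then (s:ℂ) else 0) • ea

section
variable {ea eb : X} (y : ℕ → X) (s : ℝ)

lemma zeta_zero : zeta ea eb y s 0 = y 0 - ((inner ℂ eb (y 0)).re : ℂ) • eb := by simp [zeta]

lemma zeta_neg (m : ℕ) : zeta ea eb y s (-((m:ℤ)+1)) = y (m+1) := by
  have h1 : (-((m:ℤ)+1)).natAbs = m + 1 := by omega
  simp only [zeta, h1]
  rw [if_pos (by omega)]

lemma zeta_pos (m : ℕ) : zeta ea eb y s ((m:ℤ)+1) =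
    (-(starRingEnd ℂ) (inner ℂ eb (y (m+1)))) • eb + (if m = 0 then (s:ℂ) else 0) • ea := by
  have h1 : ((m:ℤ)+1).natAbs = m + 1 := by omega
  have h2 : ((m:ℤ)+1 = 1) = (m = 0) := by simp
  simp only [zeta, h1, h2]
  rw [if_neg (by omega), if_neg (by omega)]

lemma norm_sq_comb (ha : ‖ea‖ = 1) (hb : ‖eb‖ = 1) (hab : inner ℂ ea eb = 0) (u v : ℂ) : ‖u • eb + v • ea‖ ^ 2 = ‖u‖ ^ 2 + ‖v‖ ^ 2 := by
  rw [rip_add_sq, norm_smul, norm_smul, ha, hb]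
  have : inner ℂ eb ea = 0 := by rw [← inner_conj_symm, hab, map_zero]
  simp [rip, inner_smul_left, inner_smul_right, this]

lemma zeta_re (hb : ‖eb‖ = 1) (hba : inner ℂ eb ea = 0) (y : ℕ → X) (s : ℝ) (N : ℕ) (σ : ℝ) : (inner ℂ eb (loop N (zeta ea eb y s) σ)).re = 0 := by
  have hbb : inner ℂ eb eb = (1:ℂ) := by rw [inner_self_eq_norm_sq_to_K, hb]; simp
  unfold loop
  rw [inner_sum, sum_Icc_split, Complex.add_re, Complex.re_sum, zeta_zero]
  simp only [inner_smul_right, zeta_neg, zeta_pos, inner_add_right, inner_sub_right, hbb, hba,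
    ee_zero, Complex.add_re]
  rw [Finset.sum_eq_zero]
  · simp
  · intro m _
    rw [← ee_conj ((m:ℤ)+1)]
    simp [-inner_conj_symm]

lemma zeta_quad (ha : ‖ea‖ = 1) (hb : ‖eb‖ = 1) (hab : inner ℂ ea eb = 0) (y : ℕ → X) (s : ℝ) (N : ℕ) :
    ∑ k ∈ Finset.Icc (-(N:ℤ)) N, (k:ℝ) * ‖zeta ea eb y s k‖ ^ 2 ≤ s ^ 2 := by
  rw [sum_Icc_split]
  simp only [Int.cast_zero, zero_mul, zero_add]
  have : ∀ m ∈ Finset.range N, (((((m:ℤ)+1 : ℤ)):ℝ) * ‖zeta ea eb y s ((m:ℤ)+1)‖ ^ 2 +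
      ((-((m:ℤ)+1) : ℤ):ℝ) * ‖zeta ea eb y s (-((m:ℤ)+1))‖ ^ 2) ≤ if m = 0 then s ^ 2 else 0 := by
    intro m _
    rw [zeta_neg, zeta_pos, norm_sq_comb ha hb hab]
    have h1 : ‖inner ℂ eb (y (m+1))‖ ≤ ‖y (m+1)‖ := by
      simpa [hb] using norm_inner_le_norm (𝕜 := ℂ) eb (y (m+1))
    have h2 : ‖inner ℂ eb (y (m+1))‖ ^ 2 ≤ ‖y (m+1)‖ ^ 2 := by gcongr
    rw [norm_neg, RCLike.norm_conj]
    have h3 : (0:ℝ) ≤ (m:ℝ) + 1 := by positivity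
    have h4 := mul_le_mul_of_nonneg_left h2 h3
    push_cast
    split_ifs with hm
    · subst hm
      simp
      simp at h2
      linarith
    · simp
      nlinarith
  refine (Finset.sum_le_sum this).trans ?_
  rw [Finset.sum_ite_eq']
  split_ifs
  · exact le_rfl
  · positivity

lemma zeta_qn_s (ha : ‖ea‖ = 1) (hb : ‖eb‖ = 1) (hab : inner ℂ ea eb = 0) (y : ℕ → X) (s : ℝ) (N : ℕ) (hN : 1 ≤ N) : s ^ 2 ≤ qn N (zeta ea eb y s) := by
  have h1 : ‖zeta ea eb y s 1‖ ^ 2 ≤ qn N (zeta ea eb y s) := by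
    unfold qn
    exact Finset.single_le_sum (f := fun k => ‖zeta ea eb y s k‖ ^ 2) (fun _ _ => by positivity)
      (Finset.mem_Icc.2 ⟨by omega, by omega⟩)
  have h2 := zeta_pos (ea := ea) (eb := eb) y s 0
  simp only [Nat.cast_zero, zero_add, if_true] at h2
  rw [h2, norm_sq_comb ha hb hab] at h1
  have : ‖(s:ℂ)‖ ^ 2 = s ^ 2 := by simp
  rw [this] at h1
  nlinarith [sq_nonneg ‖-(starRingEnd ℂ) (inner ℂ eb (y 1))‖]

lemma zeta_qn_y (hb : ‖eb‖ = 1) (y : ℕ → X) (s : ℝ) (N : ℕ) (m : ℕ) (hm : m ≤ N) :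
    ‖y m‖ ^ 2 - (inner ℂ eb (y 0)).re ^ 2 ≤ qn N (zeta ea eb y s) := by
  have h1 : ‖zeta ea eb y s (-(m:ℤ))‖ ^ 2 ≤ qn N (zeta ea eb y s) := by
    unfold qn
    exact Finset.single_le_sum (f := fun k => ‖zeta ea eb y s k‖ ^ 2) (fun _ _ => by positivity)
      (Finset.mem_Icc.2 ⟨by omega, by omega⟩)
  refine le_trans ?_ h1
  rcases m with _ | m
  · have h3 : (-((0:ℕ):ℤ)) = 0 := by simp
    rw [h3, zeta_zero, rip_sub_sq, norm_smul, hb]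
    simp [rip, inner_smul_right]
    rw [← inner_conj_symm, Complex.conj_re]
    nlinarith
  · have h3 : (-((m+1:ℕ):ℤ)) = -((m:ℤ)+1) := by push_cast; ring
    rw [h3, zeta_neg]
    nlinarith [sq_nonneg (inner ℂ eb (y 0)).re]

lemma zeta_a (ha : ‖ea‖ = 1) (hab : inner ℂ ea eb = 0) (y : ℕ → X) (s : ℝ) [CompleteSpace X] (N : ℕ) (hN : 1 ≤ N) :
    s ^ 2 ≤ ∫ σ in (0:ℝ)..1, ‖inner ℂ ea (loop N (zeta ea eb y s) σ)‖ ^ 2 := by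
  have haa : inner ℂ ea ea = (1:ℂ) := by rw [inner_self_eq_norm_sq_to_K, ha]; simp
  set z := zeta ea eb y s with hz
  have h0 : ∀ σ, ‖inner ℂ ea (loop N z σ)‖ = ‖loop N (fun k => (inner ℂ ea (z k)) • ea) σ‖ := by
    intro σ
    have : loop N (fun k => (inner ℂ ea (z k)) • ea) σ = (inner ℂ ea (loop N z σ)) • ea := by
      unfold loop
      rw [inner_sum, Finset.sum_smul]
      refine Finset.sum_congr rfl fun k _ => ?_
      rw [inner_smul_right, smul_smul]
    rw [this, norm_smul, ha, mul_one]
  simp_rw [h0]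
  rw [integral_norm_loop]
  have h1 : ‖(inner ℂ ea (z 1)) • ea‖ ^ 2 ≤
      ∑ k ∈ Finset.Icc (-(N:ℤ)) N, ‖(inner ℂ ea (z k)) • ea‖ ^ 2 :=
    Finset.single_le_sum (f := fun k => ‖(inner ℂ ea (z k)) • ea‖ ^ 2) (fun _ _ => by positivity)
      (Finset.mem_Icc.2 ⟨by omega, by omega⟩)
  refine le_trans ?_ h1
  have h2 := zeta_pos (ea := ea) (eb := eb) y s 0
  simp only [Nat.cast_zero, zero_add, if_true] at h2
  rw [hz, h2, inner_add_right, inner_smul_right, inner_smul_right, hab, haa, norm_smul, ha]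
  simp

lemma zeta_continuous : Continuous fun p : (ℕ → X) × ℝ => zeta ea eb p.1 p.2 := by
  refine continuous_pi fun k => ?_
  unfold zeta
  split_ifs <;> fun_prop

end

/-- The hypotheses on a family of Hamiltonians. -/
structure IsHam (ea eb : X) (G : ℝ → X → ℝ) (Y : ℝ → X → X) (c : ℝ → X) (C δ ε L : ℝ) : Prop where
  ha : ‖ea‖ = 1
  hb : ‖eb‖ = 1
  hab : inner ℂ ea eb = 0
  contG : Continuous fun p : ℝ × X => G p.1 p.2
  contY : Continuous fun p : ℝ × X => Y p.1 p.2
  contc : Continuous c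
  hC : 0 < C
  hδ : 0 < δ
  hε : 0 < ε
  hL : 0 ≤ L
  semi : ∀ t ∈ Icc (0:ℝ) 1, ∀ x y, G t x + rip (Y t x) y - L * ‖y‖ ^ 2 ≤ G t (x + y)
  zero : ∀ t ∈ Icc (0:ℝ) 1, ∀ x, ‖x - c t‖ ≤ δ → G t x = 0
  quad : ∀ t ∈ Icc (0:ℝ) 1, ∀ x, G t x ≤ C * (1 + ‖x - c t‖ ^ 2)
  c0 : (inner ℂ eb (c 0)).re < 0
  c1 : 0 < (inner ℂ eb (c 1)).re
  plane : ∀ t ∈ Icc (0:ℝ) 1, ∀ x, (inner ℂ eb x).re = 0 → 0 ≤ G t x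
  plane' : ∀ t ∈ Icc (0:ℝ) 1, ∀ x, (inner ℂ eb x).re = 0 →
    Real.pi * ‖inner ℂ ea x‖ ^ 2 + ε * ‖x‖ ^ 2 - C ≤ G t x
  plane0 : ∀ x, (inner ℂ eb x).re = 0 → Real.pi * ‖inner ℂ ea x‖ ^ 2 ≤ G 0 x
  plane1 : ∀ x, (inner ℂ eb x).re = 0 → Real.pi * ‖inner ℂ ea x‖ ^ 2 ≤ G 1 x

section
variable {ea eb : X} {G : ℝ → X → ℝ} {Y : ℝ → X → X} {c : ℝ → X} {C δ ε L : ℝ}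

lemma IsHam.hba (H : IsHam ea eb G Y c C δ ε L) : inner ℂ eb ea = 0 := by
  rw [← inner_conj_symm, H.hab, map_zero]

lemma IsHam.hbb (H : IsHam ea eb G Y c C δ ε L) : inner ℂ eb eb = (1:ℂ) := by
  rw [inner_self_eq_norm_sq_to_K, H.hb]; simp

lemma IsHam.contGt (H : IsHam ea eb G Y c C δ ε L) (t : ℝ) : Continuous (G t) :=
  H.contG.comp (f := fun x => (t, x)) (by fun_prop)

lemma IsHam.contYt (H : IsHam ea eb G Y c C δ ε L) (t : ℝ) : Continuous (Y t) :=
  H.contY.comp (f := fun x => (t, x)) (by fun_prop)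

/-- Positivity of the action on the half space of positive modes. -/
lemma IsHam.act_lower [CompleteSpace X] (H : IsHam ea eb G Y c C δ ε L) :
    ∃ α0 : ℝ, 0 < α0 ∧ ∀ α : ℝ, 0 < α → α ≤ α0 → ∀ (N : ℕ), ∀ t ∈ Icc (0:ℝ) 1, ∀ z : ℤ → X,
      (∀ m : ℕ, m < N → z (-((m:ℤ)+1)) = 0) → z 0 = c t →
      (∑ m ∈ Finset.range N, ((m:ℝ)+1) * ‖z ((m:ℤ)+1)‖ ^ 2 = α ^ 2) →
      Real.pi / 2 * α ^ 2 ≤ act G N t z := by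
  -- quadratic bound outside of the `δ` ball
  obtain ⟨B, hB, hGB⟩ : ∃ B : ℝ, 0 < B ∧ ∀ t ∈ Icc (0:ℝ) 1, ∀ x, δ ≤ ‖x - c t‖ →
      G t x ≤ B * ‖x - c t‖ ^ 2 := by
    refine ⟨C * (1 / δ ^ 2 + 1), by have := H.hC; have := H.hδ; positivity, fun t ht x hx => ?_⟩
    refine (H.quad t ht x).trans ?_
    rw [mul_assoc]
    refine mul_le_mul_of_nonneg_left ?_ H.hC.le
    have h1 : 1 ≤ 1 / δ ^ 2 * ‖x - c t‖ ^ 2 := by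
      have := H.hδ
      rw [one_div, inv_mul_eq_div, one_le_div (by positivity)]
      gcongr
    linarith
  obtain ⟨K, hK⟩ := exists_nat_gt (8 * B / Real.pi)
  have hpi := Real.pi_pos
  have hδ := H.hδ
  have hKpos : (0:ℝ) < K := lt_trans (by positivity) hK
  refine ⟨δ / (2 * K), by positivity, fun α hα hαle N t ht z hneg hz0 hsum => ?_⟩
  let w : ℤ → X := fun k => if (K:ℤ) ≤ k then z k else 0
  -- pointwise decomposition
  have hterm : ∀ m ∈ Finset.range N, ((m:ℝ)+1) * ‖z ((m:ℤ)+1)‖ ^ 2 ≤ α ^ 2 := by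
    intro m hm
    rw [← hsum]
    exact Finset.single_le_sum (f := fun m : ℕ => ((m:ℝ)+1) * ‖z ((m:ℤ)+1)‖ ^ 2)
      (fun _ _ => by positivity) hm
  have hterm' : ∀ m ∈ Finset.range N, ‖z ((m:ℤ)+1)‖ ≤ α := by
    intro m hm
    have h1 := hterm m hm
    have h2 : ‖z ((m:ℤ)+1)‖ ^ 2 ≤ α ^ 2 := by
      refine le_trans ?_ h1
      have : (0:ℝ) ≤ m := by positivity
      nlinarith [sq_nonneg ‖z ((m:ℤ)+1)‖]
    exact (sq_le_sq₀ (norm_nonneg _) hα.le).1 h2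
  have hlz : ∀ s, loop N z s = c t + ∑ m ∈ Finset.range N, ee ((m:ℤ)+1) s • z ((m:ℤ)+1) := by
    intro s
    unfold loop
    rw [sum_Icc_split, ee_zero, one_smul, hz0]
    congr 1
    refine Finset.sum_congr rfl fun m hm => ?_
    rw [hneg m (Finset.mem_range.1 hm), smul_zero, add_zero]
  have hlw : ∀ s, loop N w s = ∑ m ∈ Finset.range N, ee ((m:ℤ)+1) s • w ((m:ℤ)+1) := by
    intro s
    unfold loop
    rw [sum_Icc_split]
    have h0 : w 0 = 0 := by
      have : ¬ (K:ℤ) ≤ 0 := by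
        have : 0 < K := by exact_mod_cast hKpos
        omega
      simp only [w, this, if_false]
    rw [h0, smul_zero, zero_add]
    refine Finset.sum_congr rfl fun m hm => ?_
    have : w (-((m:ℤ)+1)) = 0 := by
      have : ¬ (K:ℤ) ≤ -((m:ℤ)+1) := by omega
      simp only [w, this, if_false]
    rw [this, smul_zero, add_zero]
  have hdiff : ∀ s, ‖loop N z s - c t - loop N w s‖ ≤ δ / 2 := by
    intro s
    rw [hlz, hlw, add_sub_cancel_left, ← Finset.sum_sub_distrib]
    have h1 : ∀ m ∈ Finset.range N, ‖ee ((m:ℤ)+1) s • z ((m:ℤ)+1) - ee ((m:ℤ)+1) s • w ((m:ℤ)+1)‖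
        ≤ if m < K then α else 0 := by
      intro m hm
      rw [← smul_sub, norm_smul, ee_norm, one_mul]
      by_cases hmK : (K:ℤ) ≤ (m:ℤ)+1
      · simp only [w, hmK, if_true, sub_self, norm_zero]
        split_ifs <;> linarith
      · have : m < K := by omega
        simp only [w, hmK, if_false, sub_zero, this, if_true]
        exact hterm' m hm
    refine (norm_sum_le _ _).trans ((Finset.sum_le_sum h1).trans ?_)
    rw [← Finset.sum_filter, Finset.sum_const, nsmul_eq_mul]
    have h2 : ((Finset.range N).filter (· < K)).card ≤ K := by
      have : (Finset.range N).filter (· < K) ⊆ Finset.range K := by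
        intro m; simp
      simpa using Finset.card_le_card this
    have h3 : (((Finset.range N).filter (· < K)).card : ℝ) ≤ K := by exact_mod_cast h2
    calc _ ≤ (K:ℝ) * (δ / (2 * K)) := by gcongr
      _ = δ / 2 := by field_simp
  have hG : ∀ s, G t (loop N z s) ≤ 4 * B * ‖loop N w s‖ ^ 2 := by
    intro s
    rcases le_or_gt ‖loop N z s - c t‖ δ with h | h
    · rw [H.zero t ht _ h]; positivity
    · refine (hGB t ht _ h.le).trans ?_
      have h1 := hdiff s
      have h2 := norm_sub_norm_le (loop N z s - c t) (loop N w s)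
      have h3 : ‖loop N z s - c t‖ ≤ 2 * ‖loop N w s‖ := by linarith
      have h4 : ‖loop N z s - c t‖ ^ 2 ≤ (2 * ‖loop N w s‖) ^ 2 := by gcongr
      nlinarith
  have hinteg : ∫ s in (0:ℝ)..1, G t (loop N z s) ≤ 4 * B * qn N w := by
    rw [qn, ← integral_norm_loop, ← intervalIntegral.integral_const_mul]
    refine intervalIntegral.integral_mono_on zero_le_one ?_ ?_ fun s _ => hG s
    · exact ((H.contGt t).comp (loop_continuous N z)).intervalIntegrable _ _
    · exact (continuous_const.mul ((loop_continuous N w).norm.pow 2)).intervalIntegrable _ _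
  have hqw : K * qn N w ≤ α ^ 2 := by
    rw [qn, sum_Icc_split, ← hsum]
    have h0 : w 0 = 0 := by
      have : ¬ (K:ℤ) ≤ 0 := by
        have : 0 < K := by exact_mod_cast hKpos
        omega
      simp only [w, this, if_false]
    rw [h0, norm_zero, zero_pow two_ne_zero, zero_add, Finset.mul_sum]
    refine Finset.sum_le_sum fun m hm => ?_
    have : w (-((m:ℤ)+1)) = 0 := by
      have : ¬ (K:ℤ) ≤ -((m:ℤ)+1) := by omega
      simp only [w, this, if_false]
    rw [this, norm_zero, zero_pow two_ne_zero, add_zero]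
    by_cases hmK : (K:ℤ) ≤ (m:ℤ)+1
    · simp only [w, hmK, if_true]
      have : (K:ℝ) ≤ (m:ℝ) + 1 := by exact_mod_cast hmK
      gcongr
    · simp only [w, hmK, if_false, norm_zero, zero_pow two_ne_zero, mul_zero]
      positivity
  have hfin : 4 * B * qn N w ≤ Real.pi / 2 * α ^ 2 := by
    have h1 : 8 * B ≤ K * Real.pi := by
      rw [div_lt_iff₀ hpi] at hK; exact hK.le
    have h2 := mul_le_mul_of_nonneg_right h1 (qn_nonneg N w)
    have h3 := mul_le_mul_of_nonneg_left hqw hpi.le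
    linarith
  unfold act
  have hq : ∑ k ∈ Finset.Icc (-(N:ℤ)) N, (k:ℝ) * ‖z k‖ ^ 2 = α ^ 2 := by
    rw [sum_Icc_split, ← hsum]
    simp only [Int.cast_zero, zero_mul, zero_add]
    refine Finset.sum_congr rfl fun m hm => ?_
    rw [hneg m (Finset.mem_range.1 hm), norm_zero]
    push_cast
    ring
  rw [hq]
  linarith

end

end Camel
end

section
namespace Camel
open Metric MeasureTheory
set_option linter.unusedSectionVars false
set_option linter.unusedSimpArgs false

variable {X : Type*} [NormedAddCommGroup X] [InnerProductSpace ℂ X]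
variable {ea eb : X} {G : ℝ → X → ℝ} {Y : ℝ → X → X} {c : ℝ → X} {C δ ε L : ℝ}

/-- extension by zero -/
def yext {N : ℕ} (x : Fin (N+1) → X) (m : ℕ) : X := if h : m < N + 1 then x ⟨m, h⟩ else 0

lemma yext_zero {N : ℕ} (x : Fin (N+1) → X) : yext x 0 = x 0 := by
  simp [yext]

lemma yext_val {N : ℕ} (x : Fin (N+1) → X) (m : Fin (N+1)) : yext x m = x m := by
  unfold yext
  rw [dif_pos m.2]

lemma yext_continuous {N : ℕ} : Continuous fun x : Fin (N+1) → X => yext x := by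
  refine continuous_pi fun m => ?_
  unfold yext
  split_ifs <;> fun_prop

/-- The parameter space of the linking family. -/
abbrev EE (X : Type*) (N : ℕ) := (Fin (N+1) → X) × ℝ

/-- Existence of almost critical points of the Galerkin functionals, with uniform bounds. -/
theorem IsHam.almost_critical [FiniteDimensional ℝ X] [CompleteSpace X]
    (H : IsHam ea eb G Y c C δ ε L) :
    ∃ β M : ℝ, 0 < β ∧ ∀ N : ℕ, 1 ≤ N → ∀ δ' : ℝ, 0 < δ' →
      ∃ t ∈ Icc (0:ℝ) 1, ∃ z : ℤ → X, qn N (grd Y N t z) ≤ δ' ∧ β ≤ act G N t z ∧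
        act G N t z ≤ M := by
  obtain ⟨α, hα, hlow⟩ := H.act_lower
  obtain ⟨Cc, hCc⟩ := (isCompact_Icc (a := (0:ℝ)) (b := 1)).exists_bound_of_continuousOn
    H.contc.continuousOn
  have hCc0 : 0 ≤ Cc := (norm_nonneg _).trans (hCc 0 (by simp))
  have hpi := Real.pi_pos
  have hε := H.hε
  have hC := H.hC
  have hre : ∀ x : X, |(inner ℂ eb x).re| ≤ ‖x‖ := by
    intro x
    refine (Complex.abs_re_le_norm _).trans ?_
    simpa [H.hb] using norm_inner_le_norm (𝕜 := ℂ) eb x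
  obtain ⟨S, hS1, hS2, hS3⟩ : ∃ S : ℝ, α < S ∧ 2 + 3 * Cc < S ∧ C ≤ ε * (S ^ 2 - 1) := by
    refine ⟨α + 2 + 3 * Cc + C / ε + 1, ?_, by positivity |> fun h : (0:ℝ) < α + C / ε + 1 => by linarith, ?_⟩
    · have : 0 < C / ε := by positivity
      linarith
    · have h0 : 0 < C / ε := by positivity
      have h1 : C / ε ≤ (α + 2 + 3 * Cc + C / ε + 1) ^ 2 - 1 := by nlinarith [mul_pos h0 h0]
      rw [div_le_iff₀ hε] at h1
      linarith
  have hS0 : 0 < S := hα.trans hS1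
  refine ⟨Real.pi / 2 * α ^ 2, Real.pi * S ^ 2, by positivity, fun N hN δ' hδ' => ?_⟩
  let τ : EE X N → ℝ := fun x => (inner ℂ eb (x.1 0)).re
  have hτ : Continuous τ := by
    simp only [τ]
    fun_prop
  let θ : EE X N → ℝ := fun x => max 0 (min 1 (τ x))
  have hθ : Continuous θ := by simp only [θ]; fun_prop
  have hθI : ∀ x, θ x ∈ Icc (0:ℝ) 1 := fun x =>
    ⟨le_max_left _ _, max_le zero_le_one (min_le_left _ _)⟩
  let ζ : EE X N → ℤ → X := fun x => zeta ea eb (yext x.1) x.2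
  have hζ : Continuous ζ :=
    zeta_continuous.comp ((yext_continuous.comp continuous_fst).prodMk continuous_snd)
  let Pr : ℝ → (ℤ → X) → EE X N := fun t z =>
    (fun m => if m = 0 then z 0 - c t +
      ((2 * ((inner ℂ eb (c t)).re - (inner ℂ eb (z 0)).re) : ℝ) : ℂ) • eb else z (-(m.val:ℤ)),
     ∑ m ∈ Finset.range N, ((m:ℝ)+1) * ‖z ((m:ℤ)+1)‖ ^ 2 - α ^ 2)
  have hPr : Continuous fun p : ℝ × (ℤ → X) => Pr p.1 p.2 := by
    refine Continuous.prodMk (continuous_pi fun m => ?_) ?_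
    · split_ifs
      · have := H.contc
        fun_prop
      · fun_prop
    · fun_prop
  let U : Set (EE X N) := {x | 0 < τ x} ∩ {x | τ x < 1} ∩ {x | 0 < x.2} ∩ {x | x.2 < S} ∩ {x | ‖x.1‖ < S}
  have hUo : IsOpen U := by
    refine ((((isOpen_lt continuous_const hτ).inter (isOpen_lt hτ continuous_const)).inter
      (isOpen_lt continuous_const continuous_snd)).inter
      (isOpen_lt continuous_snd continuous_const)).inter
      (isOpen_lt continuous_fst.norm continuous_const)
  let K : Set (EE X N) := {x | 0 ≤ τ x} ∩ {x | τ x ≤ 1} ∩ {x | 0 ≤ x.2} ∩ {x | x.2 ≤ S} ∩ {x | ‖x.1‖ ≤ S}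
  have hKc : IsClosed K := by
    refine ((((isClosed_le continuous_const hτ).inter (isClosed_le hτ continuous_const)).inter
      (isClosed_le continuous_const continuous_snd)).inter
      (isClosed_le continuous_snd continuous_const)).inter
      (isClosed_le continuous_fst.norm continuous_const)
  have hUK : U ⊆ K := by
    rintro x ⟨⟨⟨⟨h1, h2⟩, h3⟩, h4⟩, h5⟩
    simp only [mem_ofPred_eq] at h1 h2 h3 h4 h5
    exact ⟨⟨⟨⟨h1.le, h2.le⟩, h3.le⟩, h4.le⟩, h5.le⟩
  have hfr : ∀ x ∈ frontier U, (0 ≤ τ x ∧ τ x ≤ 1 ∧ 0 ≤ x.2 ∧ x.2 ≤ S ∧ ‖x.1‖ ≤ S) ∧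
      (τ x = 0 ∨ τ x = 1 ∨ x.2 = 0 ∨ x.2 = S ∨ ‖x.1‖ = S) := by
    intro x hx
    rw [hUo.frontier_eq] at hx
    obtain ⟨hx1, hx2⟩ := hx
    obtain ⟨⟨⟨⟨h1, h2⟩, h3⟩, h4⟩, h5⟩ := (closure_minimal hUK hKc) hx1
    simp only [mem_ofPred_eq] at h1 h2 h3 h4 h5
    refine ⟨⟨h1, h2, h3, h4, h5⟩, ?_⟩
    by_contra hcon
    push Not at hcon
    obtain ⟨g1, g2, g3, g4, g5⟩ := hcon
    exact hx2 ⟨⟨⟨⟨lt_of_le_of_ne h1 (Ne.symm g1), lt_of_le_of_ne h2 g2⟩,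
      lt_of_le_of_ne h3 (Ne.symm g3)⟩, lt_of_le_of_ne h4 g4⟩, lt_of_le_of_ne h5 g5⟩
  have hUb : Bornology.IsBounded U := by
    refine (Metric.isBounded_closedBall (x := (0:EE X N)) (r := S)).subset ?_
    rintro x ⟨⟨⟨⟨h1, h2⟩, h3⟩, h4⟩, h5⟩
    simp only [mem_ofPred_eq] at h3 h4 h5
    rw [mem_closedBall_zero_iff, Prod.norm_def]
    refine max_le h5.le ?_
    rw [Real.norm_eq_abs, abs_of_pos h3]; exact h4.le
  let x0 : EE X N := (fun m => if m = 0 then ((1/2:ℝ):ℂ) • eb else 0, α)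
  have hx0τ : τ x0 = 1 / 2 := by
    simp only [τ, x0, if_true, inner_smul_right, H.hbb]
    norm_num
  have hx0 : x0 ∈ U := by
    refine ⟨⟨⟨⟨?_, ?_⟩, hα⟩, hS1⟩, ?_⟩
    · simp only [mem_ofPred_eq, hx0τ]; norm_num
    · simp only [mem_ofPred_eq, hx0τ]; norm_num
    · simp only [mem_ofPred_eq, x0]
      rw [pi_norm_lt_iff hS0]
      intro m
      split_ifs
      · rw [norm_smul, H.hb]
        norm_num
        linarith
      · simpa using hS0
  have hrefl : ∀ x : EE X N, ∀ σ, (inner ℂ eb (loop N (ζ x) σ)).re = 0 := fun x σ =>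
    zeta_re H.hb H.hba _ _ _ _
  have hactle : ∀ x : EE X N, act G N (θ x) (ζ x) ≤ Real.pi * x.2 ^ 2 -
      ∫ s in (0:ℝ)..1, G (θ x) (loop N (ζ x) s) := by
    intro x
    unfold act
    have := mul_le_mul_of_nonneg_left (zeta_quad H.ha H.hb H.hab (yext x.1) x.2 N) hpi.le
    simp only [ζ]
    linarith
  have hGnn : ∀ x : EE X N, 0 ≤ ∫ s in (0:ℝ)..1, G (θ x) (loop N (ζ x) s) := fun x =>
    intervalIntegral.integral_nonneg zero_le_one fun s _ =>
      H.plane _ (hθI x) _ (hrefl x s)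
  have hGc : ∀ x : EE X N, Continuous fun s => G (θ x) (loop N (ζ x) s) := fun x =>
    (H.contGt _).comp (loop_continuous N _)
  have hlc : ∀ x : EE X N, Continuous fun s => loop N (ζ x) s := fun x => loop_continuous N _
  have hac : ∀ x : EE X N, Continuous fun s => ‖inner ℂ ea (loop N (ζ x) s)‖ ^ 2 := fun x => by
    have := hlc x
    fun_prop
  have hedge : ∀ x : EE X N, (∀ w, (inner ℂ eb w).re = 0 → Real.pi * ‖inner ℂ ea w‖ ^ 2 ≤ G (θ x) w) →
      act G N (θ x) (ζ x) ≤ 0 := by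
    intro x hx
    have h1 : Real.pi * ∫ s in (0:ℝ)..1, ‖inner ℂ ea (loop N (ζ x) s)‖ ^ 2 ≤
        ∫ s in (0:ℝ)..1, G (θ x) (loop N (ζ x) s) := by
      rw [← intervalIntegral.integral_const_mul]
      refine intervalIntegral.integral_mono_on zero_le_one ?_ ?_ fun s _ => hx _ (hrefl x s)
      · exact (continuous_const.mul (hac x)).intervalIntegrable _ _
      · exact (hGc x).intervalIntegrable _ _
    have h2 := mul_le_mul_of_nonneg_left
      (zeta_a (eb := eb) H.ha H.hab (yext x.1) x.2 N hN) hpi.le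
    have := hactle x
    simp only [ζ] at h1 h2 this ⊢
    linarith
  have hbig : ∀ x : EE X N, S ^ 2 - 1 ≤ qn N (ζ x) → act G N (θ x) (ζ x) ≤ 0 := by
    intro x hx
    have h1 : Real.pi * (∫ s in (0:ℝ)..1, ‖inner ℂ ea (loop N (ζ x) s)‖ ^ 2) +
        ε * (∫ s in (0:ℝ)..1, ‖loop N (ζ x) s‖ ^ 2) - C ≤
        ∫ s in (0:ℝ)..1, G (θ x) (loop N (ζ x) s) := by
      have hC' : C = ∫ s in (0:ℝ)..1, C := by simp
      rw [hC', ← intervalIntegral.integral_const_mul, ← intervalIntegral.integral_const_mul,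
        ← intervalIntegral.integral_add, ← intervalIntegral.integral_sub]
      · refine intervalIntegral.integral_mono_on zero_le_one ?_ ?_ fun s _ =>
          H.plane' _ (hθI x) _ (hrefl x s)
        · exact (((continuous_const.mul (hac x)).add
            (continuous_const.mul ((hlc x).norm.pow 2))).sub continuous_const).intervalIntegrable _ _
        · exact (hGc x).intervalIntegrable _ _
      · exact ((continuous_const.mul (hac x)).add
            (continuous_const.mul ((hlc x).norm.pow 2))).intervalIntegrable _ _
      · exact continuous_const.intervalIntegrable _ _
      · exact (continuous_const.mul (hac x)).intervalIntegrable _ _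
      · exact (continuous_const.mul ((hlc x).norm.pow 2)).intervalIntegrable _ _
    rw [integral_norm_loop] at h1
    change _ + ε * (qn N (ζ x)) - C ≤ _ at h1
    have h2 := mul_le_mul_of_nonneg_left
      (zeta_a (eb := eb) H.ha H.hab (yext x.1) x.2 N hN) hpi.le
    have h3 := mul_le_mul_of_nonneg_left hx hε.le
    have := hactle x
    simp only [ζ] at h1 h2 h3 this ⊢
    linarith
  have hθ0 : ∀ x : EE X N, τ x = 0 → θ x = 0 := fun x hx => by simp [θ, hx]
  have hθ1 : ∀ x : EE X N, τ x = 1 → θ x = 1 := fun x hx => by simp [θ, hx]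
  obtain ⟨η, hη, hη2⟩ : ∃ η : ℝ, 0 < η ∧ η * (Real.pi * N + L) ≤ 1 / 2 := by
    have hL := H.hL
    have h1 : 0 < Real.pi * N + L + 1 := by positivity
    refine ⟨1 / (2 * (Real.pi * N + L + 1)), by positivity, ?_⟩
    rw [div_mul_eq_mul_div, div_le_div_iff₀ (by positivity) (by norm_num)]
    linarith
  refine link (E := EE X N) (act G N) (grd Y N) (grd_continuous Y H.contY N) (qn N) (qn_nonneg N) η hη
    (fun t ht z σ hσ => act_descent G Y H.contG H.contY L H.hL t (H.semi t ht) N η hη hη2 z σ hσ)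
    θ hθ hθI ζ hζ Pr hPr U hUo hUb x0 hx0 (Real.pi / 2 * α ^ 2) (Real.pi * S ^ 2) (by positivity)
    ?_ ?_ ?_ ?_ δ' hδ'
  · -- nonpositive on the frontier
    intro x hx
    obtain ⟨⟨h1, h2, h3, h4, h5⟩, h6⟩ := hfr x hx
    rcases h6 with h | h | h | h | h
    · refine hedge x ?_
      rw [hθ0 x h]; exact H.plane0
    · refine hedge x ?_
      rw [hθ1 x h]; exact H.plane1
    · have := hactle x
      rw [h] at this
      have := hGnn x
      linarith
    · refine hbig x ?_
      have := zeta_qn_s H.ha H.hb H.hab (yext x.1) x.2 N hN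
      rw [h] at this
      simp only [ζ]
      rw [h]
      linarith
    · refine hbig x ?_
      have : ∃ m, S ≤ ‖x.1 m‖ := by
        by_contra hcon
        push Not at hcon
        exact absurd h ((pi_norm_lt_iff hS0).2 hcon).ne
      obtain ⟨m, hm⟩ := this
      have h7 := zeta_qn_y (ea := ea) H.hb (yext x.1) x.2 N m (by have := m.2; omega)
      rw [yext_val, yext_zero] at h7
      simp only [ζ]
      have h8 : S ^ 2 ≤ ‖x.1 m‖ ^ 2 := by gcongr
      have h9 : τ x ^ 2 ≤ 1 := by nlinarith
      simp only [τ] at h9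
      linarith
  · -- no zeros on the frontier
    intro x hx cc hcc hzero
    obtain ⟨⟨h1, h2, h3, h4, h5⟩, h6⟩ := hfr x hx
    have hfst := congrArg Prod.fst hzero
    have hsnd := congrArg Prod.snd hzero
    have hneg : ∀ m : ℕ, m < N → yext x.1 (m+1) = 0 := by
      intro m hm
      have h7 := congrFun hfst ⟨m+1, by omega⟩
      have h8 : (⟨m+1, by omega⟩ : Fin (N+1)) ≠ 0 := by
        intro h; simpa using congrArg Fin.val h
      simp only [Pr, x0, Prod.fst_add, Prod.smul_fst, Prod.fst_sub, Pi.add_apply, Pi.smul_apply,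
        Pi.sub_apply, h8, if_false, sub_zero, Prod.fst_zero, Pi.zero_apply] at h7
      have h9 : ζ x (-((m+1:ℕ):ℤ)) = yext x.1 (m+1) := by
        simp only [ζ]
        have : (-((m+1:ℕ):ℤ)) = -((m:ℤ)+1) := by push_cast; ring
        rw [this, zeta_neg]
      rw [h9] at h7
      have h10 : yext x.1 (m+1) = x.1 ⟨m+1, by omega⟩ := by
        simp [yext, hm]
      rw [← h10, ← add_smul] at h7
      simpa using h7
    have hsα : x.2 = α := by
      simp only [Pr, x0, Prod.snd_add, Prod.smul_snd, Prod.snd_sub, Prod.snd_zero, smul_eq_mul]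
        at hsnd
      have h7 : ∑ m ∈ Finset.range N, ((m:ℝ)+1) * ‖ζ x ((m:ℤ)+1)‖ ^ 2 = x.2 ^ 2 := by
        have : ∀ m ∈ Finset.range N, ((m:ℝ)+1) * ‖ζ x ((m:ℤ)+1)‖ ^ 2 =
            if m = 0 then x.2 ^ 2 else 0 := by
          intro m hm
          simp only [ζ]
          rw [zeta_pos, norm_sq_comb H.ha H.hb H.hab, hneg m (Finset.mem_range.1 hm)]
          split_ifs with h
          · subst h; simp
          · simp
        rw [Finset.sum_congr rfl this, Finset.sum_ite_eq', if_pos (Finset.mem_range.2 (by omega))]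
      rw [h7] at hsnd
      have h8 : (x.2 - α) * ((1 - cc) + cc * (x.2 + α)) = 0 := by linarith
      rcases mul_eq_zero.1 h8 with h | h
      · linarith
      · exfalso
        rcases eq_or_lt_of_le hcc.2 with h9 | h9
        · rw [h9] at h; linarith
        · have := mul_nonneg hcc.1 (show 0 ≤ x.2 + α by linarith)
          linarith
    have h0 := congrFun hfst 0
    have hz0 : ζ x 0 = x.1 0 - ((τ x : ℝ) : ℂ) • eb := by
      simp only [ζ]; rw [zeta_zero, yext_zero]
    have hz0b : (inner ℂ eb (ζ x 0)).re = 0 := by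
      rw [hz0, inner_sub_right, inner_smul_right, H.hbb]
      simp [τ]
    set γ := (inner ℂ eb (c (θ x))).re with hγ
    simp only [Pr, x0, Prod.fst_add, Prod.smul_fst, Prod.fst_sub, Pi.add_apply, Pi.smul_apply,
        Pi.sub_apply, if_true, Prod.fst_zero, Pi.zero_apply, hz0b, sub_zero] at h0
    rw [← hγ, hz0] at h0
    have hkey : (1 - cc) * (τ x - 1 / 2) + cc * γ = 0 := by
      have := congrArg (fun w => rip eb w) h0
      simp only [rip_add_right, rip_smul_right, rip_sub_right, rip_zero_right] at this
      simp only [rip, inner_smul_right, H.hbb, ← hγ] at this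
      simp only [mul_one, Complex.ofReal_re] at this
      simp only [τ] at this ⊢
      linarith
    rcases h6 with h | h | h | h | h
    · have hγ0 : γ < 0 := by rw [hγ, hθ0 x h]; exact H.c0
      rw [h] at hkey
      rcases eq_or_lt_of_le hcc.2 with h9 | h9
      · rw [h9] at hkey; linarith
      · nlinarith [mul_nonneg hcc.1 (neg_nonneg.2 hγ0.le)]
    · have hγ0 : 0 < γ := by rw [hγ, hθ1 x h]; exact H.c1
      rw [h] at hkey
      rcases eq_or_lt_of_le hcc.2 with h9 | h9
      · rw [h9] at hkey; linarith
      · nlinarith [mul_nonneg hcc.1 hγ0.le]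
    · linarith
    · linarith
    · have hy0 : x.1 0 = (1 - cc) • (((1/2:ℝ):ℂ) • eb) +
          cc • (((τ x : ℝ) : ℂ) • eb + c (θ x) - ((2 * γ : ℝ) : ℂ) • eb) := by
        rw [← sub_eq_zero, ← h0]
        module
      have hcb := hCc _ (hθI x)
      have hγb : |γ| ≤ Cc := (hre _).trans hcb
      have hn0 : ‖x.1 0‖ < S := by
        rw [hy0]
        refine lt_of_le_of_lt (norm_add_le _ _) ?_
        rw [norm_smul, norm_smul, norm_smul, H.hb, Real.norm_eq_abs, Real.norm_eq_abs,
          abs_of_nonneg hcc.1, abs_of_nonneg (show 0 ≤ 1 - cc by linarith [hcc.2])]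
        have h7 : ‖((τ x : ℝ) : ℂ) • eb + c (θ x) - ((2 * γ : ℝ) : ℂ) • eb‖ ≤ 1 + Cc + 2 * Cc := by
          refine (norm_sub_le _ _).trans ?_
          refine add_le_add ((norm_add_le _ _).trans (add_le_add ?_ hcb)) ?_
          · rw [norm_smul, H.hb, mul_one, Complex.norm_real, Real.norm_eq_abs, abs_of_nonneg h1]
            exact h2
          · rw [norm_smul, H.hb, mul_one, Complex.norm_real, Real.norm_eq_abs, abs_mul]
            norm_num
            exact hγb
        have h8 : cc * ‖((τ x : ℝ) : ℂ) • eb + c (θ x) - ((2 * γ : ℝ) : ℂ) • eb‖ ≤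
            1 * (1 + Cc + 2 * Cc) :=
          mul_le_mul hcc.2 h7 (norm_nonneg _) zero_le_one
        have h9 : ‖((1/2:ℝ):ℂ)‖ = 1 / 2 := by norm_num
        rw [h9]
        nlinarith [hcc.1]
      refine absurd h ((pi_norm_lt_iff hS0).2 fun m => ?_).ne
      by_cases hm : m = 0
      · rw [hm]; exact hn0
      · obtain ⟨j, hj⟩ := Nat.exists_eq_succ_of_ne_zero (show m.val ≠ 0 from fun h => hm (Fin.ext h))
        have h7 := hneg j (by have := m.2; omega)
        have h8 := yext_val x.1 m
        rw [hj] at h8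
        rw [← h8]
        change ‖yext x.1 (j+1)‖ < S
        rw [h7, norm_zero]
        exact hS0
  · -- linking set
    intro t ht z hz
    have hfst := congrArg Prod.fst hz
    have hsnd := congrArg Prod.snd hz
    refine hlow α hα le_rfl N t ht z ?_ ?_ ?_
    · intro m hm
      have h7 := congrFun hfst ⟨m+1, by omega⟩
      have h8 : (⟨m+1, by omega⟩ : Fin (N+1)) ≠ 0 := by
        intro h; simpa using congrArg Fin.val h
      simp only [Pr, h8, if_false, Prod.fst_zero, Pi.zero_apply] at h7
      have : (-((m+1:ℕ):ℤ)) = -((m:ℤ)+1) := by push_cast; ring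
      rw [← this]; exact h7
    · have h7 := congrFun hfst 0
      simp only [Pr, if_true, Prod.fst_zero, Pi.zero_apply] at h7
      have h8 := congrArg (fun w => rip eb w) h7
      simp only [rip_add_right, rip_smul_right, rip_sub_right, rip_zero_right] at h8
      simp only [rip, inner_smul_right, H.hbb, mul_one, Complex.ofReal_re] at h8
      have h9 : (inner ℂ eb (c t)).re - (inner ℂ eb (z 0)).re = 0 := by linarith
      rw [h9] at h7
      simpa [sub_eq_zero] using h7
    · simp only [Pr, Prod.snd_zero] at hsnd
      linarith
  · intro x hx
    obtain ⟨⟨⟨⟨h1, h2⟩, h3⟩, h4⟩, h5⟩ := hUK hx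
    simp only [mem_ofPred_eq] at h3 h4
    have := hactle x
    have := hGnn x
    have h7 : Real.pi * x.2 ^ 2 ≤ Real.pi * S ^ 2 := by gcongr
    linarith

end Camel
end

section
namespace Camel
open Metric MeasureTheory Filter Topology
set_option linter.unusedSectionVars false
set_option linter.unusedSimpArgs false

section
variable {X : Type*} [NormedAddCommGroup X] [InnerProductSpace ℂ X]

lemma loop_add (N : ℕ) (z w : ℤ → X) (s : ℝ) :
    loop N (fun k => z k + w k) s = loop N z s + loop N w s := by
  simp [loop, Finset.sum_add_distrib]

/-- The asymptotic linear vector field. -/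
def linA (ea eb : X) (e : ℝ) (x : X) : X :=
  ((2 * e : ℝ) : ℂ) • x + (((3 * Real.pi - 2 * e : ℝ) : ℂ) * inner ℂ ea x) • ea
    - (((2 * e : ℝ) : ℂ) * (inner ℂ eb x + (starRingEnd ℂ) (inner ℂ eb x))) • eb

/-- The asymptotic linear vector field on Fourier coefficients. -/
def linAc (ea eb : X) (e : ℝ) (z : ℤ → X) (k : ℤ) : X :=
  ((2 * e : ℝ) : ℂ) • z k + (((3 * Real.pi - 2 * e : ℝ) : ℂ) * inner ℂ ea (z k)) • ea
    - (((2 * e : ℝ) : ℂ) * (inner ℂ eb (z k) + (starRingEnd ℂ) (inner ℂ eb (z (-k))))) • eb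

lemma sum_Icc_neg {M : Type*} [AddCommMonoid M] (f : ℤ → M) (N : ℕ) :
    ∑ k ∈ Finset.Icc (-(N:ℤ)) N, f (-k) = ∑ k ∈ Finset.Icc (-(N:ℤ)) N, f k := by
  refine Finset.sum_nbij' (fun k => -k) (fun k => -k) ?_ ?_ ?_ ?_ ?_ <;> simp <;> omega

lemma linA_loop (ea eb : X) (e : ℝ) (N : ℕ) (z : ℤ → X) (s : ℝ) :
    linA ea eb e (loop N z s) = loop N (linAc ea eb e z) s := by
  have h1 : ∀ w : X, inner ℂ w (loop N z s) = ∑ k ∈ Finset.Icc (-(N:ℤ)) N, ee k s * inner ℂ w (z k) := by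
    intro w; simp [loop, inner_sum, inner_smul_right]
  have h2 : (starRingEnd ℂ) (inner ℂ eb (loop N z s)) =
      ∑ k ∈ Finset.Icc (-(N:ℤ)) N, ee k s * (starRingEnd ℂ) (inner ℂ eb (z (-k))) := by
    rw [h1, map_sum, ← sum_Icc_neg]
    refine Finset.sum_congr rfl fun k _ => ?_
    rw [map_mul, ee_conj, neg_neg]
  unfold linA
  rw [h2, h1, h1]
  unfold loop linAc
  rw [← Finset.sum_add_distrib, Finset.smul_sum, Finset.mul_sum, Finset.mul_sum, Finset.sum_smul,
    Finset.sum_smul, ← Finset.sum_add_distrib, ← Finset.sum_sub_distrib]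
  refine Finset.sum_congr rfl fun k _ => ?_
  module

lemma linA_continuous (ea eb : X) (e : ℝ) : Continuous (linA ea eb e) := by
  unfold linA
  fun_prop

lemma linA_bound {ea eb : X} (ha : ‖ea‖ = 1) (hb : ‖eb‖ = 1) (e : ℝ) :
    ∃ CA : ℝ, 0 ≤ CA ∧ ∀ x, ‖linA ea eb e x‖ ≤ CA * ‖x‖ := by
  refine ⟨‖((2 * e : ℝ) : ℂ)‖ + ‖((3 * Real.pi - 2 * e : ℝ) : ℂ)‖ + ‖((2 * e : ℝ) : ℂ)‖ * 2,
    by positivity, fun x => ?_⟩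
  have h1 : ‖inner ℂ ea x‖ ≤ ‖x‖ := by simpa [ha] using norm_inner_le_norm (𝕜 := ℂ) ea x
  have h2 : ‖inner ℂ eb x‖ ≤ ‖x‖ := by simpa [hb] using norm_inner_le_norm (𝕜 := ℂ) eb x
  unfold linA
  refine (norm_sub_le _ _).trans ?_
  rw [add_mul, add_mul]
  refine add_le_add ((norm_add_le _ _).trans (add_le_add ?_ ?_)) ?_
  · rw [norm_smul]
  · rw [norm_smul, ha, mul_one, norm_mul]
    gcongr
  · rw [norm_smul, hb, mul_one, norm_mul, mul_assoc]
    gcongr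
    refine (norm_add_le _ _).trans ?_
    rw [RCLike.norm_conj]
    linarith

lemma norm_sq_comb3 {ea eb : X} (ha : ‖ea‖ = 1) (hb : ‖eb‖ = 1) (hab : inner ℂ ea eb = 0)
    (u v : ℂ) (w : X) (hwa : inner ℂ ea w = 0) (hwb : inner ℂ eb w = 0) :
    ‖u • ea + v • eb + w‖ ^ 2 = ‖u‖ ^ 2 + ‖v‖ ^ 2 + ‖w‖ ^ 2 := by
  rw [rip_add_sq, rip_add_sq, norm_smul, norm_smul, ha, hb]
  simp [rip, inner_add_left, inner_smul_left, inner_smul_right, hab, hwa, hwb]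

lemma coerc_pair (k e : ℝ) (v w : ℂ) :
    4 * e ^ 2 * (‖v‖ ^ 2 + ‖w‖ ^ 2) ≤
      ‖((2 * Real.pi * k : ℝ) : ℂ) * v + ((2 * e : ℝ) : ℂ) * (starRingEnd ℂ) w‖ ^ 2 +
      ‖((2 * Real.pi * (-k) : ℝ) : ℂ) * w + ((2 * e : ℝ) : ℂ) * (starRingEnd ℂ) v‖ ^ 2 := by
  rw [Complex.sq_norm, Complex.sq_norm, Complex.sq_norm, Complex.sq_norm]
  simp only [Complex.normSq_apply, Complex.add_re, Complex.add_im, Complex.mul_re, Complex.mul_im,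
    Complex.ofReal_re, Complex.ofReal_im, Complex.conj_re, Complex.conj_im]
  nlinarith [sq_nonneg (2 * Real.pi * k * v.re), sq_nonneg (2 * Real.pi * k * v.im),
    sq_nonneg (2 * Real.pi * k * w.re), sq_nonneg (2 * Real.pi * k * w.im)]

lemma coerc {ea eb : X} (ha : ‖ea‖ = 1) (hb : ‖eb‖ = 1) (hab : inner ℂ ea eb = 0) {e : ℝ}
    (he : 0 < e) (he2 : 2 * e ≤ 1) (N : ℕ) (z : ℤ → X) :
    4 * e ^ 2 * qn N z ≤ qn N (fun k => (2 * Real.pi * k : ℝ) • z k - linAc ea eb e z k) := by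
  have hpi : 3 < Real.pi := Real.pi_gt_three
  have haa : inner ℂ ea ea = (1:ℂ) := by rw [inner_self_eq_norm_sq_to_K, ha]; simp
  have hbb : inner ℂ eb eb = (1:ℂ) := by rw [inner_self_eq_norm_sq_to_K, hb]; simp
  have hba : inner ℂ eb ea = 0 := by rw [← inner_conj_symm, hab, map_zero]
  let u : ℤ → ℂ := fun k => inner ℂ ea (z k)
  let v : ℤ → ℂ := fun k => inner ℂ eb (z k)
  let w : ℤ → X := fun k => z k - u k • ea - v k • eb
  let q : ℤ → ℂ := fun k => ((2 * Real.pi * k : ℝ) : ℂ) * v k +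
    ((2 * e : ℝ) : ℂ) * (starRingEnd ℂ) (v (-k))
  have hwa : ∀ k, inner ℂ ea (w k) = 0 := fun k => by
    simp [w, u, v, inner_sub_right, inner_smul_right, haa, hab, ha]
  have hwb : ∀ k, inner ℂ eb (w k) = 0 := fun k => by
    simp [w, u, v, inner_sub_right, inner_smul_right, hbb, hba, hb]
  have hz : ∀ k, ‖z k‖ ^ 2 = ‖u k‖ ^ 2 + ‖v k‖ ^ 2 + ‖w k‖ ^ 2 := fun k => by
    rw [← norm_sq_comb3 ha hb hab (u k) (v k) (w k) (hwa k) (hwb k)]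
    congr 2
    simp only [w]; abel
  have hT : ∀ k : ℤ, ‖(2 * Real.pi * k : ℝ) • z k - linAc ea eb e z k‖ ^ 2 =
      ‖((2 * Real.pi * k - 3 * Real.pi : ℝ) : ℂ) * u k‖ ^ 2 + ‖q k‖ ^ 2 +
      ‖((2 * Real.pi * k - 2 * e : ℝ) : ℂ) • w k‖ ^ 2 := fun k => by
    rw [← norm_sq_comb3 ha hb hab _ _ _ (by rw [inner_smul_right, hwa, mul_zero])
      (by rw [inner_smul_right, hwb, mul_zero])]
    congr 2
    rw [← Complex.coe_smul]
    simp only [linAc, w, q, u, v]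
    push_cast
    module
  have hk1 : ∀ k : ℤ, 4 * e ^ 2 ≤ (2 * Real.pi * k - 3 * Real.pi) ^ 2 := fun k => by
    have h1 : (1:ℝ) ≤ ((2 * k - 3 : ℤ) : ℝ) ^ 2 := by
      have : (1:ℤ) ≤ (2 * k - 3) ^ 2 := by
        have : (2 * k - 3) ≠ 0 := by omega
        have := sq_pos_of_ne_zero this
        omega
      exact_mod_cast this
    push_cast at h1
    nlinarith [mul_le_mul_of_nonneg_left h1 (sq_nonneg Real.pi)]
  have hk2 : ∀ k : ℤ, 4 * e ^ 2 ≤ (2 * Real.pi * k - 2 * e) ^ 2 := fun k => by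
    rcases le_or_gt k 0 with h | h
    · have : (k:ℝ) ≤ 0 := by exact_mod_cast h
      nlinarith [mul_nonneg Real.pi_pos.le (neg_nonneg.2 this)]
    · have : (1:ℝ) ≤ k := by exact_mod_cast h
      have h2 : Real.pi ≤ Real.pi * k := by nlinarith
      nlinarith
  have hq : 4 * e ^ 2 * ∑ k ∈ Finset.Icc (-(N:ℤ)) N, ‖v k‖ ^ 2 ≤
      ∑ k ∈ Finset.Icc (-(N:ℤ)) N, ‖q k‖ ^ 2 := by
    have h1 := sum_Icc_neg (fun k => ‖q k‖ ^ 2) N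
    have h2 := sum_Icc_neg (fun k => ‖v k‖ ^ 2) N
    have h3 : ∑ k ∈ Finset.Icc (-(N:ℤ)) N, 4 * e ^ 2 * (‖v k‖ ^ 2 + ‖v (-k)‖ ^ 2) ≤
        ∑ k ∈ Finset.Icc (-(N:ℤ)) N, (‖q k‖ ^ 2 + ‖q (-k)‖ ^ 2) := by
      refine Finset.sum_le_sum fun k _ => ?_
      have := coerc_pair k e (v k) (v (-k))
      simp only [q, neg_neg]
      push_cast at this ⊢
      exact this
    rw [← Finset.mul_sum, Finset.sum_add_distrib, Finset.sum_add_distrib, h1, h2] at h3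
    linarith
  unfold qn
  simp only [hT, hz]
  rw [Finset.sum_add_distrib, Finset.sum_add_distrib, Finset.sum_add_distrib,
    Finset.sum_add_distrib, mul_add, mul_add]
  refine add_le_add (add_le_add ?_ hq) ?_
  · rw [Finset.mul_sum]
    refine Finset.sum_le_sum fun k _ => ?_
    rw [norm_mul, mul_pow, Complex.norm_real, Real.norm_eq_abs, sq_abs]
    exact mul_le_mul_of_nonneg_right (hk1 k) (sq_nonneg _)
  · rw [Finset.mul_sum]
    refine Finset.sum_le_sum fun k _ => ?_
    rw [norm_smul, mul_pow, Complex.norm_real, Real.norm_eq_abs, sq_abs]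
    exact mul_le_mul_of_nonneg_right (hk2 k) (sq_nonneg _)

lemma qn_add (N : ℕ) (z w : ℤ → X) : qn N (fun k => z k + w k) ≤ 2 * qn N z + 2 * qn N w := by
  unfold qn
  rw [Finset.mul_sum, Finset.mul_sum, ← Finset.sum_add_distrib]
  refine Finset.sum_le_sum fun k _ => ?_
  have := norm_add_le (z k) (w k)
  have h1 : ‖z k + w k‖ ^ 2 ≤ (‖z k‖ + ‖w k‖) ^ 2 := by gcongr
  nlinarith [sq_nonneg (‖z k‖ - ‖w k‖)]

lemma fc_sub [CompleteSpace X] (k : ℤ) {y w : ℝ → X} (hy : Continuous y) (hw : Continuous w) :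
    fc k (fun s => y s - w s) = fc k y - fc k w := by
  unfold fc
  rw [← intervalIntegral.integral_sub]
  · simp only [smul_sub]
  · exact ((ee_continuous _).smul hy).intervalIntegrable _ _
  · exact ((ee_continuous _).smul hw).intervalIntegrable _ _

/-- A priori bounds. -/
lemma apriori [CompleteSpace X] {ea eb : X} (ha : ‖ea‖ = 1) (hb : ‖eb‖ = 1)
    (hab : inner ℂ ea eb = 0) {e : ℝ} (he : 0 < e) (he2 : 2 * e ≤ 1) (Y : ℝ → X → X)
    (hY : ∀ t, Continuous (Y t)) (C' : ℝ)
    (hA : ∀ t ∈ Icc (0:ℝ) 1, ∀ x, ‖Y t x - linA ea eb e x‖ ≤ C') :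
    ∃ B : ℝ, ∀ N : ℕ, ∀ t ∈ Icc (0:ℝ) 1, ∀ z : ℤ → X, qn N (grd Y N t z) ≤ 1 →
      ∑ k ∈ Finset.Icc (-(N:ℤ)) N, (1 + (k:ℝ) ^ 2) * ‖z k‖ ^ 2 ≤ B := by
  obtain ⟨CA, hCA, hCAx⟩ := linA_bound ha hb e
  have hpi := Real.pi_gt_three
  let B0 : ℝ := (2 + 2 * C' ^ 2) / (4 * e ^ 2)
  refine ⟨B0 + (2 + 2 * (2 * C' ^ 2 + 2 * (CA ^ 2 * B0))), fun N t ht z hz => ?_⟩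
  have hl := loop_continuous N z
  have hyc : Continuous fun s => Y t (loop N z s) := (hY t).comp hl
  have hac : Continuous fun s => linA ea eb e (loop N z s) := (linA_continuous ea eb e).comp hl
  have h1 : qn N z ≤ B0 := by
    rw [le_div_iff₀ (by positivity)]
    have h2 := coerc ha hb hab he he2 N z
    have h3 : qn N (fun k => (2 * Real.pi * k : ℝ) • z k - linAc ea eb e z k) ≤
        2 * qn N (grd Y N t z) + 2 * qn N (fun k => fc k (fun s => Y t (loop N z s) -
          linA ea eb e (loop N z s))) := by
      refine le_trans (le_of_eq ?_) (qn_add N (grd Y N t z) _)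
      unfold qn
      refine Finset.sum_congr rfl fun k hk => ?_
      have hg : grd Y N t z k = _ := if_pos hk
      dsimp only
      congr 2
      rw [hg, fc_sub k hyc hac]
      have : fc k (fun s => linA ea eb e (loop N z s)) = linAc ea eb e z k := by
        rw [← fc_loop N (linAc ea eb e z) hk]
        congr 1; funext s; exact linA_loop ea eb e N z s
      rw [this]; abel
    have h4 : qn N (fun k => fc k (fun s => Y t (loop N z s) - linA ea eb e (loop N z s))) ≤
        C' ^ 2 := by
      refine (bessel N _ (hyc.sub hac)).trans ?_
      have : C' ^ 2 = ∫ s in (0:ℝ)..1, C' ^ 2 := by simp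
      rw [this]
      refine intervalIntegral.integral_mono_on zero_le_one ?_ ?_ fun s _ => ?_
      · exact ((hyc.sub hac).norm.pow 2).intervalIntegrable _ _
      · exact continuous_const.intervalIntegrable _ _
      · have := hA t ht (loop N z s)
        exact pow_le_pow_left₀ (norm_nonneg _) this 2
    linarith
  have h5 : qn N (fun k => (2 * Real.pi * k : ℝ) • z k) ≤
      2 + 2 * (2 * C' ^ 2 + 2 * (CA ^ 2 * B0)) := by
    have h3 : qn N (fun k => (2 * Real.pi * k : ℝ) • z k) ≤
        2 * qn N (grd Y N t z) + 2 * qn N (fun k => fc k (fun s => Y t (loop N z s))) := by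
      refine le_trans (le_of_eq ?_) (qn_add N (grd Y N t z) _)
      unfold qn
      refine Finset.sum_congr rfl fun k hk => ?_
      have hg : grd Y N t z k = _ := if_pos hk
      dsimp only
      congr 2
      rw [hg]
      abel
    have h4 : qn N (fun k => fc k (fun s => Y t (loop N z s))) ≤
        2 * C' ^ 2 + 2 * (CA ^ 2 * B0) := by
      refine (bessel N _ hyc).trans ?_
      have h6 : ∫ s in (0:ℝ)..1, (2 * C' ^ 2 + 2 * CA ^ 2 * ‖loop N z s‖ ^ 2) =
          2 * C' ^ 2 + 2 * CA ^ 2 * qn N z := by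
        rw [intervalIntegral.integral_add, intervalIntegral.integral_const_mul (2 * CA ^ 2),
          integral_norm_loop]
        · simp [qn]
        · exact continuous_const.intervalIntegrable _ _
        · exact (continuous_const.mul (hl.norm.pow 2)).intervalIntegrable _ _
      have h7 : 2 * C' ^ 2 + 2 * CA ^ 2 * qn N z ≤ 2 * C' ^ 2 + 2 * (CA ^ 2 * B0) := by
        have := mul_le_mul_of_nonneg_left h1 (sq_nonneg CA)
        linarith
      refine le_trans ?_ h7
      rw [← h6]
      refine intervalIntegral.integral_mono_on zero_le_one ?_ ?_ fun s _ => ?_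
      · exact (hyc.norm.pow 2).intervalIntegrable _ _
      · exact (continuous_const.add (continuous_const.mul (hl.norm.pow 2))).intervalIntegrable _ _
      · have g1 := hA t ht (loop N z s)
        have g2 := hCAx (loop N z s)
        have g3 : ‖Y t (loop N z s)‖ ≤ C' + CA * ‖loop N z s‖ := by
          have := norm_add_le (Y t (loop N z s) - linA ea eb e (loop N z s))
            (linA ea eb e (loop N z s))
          rw [sub_add_cancel] at this
          linarith
        have g4 : ‖Y t (loop N z s)‖ ^ 2 ≤ (C' + CA * ‖loop N z s‖) ^ 2 := by gcongr
        nlinarith [sq_nonneg (C' - CA * ‖loop N z s‖)]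
    linarith
  have h8 : ∑ k ∈ Finset.Icc (-(N:ℤ)) N, (1 + (k:ℝ) ^ 2) * ‖z k‖ ^ 2 ≤
      qn N z + qn N (fun k => (2 * Real.pi * k : ℝ) • z k) := by
    unfold qn
    rw [← Finset.sum_add_distrib]
    refine Finset.sum_le_sum fun k _ => ?_
    rw [norm_smul, mul_pow, Real.norm_eq_abs, sq_abs]
    have : (k:ℝ) ^ 2 ≤ (2 * Real.pi * k) ^ 2 := by
      nlinarith [sq_nonneg (k:ℝ), mul_nonneg (sq_nonneg (k:ℝ)) (show 0 ≤ 4 * Real.pi ^ 2 - 1 by nlinarith)]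
    nlinarith [mul_le_mul_of_nonneg_right this (sq_nonneg ‖z k‖)]
  linarith

end
end Camel
end

section
namespace Camel
open Metric MeasureTheory Filter Topology
set_option linter.unusedSectionVars false
set_option linter.unusedSimpArgs false

lemma summable_wt : Summable fun k : ℤ => 1 / (1 + (k:ℝ) ^ 2) := by
  have h1 : Summable fun k : ℤ => 1 / (k:ℝ) ^ 2 := Real.summable_one_div_int_pow.2 (by norm_num)
  refine Summable.of_norm_bounded_eventually h1 ?_
  have : ({0} : Set ℤ)ᶜ ∈ (cofinite : Filter ℤ) := (Set.finite_singleton 0).compl_mem_cofinite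
  filter_upwards [this] with k hk
  have hk0 : (k:ℝ) ≠ 0 := by exact_mod_cast hk
  rw [Real.norm_eq_abs, abs_of_nonneg (by positivity)]
  have : 0 < (k:ℝ) ^ 2 := by positivity
  exact one_div_le_one_div_of_le this (by linarith)

lemma tail_lemma (d : ℕ → ℤ → ℝ) (hd0 : ∀ n k, 0 ≤ d n k) (B : ℝ)
    (hB : ∀ n (F : Finset ℤ), ∑ k ∈ F, (1 + (k:ℝ) ^ 2) * d n k ^ 2 ≤ B)
    (hlim : ∀ k, Tendsto (fun n => d n k) atTop (𝓝 0)) :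
    (∀ n, Summable (d n)) ∧ Tendsto (fun n => ∑' k, d n k) atTop (𝓝 0) := by
  have hw : ∀ n, Summable fun k : ℤ => (1 + (k:ℝ) ^ 2) * d n k ^ 2 := fun n =>
    summable_of_sum_le (fun k => by positivity) (hB n)
  have hwB : ∀ n, ∑' k : ℤ, (1 + (k:ℝ) ^ 2) * d n k ^ 2 ≤ B := fun n =>
    (hw n).tsum_le_of_sum_le (hB n)
  have hB0 : 0 ≤ B := by simpa using hB 0 ∅
  have key : ∀ η > 0, ∀ n, ∀ k : ℤ, d n k ≤ η * ((1 + (k:ℝ) ^ 2) * d n k ^ 2) +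
      min (d n k) (1 / η * (1 / (1 + (k:ℝ) ^ 2))) := by
    intro η hη n k
    have hk : 0 < 1 + (k:ℝ) ^ 2 := by positivity
    rcases min_choice (d n k) (1 / η * (1 / (1 + (k:ℝ) ^ 2))) with h | h
    · rw [h]
      have : 0 ≤ η * ((1 + (k:ℝ) ^ 2) * d n k ^ 2) := by positivity
      linarith
    · rw [h]
      set A := η * (1 + (k:ℝ) ^ 2) with hA
      have hApos : 0 < A := by positivity
      have h1 : 1 / η * (1 / (1 + (k:ℝ) ^ 2)) = A⁻¹ := by
        rw [hA, mul_inv]; simp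
      rw [h1, ← mul_assoc, ← hA]
      have h2 : A * A⁻¹ = 1 := mul_inv_cancel₀ hApos.ne'
      have h3 : 0 < A⁻¹ := inv_pos.2 hApos
      have h4 : 0 ≤ A⁻¹ * (A * d n k - 1 / 2) ^ 2 := by positivity
      have h5 : A⁻¹ * (A * d n k - 1 / 2) ^ 2 = A * d n k ^ 2 - d n k + A⁻¹ / 4 := by
        field_simp
        ring
      linarith
  have hmin : ∀ η > 0, ∀ n, Summable fun k : ℤ => min (d n k) (1 / η * (1 / (1 + (k:ℝ) ^ 2))) := by
    intro η hη n
    refine Summable.of_nonneg_of_le (fun k => le_min (hd0 n k) (by positivity))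
      (fun k => min_le_right _ _) (summable_wt.mul_left _)
  have hsum : ∀ n, Summable (d n) := fun n =>
    Summable.of_nonneg_of_le (hd0 n) (key 1 one_pos n) (((hw n).mul_left 1).add (hmin 1 one_pos n))
  refine ⟨hsum, ?_⟩
  rw [Metric.tendsto_atTop]
  intro ε hε
  obtain ⟨η, hη, hηB⟩ : ∃ η > 0, η * B ≤ ε / 2 := by
    refine ⟨ε / (2 * (B + 1)), by positivity, ?_⟩
    rw [div_mul_eq_mul_div, div_le_div_iff₀ (by positivity) (by norm_num)]
    nlinarith
  have h1 : Tendsto (fun n => ∑' k : ℤ, min (d n k) (1 / η * (1 / (1 + (k:ℝ) ^ 2)))) atTop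
      (𝓝 (∑' k : ℤ, (0:ℝ))) := by
    refine tendsto_tsum_of_dominated_convergence (summable_wt.mul_left (1 / η)) ?_ ?_
    · intro k
      have : (0:ℝ) = min 0 (1 / η * (1 / (1 + (k:ℝ) ^ 2))) := by
        rw [min_eq_left]; positivity
      rw [this]
      exact (hlim k).min tendsto_const_nhds
    · refine Eventually.of_forall fun n k => ?_
      rw [Real.norm_eq_abs, abs_of_nonneg (le_min (hd0 n k) (by positivity))]
      exact min_le_right _ _
  rw [tsum_zero, Metric.tendsto_atTop] at h1
  obtain ⟨n0, hn0⟩ := h1 (ε / 2) (by linarith)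
  refine ⟨n0, fun n hn => ?_⟩
  have h2 := hn0 n hn
  rw [Real.dist_eq, sub_zero] at h2 ⊢
  have h3 := (abs_lt.1 h2).2
  rw [abs_of_nonneg (tsum_nonneg (hd0 n))]
  have h4 : ∑' k, d n k ≤ η * ∑' k : ℤ, (1 + (k:ℝ) ^ 2) * d n k ^ 2 +
      ∑' k : ℤ, min (d n k) (1 / η * (1 / (1 + (k:ℝ) ^ 2))) := by
    rw [← tsum_mul_left, ← ((hw n).mul_left η).tsum_add (hmin η hη n)]
    exact (hsum n).tsum_le_tsum (key η hη n) (((hw n).mul_left η).add (hmin η hη n))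
  have h5 := mul_le_mul_of_nonneg_left (hwB n) hη.le
  linarith

/-- A continuous periodic function whose nonzero Fourier coefficients vanish is constant. -/
lemma const_of_fourier (f : ℝ → ℂ) (hf : Continuous f) (hper : ∀ s, f (s + 1) = f s)
    (h : ∀ k : ℤ, k ≠ 0 → ∫ s in (0:ℝ)..1, ee (-k) s * f s = 0) (s : ℝ) : f s = f 0 := by
  have : Fact (0 < (1:ℝ)) := ⟨one_pos⟩
  have hp : Function.Periodic f 1 := hper
  let F : C(AddCircle (1:ℝ), ℂ) := ⟨hp.lift, continuous_coinduced_dom.mpr hf⟩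
  have hF : ∀ s : ℝ, F (s : AddCircle (1:ℝ)) = f s := fun s => hp.lift_coe s
  have hc : ∀ k : ℤ, k ≠ 0 → fourierCoeff F k = 0 := by
    intro k hk
    rw [fourierCoeff_eq_intervalIntegral F k 0]
    have : ∀ s : ℝ, fourier (T := (1:ℝ)) (-k) (s : AddCircle (1:ℝ)) • F (s : AddCircle (1:ℝ)) =
        ee (-k) s * f s := by
      intro s
      rw [fourier_coe_apply, hF, smul_eq_mul, ee]
      simp
    simp only [this]
    rw [zero_add, h k hk, smul_zero]
  have hs : Summable (fourierCoeff F) :=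
    summable_of_ne_finset_zero (s := {0}) fun k hk => hc k (by simpa using hk)
  have hval : ∀ s : ℝ, f s = fourierCoeff F 0 := by
    intro s
    have h1 := has_pointwise_sum_fourier_series_of_summable hs (s : AddCircle (1:ℝ))
    have h2 : HasSum (fun i => fourierCoeff F i • fourier i (s : AddCircle (1:ℝ)))
        (fourierCoeff F 0 • fourier 0 (s : AddCircle (1:ℝ))) :=
      hasSum_single 0 fun k hk => by rw [hc k hk, zero_smul]
    rw [← hF, h1.unique h2]
    simp
  rw [hval s, hval 0]

section
variable {X : Type*} [NormedAddCommGroup X] [InnerProductSpace ℂ X] [CompleteSpace X]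

lemma ee_hasDerivAt (k : ℤ) (s : ℝ) :
    HasDerivAt (ee k) ((2 * Real.pi * Complex.I * k) * ee k s) s := by
  unfold ee
  have h1 : HasDerivAt (fun s : ℝ => (2 * Real.pi * Complex.I * k * s : ℂ))
      (2 * Real.pi * Complex.I * k) s := by
    simpa using (Complex.ofRealCLM.hasDerivAt (x := s)).const_mul (2 * Real.pi * Complex.I * k : ℂ)
  simpa [mul_comm] using h1.cexp

/-- Bootstrapping: weak solutions are classical. -/
lemma weak_classical (x y : ℝ → X) (hx : Continuous x) (hy : Continuous y)
    (hxp : ∀ s, x (s + 1) = x s) (hyp : ∀ s, y (s + 1) = y s)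
    (hk : ∀ k : ℤ, (2 * Real.pi * k : ℝ) • fc k x = fc k y) (s : ℝ) :
    HasDerivAt x (Complex.I • y s) s := by
  let P : ℝ → X := fun s => ∫ σ in (0:ℝ)..s, Complex.I • y σ
  have hIy : Continuous fun σ => Complex.I • y σ := hy.const_smul _
  have hP : ∀ s, HasDerivAt P (Complex.I • y s) s := fun s =>
    intervalIntegral.integral_hasDerivAt_right (hIy.intervalIntegrable _ _)
      (hIy.stronglyMeasurableAtFilter _ _) hIy.continuousAt
  have hPc : Continuous P := continuous_iff_continuousAt.2 fun s => (hP s).continuousAt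
  have hP0 : P 0 = 0 := by simp [P]
  have hP1 : P 1 = 0 := by
    have h1 : fc 0 y = 0 := by rw [← hk 0]; simp
    have h2 : P 1 = Complex.I • fc 0 y := by
      simp only [P, fc, neg_zero, ee_zero, one_smul]
      rw [intervalIntegral.integral_smul]
    rw [h2, h1, smul_zero]
  have hPp : ∀ s, P (s + 1) = P s := by
    intro s
    have h1 : ∀ s, HasDerivAt (fun s => P (s + 1) - P s) 0 s := by
      intro s
      have := ((hP (s+1)).comp_add_const s 1).sub (hP s)
      rw [hyp, sub_self] at this
      exact this
    have h2 := is_const_of_deriv_eq_zero (f := fun s => P (s + 1) - P s)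
      (fun s => (h1 s).differentiableAt) (fun s => (h1 s).deriv) s 0
    simp only [zero_add, hP0, hP1, sub_self] at h2
    exact sub_eq_zero.1 h2
  have hPk : ∀ k : ℤ, (2 * Real.pi * k : ℝ) • fc k P = fc k y := by
    intro k
    have h1 : ∀ s, HasDerivAt (fun s => ee (-k) s • P s)
        (ee (-k) s • (Complex.I • y s) + ((2 * Real.pi * Complex.I * (-k : ℤ)) * ee (-k) s) • P s) s :=
      fun s => (ee_hasDerivAt (-k) s).smul (hP s)
    have hc1 : Continuous fun s => ee (-k) s • (Complex.I • y s) := (ee_continuous _).smul hIy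
    have hc2 : Continuous fun s => ((2 * Real.pi * Complex.I * (-k : ℤ)) * ee (-k) s) • P s :=
      (continuous_const.mul (ee_continuous _)).smul hPc
    have h2 := intervalIntegral.integral_eq_sub_of_hasDerivAt (a := 0) (b := 1) (fun s _ => h1 s)
      ((hc1.add hc2).intervalIntegrable _ _)
    rw [hP0, hP1, smul_zero, smul_zero, sub_zero, intervalIntegral.integral_add
      (hc1.intervalIntegrable _ _) (hc2.intervalIntegrable _ _)] at h2
    have h3 : ∫ s in (0:ℝ)..1, ee (-k) s • (Complex.I • y s) = Complex.I • fc k y := by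
      rw [fc, ← intervalIntegral.integral_smul]
      refine intervalIntegral.integral_congr fun s _ => ?_
      simp only [smul_smul, mul_comm]
    have h4 : ∫ s in (0:ℝ)..1, ((2 * Real.pi * Complex.I * (-k : ℤ)) * ee (-k) s) • P s =
        (2 * Real.pi * Complex.I * (-k : ℤ)) • fc k P := by
      rw [fc, ← intervalIntegral.integral_smul]
      refine intervalIntegral.integral_congr fun s _ => ?_
      simp only [smul_smul]
    rw [h3, h4] at h2
    have h5 : Complex.I • (fc k y - (2 * Real.pi * k : ℝ) • fc k P) = 0 := by
      rw [← h2, ← Complex.coe_smul]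
      push_cast
      module
    have h6 := (smul_eq_zero.1 h5).resolve_left Complex.I_ne_zero
    exact (sub_eq_zero.1 h6).symm
  have hD : ∀ s, x s = P s + x 0 := by
    intro s
    have h0 : ∀ w : X, inner ℂ w (x s - P s) = inner ℂ w (x 0 - P 0) := by
      intro w
      refine const_of_fourier (fun s => inner ℂ w (x s - P s)) ?_ ?_ ?_ s
      · fun_prop
      · intro s; simp only [hxp, hPp]
      · intro k hk0
        have h1 : fc k (fun s => x s - P s) = 0 := by
          rw [fc_sub k hx hPc]
          have h2 : (2 * Real.pi * k : ℝ) • (fc k x - fc k P) = 0 := by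
            rw [smul_sub, hk, hPk, sub_self]
          refine (smul_eq_zero.1 h2).resolve_left ?_
          have := Real.pi_ne_zero
          have h3 : (k:ℝ) ≠ 0 := by exact_mod_cast hk0
          positivity
        have h2 := congrArg (innerSL ℂ w) h1
        rw [fc, map_zero, ← ContinuousLinearMap.intervalIntegral_comp_comm] at h2
        · rw [← h2]
          refine intervalIntegral.integral_congr fun s _ => ?_
          simp only [innerSL_apply_apply, inner_smul_right]
        · exact ((ee_continuous _).smul (hx.sub hPc)).intervalIntegrable _ _
    have h1 := ext_inner_left ℂ h0
    rw [hP0, sub_zero] at h1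
    rw [← h1]; abel
  have : x = fun s => P s + x 0 := funext hD
  rw [this]
  have h := (hP s).add_const (x 0)
  have h2 : y s = y s := rfl
  exact h

end
end Camel
end

section
namespace Camel
open Metric MeasureTheory Filter Topology
set_option linter.unusedSectionVars false
set_option linter.unusedSimpArgs false

section
variable {X : Type*} [NormedAddCommGroup X] [InnerProductSpace ℂ X]
variable {ea eb : X} {G : ℝ → X → ℝ} {Y : ℝ → X → X} {c : ℝ → X} {C δ ε L : ℝ}

lemma act_eq [CompleteSpace X] (G : ℝ → X → ℝ) (Y : ℝ → X → X) (hG : ∀ t, Continuous (G t))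
    (hY : ∀ t, Continuous (Y t)) (N : ℕ) (t : ℝ)
    (z : ℤ → X) : act G N t z = 1 / 2 * ∑ k ∈ Finset.Icc (-(N:ℤ)) N, rip (grd Y N t z k) (z k) +
      ∫ s in (0:ℝ)..1, (rip (Y t (loop N z s)) (loop N z s) / 2 - G t (loop N z s)) := by
  have hl := loop_continuous N z
  have hyc : Continuous fun s => Y t (loop N z s) := (hY t).comp hl
  rw [intervalIntegral.integral_sub, intervalIntegral.integral_div, integral_rip_loop N _ hyc]
  · unfold act
    have h1 : ∀ k ∈ Finset.Icc (-(N:ℤ)) N, rip (grd Y N t z k) (z k) =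
        2 * Real.pi * (k * ‖z k‖ ^ 2) - rip (fc k (fun s => Y t (loop N z s))) (z k) := by
      intro k hk
      have hg : grd Y N t z k = _ := if_pos hk
      rw [hg, rip_sub_left, rip_smul_left, rip_self]; ring
    rw [Finset.sum_congr rfl h1, Finset.sum_sub_distrib, ← Finset.mul_sum]
    ring
  · exact ((hyc.rip' hl).div_const 2).intervalIntegrable _ _
  · exact ((hG t).comp hl).intervalIntegrable _ _

lemma rip_sum_small (N : ℕ) (g z : ℤ → X) (lam : ℝ) (hl : 0 < lam) :
    |∑ k ∈ Finset.Icc (-(N:ℤ)) N, rip (g k) (z k)| ≤ lam * qn N g + lam⁻¹ * qn N z := by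
  refine (Finset.abs_sum_le_sum_abs _ _).trans ?_
  unfold qn
  rw [Finset.mul_sum, Finset.mul_sum, ← Finset.sum_add_distrib]
  refine Finset.sum_le_sum fun k _ => (rip_le _ _).trans ?_
  have h1 : lam * lam⁻¹ = 1 := mul_inv_cancel₀ hl.ne'
  have h2 : 0 < lam⁻¹ := inv_pos.2 hl
  have h4 : 0 ≤ lam⁻¹ * (lam * ‖g k‖ - ‖z k‖) ^ 2 := by positivity
  have h5 : lam⁻¹ * (lam * ‖g k‖ - ‖z k‖) ^ 2 =
      lam * ‖g k‖ ^ 2 - 2 * (‖g k‖ * ‖z k‖) + lam⁻¹ * ‖z k‖ ^ 2 := by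
    field_simp
    ring
  have h6 : 0 ≤ ‖g k‖ * ‖z k‖ := by positivity
  linarith

/-- Existence of a periodic orbit with positive action. -/
theorem IsHam.orbit [FiniteDimensional ℝ X] [CompleteSpace X]
    (H : IsHam ea eb G Y c C δ ε L) {e : ℝ} (he : 0 < e) (he2 : 2 * e ≤ 1) (C' : ℝ)
    (hA : ∀ t ∈ Icc (0:ℝ) 1, ∀ x, ‖Y t x - linA ea eb e x‖ ≤ C') :
    ∃ t ∈ Icc (0:ℝ) 1, ∃ x : ℝ → X, (∀ s, HasDerivAt x (Complex.I • Y t (x s)) s) ∧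
      (∀ s, x (s + 1) = x s) ∧
      0 < ∫ s in (0:ℝ)..1, (rip (Y t (x s)) (x s) / 2 - G t (x s)) := by
  have hpr : ProperSpace X := FiniteDimensional.proper ℝ X
  obtain ⟨β, M, hβ, hac⟩ := H.almost_critical
  obtain ⟨B, hB⟩ := apriori H.ha H.hb H.hab he he2 Y H.contYt C' hA
  have hδN : ∀ N : ℕ, (0:ℝ) < 1 / ((N:ℝ) + 1) ^ 2 := fun N => by positivity
  choose t' ht' z' hz1 hz2 hz3 using fun N : ℕ => hac (N+1) (by omega) _ (hδN N)
  -- cut off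
  let z : ℕ → ℤ → X := fun N k => if k ∈ Finset.Icc (-((N+1:ℕ):ℤ)) ((N+1:ℕ):ℤ) then z' N k else 0
  have hzz : ∀ N, ∀ k ∈ Finset.Icc (-((N+1:ℕ):ℤ)) ((N+1:ℕ):ℤ), z N k = z' N k :=
    fun N k hk => if_pos hk
  have hloop : ∀ N s, loop (N+1) (z' N) s = loop (N+1) (z N) s := by
    intro N s
    unfold loop
    exact Finset.sum_congr rfl fun k hk => by rw [hzz N k hk]
  have hzB : ∀ N (F : Finset ℤ), ∑ k ∈ F, (1 + (k:ℝ) ^ 2) * ‖z N k‖ ^ 2 ≤ B := by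
    intro N F
    have h1 := hB (N+1) (t' N) (ht' N) (z' N) ((hz1 N).trans (by
      rw [div_le_one (by positivity)]
      have : (0:ℝ) ≤ N := by positivity
      nlinarith))
    refine le_trans ?_ h1
    calc ∑ k ∈ F, (1 + (k:ℝ) ^ 2) * ‖z N k‖ ^ 2
        ≤ ∑ k ∈ F ∪ Finset.Icc (-((N+1:ℕ):ℤ)) ((N+1:ℕ):ℤ), (1 + (k:ℝ) ^ 2) * ‖z N k‖ ^ 2 :=
          Finset.sum_le_sum_of_subset_of_nonneg Finset.subset_union_left
            fun k _ _ => by positivity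
      _ = ∑ k ∈ Finset.Icc (-((N+1:ℕ):ℤ)) ((N+1:ℕ):ℤ), (1 + (k:ℝ) ^ 2) * ‖z N k‖ ^ 2 := by
          symm
          refine Finset.sum_subset Finset.subset_union_right fun k _ hk => ?_
          simp only [z, if_neg hk]; simp
      _ = _ := Finset.sum_congr rfl fun k hk => by rw [hzz N k hk]
  have hB0 : 0 ≤ B := by simpa using hzB 0 ∅
  have hzk : ∀ N k, ‖z N k‖ ≤ Real.sqrt B := by
    intro N k
    refine Real.le_sqrt_of_sq_le ?_
    have := hzB N {k}
    rw [Finset.sum_singleton] at this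
    nlinarith [mul_nonneg (sq_nonneg (k:ℝ)) (sq_nonneg ‖z N k‖)]
  -- compactness
  obtain ⟨⟨t, a⟩, hta, φ, hφ, hlim⟩ :=
    ((isCompact_Icc (a := (0:ℝ)) (b := 1)).prod (isCompact_univ_pi fun _ : ℤ =>
      isCompact_closedBall (0:X) (Real.sqrt B))).tendsto_subseq
      (x := fun N => (t' N, z N)) (fun N => ⟨ht' N, fun k _ => by simpa using hzk N k⟩)
  have ht : t ∈ Icc (0:ℝ) 1 := hta.1
  have hlimt : Tendsto (fun n => t' (φ n)) atTop (𝓝 t) := (continuous_fst.tendsto _).comp hlim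
  have hlimz : ∀ k, Tendsto (fun n => z (φ n) k) atTop (𝓝 (a k)) := fun k =>
    ((continuous_apply k).tendsto _).comp ((continuous_snd.tendsto _).comp hlim)
  have haB : ∀ F : Finset ℤ, ∑ k ∈ F, (1 + (k:ℝ) ^ 2) * ‖a k‖ ^ 2 ≤ B := by
    intro F
    refine le_of_tendsto (f := fun n => ∑ k ∈ F, (1 + (k:ℝ) ^ 2) * ‖z (φ n) k‖ ^ 2) (x := atTop) ?_
      (Eventually.of_forall fun n => hzB _ F)
    exact tendsto_finsetSum _ fun k _ => ((hlimz k).norm.pow 2).const_mul _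
  -- the tails
  have hdB : ∀ n (F : Finset ℤ), ∑ k ∈ F, (1 + (k:ℝ) ^ 2) * ‖z (φ n) k - a k‖ ^ 2 ≤ 4 * B := by
    intro n F
    have : ∑ k ∈ F, (1 + (k:ℝ) ^ 2) * ‖z (φ n) k - a k‖ ^ 2 ≤
        2 * ∑ k ∈ F, (1 + (k:ℝ) ^ 2) * ‖z (φ n) k‖ ^ 2 + 2 * ∑ k ∈ F, (1 + (k:ℝ) ^ 2) * ‖a k‖ ^ 2 := by
      rw [Finset.mul_sum, Finset.mul_sum, ← Finset.sum_add_distrib]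
      refine Finset.sum_le_sum fun k _ => ?_
      have h1 : ‖z (φ n) k - a k‖ ^ 2 ≤ (‖z (φ n) k‖ + ‖a k‖) ^ 2 := by
        gcongr; exact norm_sub_le _ _
      have h2 : ‖z (φ n) k - a k‖ ^ 2 ≤ 2 * ‖z (φ n) k‖ ^ 2 + 2 * ‖a k‖ ^ 2 := by
        nlinarith [sq_nonneg (‖z (φ n) k‖ - ‖a k‖)]
      have h3 : (0:ℝ) ≤ 1 + (k:ℝ) ^ 2 := by positivity
      nlinarith [mul_le_mul_of_nonneg_left h2 h3]
    have := hzB (φ n) F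
    have := haB F
    linarith
  obtain ⟨hds, hdl⟩ := tail_lemma (fun n k => ‖z (φ n) k - a k‖) (fun _ _ => norm_nonneg _) (4 * B) hdB
    (fun k => by simpa using ((hlimz k).sub_const (a k)).norm)
  have has : Summable fun k => ‖a k‖ := (tail_lemma (fun n k => ‖if n = 0 then a k else 0‖)
    (fun _ _ => norm_nonneg _) B (fun n F => by
      by_cases hn : n = 0
      · simpa [hn] using haB F
      · simpa [hn] using hB0) (fun k => by
      refine tendsto_const_nhds.congr' ?_
      filter_upwards [eventually_ge_atTop 1] with n hn
      rw [if_neg (by omega), norm_zero])).1 0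
  let x : ℝ → X := fun s => ∑' k : ℤ, ee k s • a k
  have hterm : ∀ (k : ℤ) (s : ℝ) (w : X), ‖ee k s • w‖ = ‖w‖ := fun k s w => by
    rw [norm_smul, ee_norm, one_mul]
  have hxc : Continuous x :=
    continuous_tsum (fun k => (ee_continuous k).smul continuous_const) has
      fun k s => (hterm k s _).le
  have hxs : ∀ s, Summable fun k : ℤ => ee k s • a k := fun s =>
    Summable.of_norm (by simpa only [hterm] using has)
  have heep : ∀ (k : ℤ) s, ee k (s + 1) = ee k s := by
    intro k s
    unfold ee
    rw [Complex.exp_eq_exp_iff_exists_int]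
    exact ⟨k, by push_cast; ring⟩
  have hxp : ∀ s, x (s + 1) = x s := fun s => by simp only [x, heep]
  let xn : ℕ → ℝ → X := fun n s => loop (φ n + 1) (z (φ n)) s
  have hxnc : ∀ n, Continuous (xn n) := fun n => loop_continuous _ _
  have hxnx : ∀ n s, ‖xn n s - x s‖ ≤ ∑' k, ‖z (φ n) k - a k‖ := by
    intro n s
    have h1 : HasSum (fun k : ℤ => ee k s • z (φ n) k) (xn n s) := by
      refine hasSum_sum_of_ne_finset_zero fun k hk => ?_
      simp only [z, if_neg hk, smul_zero]
    have h2 := h1.sub (hxs s).hasSum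
    change ‖xn n s - ∑' k : ℤ, ee k s • a k‖ ≤ _
    rw [← h2.tsum_eq]
    refine (norm_tsum_le_tsum_norm ?_).trans (le_of_eq ?_)
    · simpa only [← smul_sub, hterm] using hds n
    · simp only [← smul_sub, hterm]
  have hxnlim : ∀ s, Tendsto (fun n => xn n s) atTop (𝓝 (x s)) := by
    intro s
    rw [tendsto_iff_norm_sub_tendsto_zero]
    exact squeeze_zero (fun n => norm_nonneg _) (fun n => hxnx n s) hdl
  -- uniform bound
  obtain ⟨R, hR⟩ : ∃ R, ∀ n, ∀ s, ‖xn n s‖ ≤ R := by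
    obtain ⟨R1, hR1⟩ := hdl.bddAbove_range
    refine ⟨R1 + ∑' k, ‖a k‖, fun n s => ?_⟩
    have h1 : ‖x s‖ ≤ ∑' k, ‖a k‖ := by
      refine (norm_tsum_le_tsum_norm ?_).trans (le_of_eq ?_)
      · simpa only [hterm] using has
      · simp only [hterm]
    have h2 := (hxnx n s).trans (hR1 (mem_range_self n))
    have h3 := norm_add_le (xn n s - x s) (x s)
    rw [sub_add_cancel] at h3
    linarith
  have hcpt : IsCompact (Icc (0:ℝ) 1 ×ˢ closedBall (0:X) R) :=
    isCompact_Icc.prod (isCompact_closedBall _ _)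
  obtain ⟨BY, hBY⟩ := hcpt.exists_bound_of_continuousOn H.contY.continuousOn
  obtain ⟨BG, hBG⟩ := hcpt.exists_bound_of_continuousOn H.contG.continuousOn
  have hmem : ∀ n s, (t' (φ n), xn n s) ∈ Icc (0:ℝ) 1 ×ˢ closedBall (0:X) R := fun n s =>
    ⟨ht' _, by simpa using hR n s⟩
  have hpair : ∀ s, Tendsto (fun n => (t' (φ n), xn n s)) atTop (𝓝 (t, x s)) := fun s =>
    hlimt.prodMk_nhds (hxnlim s)
  have hYlim : ∀ s, Tendsto (fun n => Y (t' (φ n)) (xn n s)) atTop (𝓝 (Y t (x s))) := fun s =>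
    (H.contY.tendsto (t, x s)).comp (hpair s)
  have hGlim : ∀ s, Tendsto (fun n => G (t' (φ n)) (xn n s)) atTop (𝓝 (G t (x s))) := fun s =>
    (H.contG.tendsto (t, x s)).comp (hpair s)
  have hYn : ∀ n, Continuous fun s => Y (t' (φ n)) (xn n s) := fun n =>
    (H.contYt _).comp (hxnc n)
  have hfclim : ∀ k : ℤ, Tendsto (fun n => fc k (fun s => Y (t' (φ n)) (xn n s))) atTop
      (𝓝 (fc k (fun s => Y t (x s)))) := by
    intro k
    unfold fc
    refine intervalIntegral.tendsto_integral_filter_of_dominated_convergence (fun _ => BY) ?_ ?_ ?_ ?_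
    · exact Eventually.of_forall fun n => ((ee_continuous _).smul (hYn n)).aestronglyMeasurable
    · exact Eventually.of_forall fun n => Eventually.of_forall fun s _ => by
        rw [hterm]; exact hBY _ (hmem n s)
    · exact continuous_const.intervalIntegrable _ _
    · exact Eventually.of_forall fun s _ => (hYlim s).const_smul _
  have hfcx : ∀ k : ℤ, fc k x = a k := by
    intro k
    have h1 : Tendsto (fun n => fc k (xn n)) atTop (𝓝 (fc k x)) := by
      unfold fc
      refine intervalIntegral.tendsto_integral_filter_of_dominated_convergence (fun _ => R) ?_ ?_ ?_ ?_
      · exact Eventually.of_forall fun n => ((ee_continuous _).smul (hxnc n)).aestronglyMeasurable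
      · exact Eventually.of_forall fun n => Eventually.of_forall fun s _ => by
          rw [hterm]; exact hR n s
      · exact continuous_const.intervalIntegrable _ _
      · exact Eventually.of_forall fun s _ => (hxnlim s).const_smul _
    refine tendsto_nhds_unique h1 ((hlimz k).congr' ?_)
    filter_upwards [eventually_ge_atTop k.natAbs] with n hn
    refine (fc_loop _ _ ?_).symm
    have := hφ.id_le n
    simp only [id] at this
    rw [Finset.mem_Icc]
    constructor <;> push_cast <;> omega
  have hgrdsmall : ∀ N, qn (N+1) (grd Y (N+1) (t' N) (z' N)) ≤ 1 / ((N:ℝ)+1) ^ 2 := hz1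
  have hgk : ∀ k : ℤ, (2 * Real.pi * k : ℝ) • fc k x = fc k (fun s => Y t (x s)) := by
    intro k
    rw [hfcx]
    have h1 : Tendsto (fun n => (2 * Real.pi * k : ℝ) • z (φ n) k -
        fc k (fun s => Y (t' (φ n)) (xn n s))) atTop
        (𝓝 ((2 * Real.pi * k : ℝ) • a k - fc k (fun s => Y t (x s)))) :=
      ((hlimz k).const_smul _).sub (hfclim k)
    have h2 : Tendsto (fun n => (2 * Real.pi * k : ℝ) • z (φ n) k -
        fc k (fun s => Y (t' (φ n)) (xn n s))) atTop (𝓝 0) := by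
      rw [tendsto_zero_iff_norm_tendsto_zero]
      have h3 : Tendsto (fun n : ℕ => 1 / ((n:ℝ) + 1)) atTop (𝓝 0) :=
        tendsto_one_div_add_atTop_nhds_zero_nat
      refine squeeze_zero' (Eventually.of_forall fun n => norm_nonneg _) ?_
        (h3.comp hφ.tendsto_atTop)
      filter_upwards [eventually_ge_atTop k.natAbs] with n hn
      have hk : k ∈ Finset.Icc (-((φ n+1:ℕ):ℤ)) ((φ n+1:ℕ):ℤ) := by
        have := hφ.id_le n
        simp only [id] at this
        rw [Finset.mem_Icc]
        constructor <;> push_cast <;> omega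
      have h4 : grd Y (φ n+1) (t' (φ n)) (z' (φ n)) k = (2 * Real.pi * k : ℝ) • z (φ n) k -
          fc k (fun s => Y (t' (φ n)) (xn n s)) := by
        have hg : grd Y (φ n+1) (t' (φ n)) (z' (φ n)) k = _ := if_pos hk
        rw [hg, hzz _ _ hk]
        simp only [xn, hloop]
      rw [← h4]
      have h5 : ‖grd Y (φ n+1) (t' (φ n)) (z' (φ n)) k‖ ^ 2 ≤ 1 / ((φ n:ℝ)+1) ^ 2 := by
        refine le_trans ?_ (hz1 (φ n))
        exact Finset.single_le_sum (f := fun k => ‖grd Y (φ n+1) (t' (φ n)) (z' (φ n)) k‖ ^ 2)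
          (fun _ _ => by positivity) hk
      have h6 : (1 / ((φ n:ℝ)+1) ^ 2) = (1 / ((φ n:ℝ)+1)) ^ 2 := by rw [div_pow, one_pow]
      rw [h6] at h5
      exact (sq_le_sq₀ (norm_nonneg _) (show (0:ℝ) ≤ 1 / ((φ n:ℝ)+1) by positivity)).1 h5
    exact sub_eq_zero.1 (tendsto_nhds_unique h1 h2)
  refine ⟨t, ht, x, fun s => ?_, hxp, ?_⟩
  · exact weak_classical x (fun s => Y t (x s)) hxc ((H.contYt t).comp hxc) hxp
      (fun s => by simp only [hxp]) hgk s
  · have h1 : Tendsto (fun n => ∫ s in (0:ℝ)..1, (rip (Y (t' (φ n)) (xn n s)) (xn n s) / 2 -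
        G (t' (φ n)) (xn n s))) atTop
        (𝓝 (∫ s in (0:ℝ)..1, (rip (Y t (x s)) (x s) / 2 - G t (x s)))) := by
      refine intervalIntegral.tendsto_integral_filter_of_dominated_convergence
        (fun _ => BY * R / 2 + BG) ?_ ?_ ?_ ?_
      · exact Eventually.of_forall fun n => ((((hYn n).rip' (hxnc n)).div_const 2).sub
          ((H.contGt _).comp (hxnc n))).aestronglyMeasurable
      · refine Eventually.of_forall fun n => Eventually.of_forall fun s _ => ?_
        have g1 := hBY _ (hmem n s)
        have g2 := hBG _ (hmem n s)
        have g3 := rip_le (Y (t' (φ n)) (xn n s)) (xn n s)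
        have g4 : ‖Y (t' (φ n)) (xn n s)‖ * ‖xn n s‖ ≤ BY * R :=
          mul_le_mul g1 (hR n s) (norm_nonneg _) ((norm_nonneg _).trans g1)
        refine (norm_sub_le _ _).trans (add_le_add ?_ g2)
        rw [norm_div, Real.norm_eq_abs, Real.norm_eq_abs, abs_of_pos (show (0:ℝ) < 2 by norm_num)]
        linarith
      · exact continuous_const.intervalIntegrable _ _
      · exact Eventually.of_forall fun s _ =>
          ((rip_continuous.tendsto (Y t (x s), x s)).comp
            ((hYlim s).prodMk_nhds (hxnlim s))).div_const 2 |>.sub (hGlim s)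
    have h3 : Tendsto (fun n : ℕ => 1 / ((n:ℝ) + 1)) atTop (𝓝 0) :=
      tendsto_one_div_add_atTop_nhds_zero_nat
    have h4 : Tendsto (fun n : ℕ => β - 1 / 2 * ((1 + B) * (1 / ((φ n:ℝ) + 1)))) atTop
        (𝓝 (β - 1 / 2 * ((1 + B) * 0))) :=
      (((h3.comp hφ.tendsto_atTop).const_mul _).const_mul _).const_sub _
    have h5 : β ≤ ∫ s in (0:ℝ)..1, (rip (Y t (x s)) (x s) / 2 - G t (x s)) := by
      have h6 : β = β - 1 / 2 * ((1 + B) * 0) := by ring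
      rw [h6]
      refine le_of_tendsto_of_tendsto' h4 h1 fun n => ?_
      have h7 := hz2 (φ n)
      rw [act_eq G Y H.contGt H.contYt] at h7
      have h8 := rip_sum_small (φ n + 1) (grd Y (φ n+1) (t' (φ n)) (z' (φ n))) (z' (φ n))
        ((φ n:ℝ) + 1) (by positivity)
      have h9 : qn (φ n + 1) (z' (φ n)) ≤ B := by
        have g := hzB (φ n) (Finset.Icc (-((φ n+1:ℕ):ℤ)) ((φ n+1:ℕ):ℤ))
        refine le_trans ?_ g
        unfold qn
        refine Finset.sum_le_sum fun k hk => ?_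
        rw [hzz _ _ hk]
        nlinarith [mul_nonneg (sq_nonneg (k:ℝ)) (sq_nonneg ‖z' (φ n) k‖)]
      have g1 : ((φ n:ℝ) + 1) * qn (φ n + 1) (grd Y (φ n+1) (t' (φ n)) (z' (φ n))) ≤
          1 / ((φ n:ℝ) + 1) := by
        refine (mul_le_mul_of_nonneg_left (hz1 (φ n)) (by positivity)).trans (le_of_eq ?_)
        field_simp
      have g2 : ((φ n:ℝ) + 1)⁻¹ * qn (φ n + 1) (z' (φ n)) ≤ B * (1 / ((φ n:ℝ) + 1)) := by
        rw [one_div, mul_comm]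
        exact mul_le_mul_of_nonneg_right h9 (by positivity)
      have g3 := (le_abs_self _).trans h8
      simp only [hloop] at h7
      change _ ≤ _ + ∫ s in (0:ℝ)..1, (rip (Y (t' (φ n)) (xn n s)) (xn n s) / 2 -
        G (t' (φ n)) (xn n s)) at h7
      linarith
    exact hβ.trans_le h5

end
end Camel
end

section
namespace Camel
open Metric MeasureTheory Filter Topology
set_option linter.unusedSectionVars false
set_option linter.unusedSimpArgs false

/-! ### One dimensional profile functions -/

/-- slope function -/
def gam (a b v : ℝ) : ℝ := 3 * Real.pi / 2 * max 0 (min 1 ((v - a) / (b - a)))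

lemma gam_continuous (a b : ℝ) : Continuous (gam a b) := by
  unfold gam; fun_prop

lemma gam_nonneg (a b v : ℝ) : 0 ≤ gam a b v := by
  unfold gam
  have := Real.pi_pos
  have := le_max_left 0 (min 1 ((v - a) / (b - a)))
  positivity

lemma gam_le (a b v : ℝ) : gam a b v ≤ 3 * Real.pi / 2 := by
  unfold gam
  have h1 := Real.pi_pos
  have h2 : max 0 (min 1 ((v - a) / (b - a))) ≤ 1 := max_le zero_le_one (min_le_left _ _)
  nlinarith

lemma gam_mono {a b : ℝ} (hab : a < b) : Monotone (gam a b) := by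
  intro v w h
  unfold gam
  have h1 := Real.pi_pos
  have h0 : 0 < b - a := by linarith
  gcongr

lemma gam_zero {a b v : ℝ} (hab : a < b) (hv : v ≤ a) : gam a b v = 0 := by
  unfold gam
  have h0 : 0 < b - a := by linarith
  have h1 : (v - a) / (b - a) ≤ 0 := div_nonpos_of_nonpos_of_nonneg (by linarith) h0.le
  rw [max_eq_left ((min_le_right _ _).trans h1), mul_zero]

lemma gam_one {a b v : ℝ} (hab : a < b) (hv : b ≤ v) : gam a b v = 3 * Real.pi / 2 := by
  unfold gam
  have h0 : 0 < b - a := by linarith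
  have h1 : 1 ≤ (v - a) / (b - a) := by rw [one_le_div h0]; linarith
  rw [min_eq_left h1, max_eq_right zero_le_one, mul_one]

lemma gam_lip {a b : ℝ} (hab : a < b) (v w : ℝ) :
    |gam a b v - gam a b w| ≤ 3 * Real.pi / 2 / (b - a) * |v - w| := by
  unfold gam
  have h0 : 0 < b - a := by linarith
  have h1 := Real.pi_pos
  rw [← mul_sub, abs_mul, abs_of_pos (show (0:ℝ) < 3 * Real.pi / 2 by positivity)]
  rw [show 3 * Real.pi / 2 / (b - a) * |v - w| = 3 * Real.pi / 2 * (|v - w| / (b - a)) by ring]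
  refine mul_le_mul_of_nonneg_left ?_ (show (0:ℝ) ≤ 3 * Real.pi / 2 by positivity)
  refine (abs_max_sub_max_le_max _ _ _ _).trans ?_
  rw [sub_self, abs_zero, max_eq_right (abs_nonneg _)]
  refine (abs_min_sub_min_le_max _ _ _ _).trans ?_
  rw [sub_self, abs_zero, max_eq_right (abs_nonneg _), ← sub_div, abs_div, abs_of_pos h0]
  apply le_of_eq
  congr 2
  ring

/-- convex profile -/
def gpr (a b v : ℝ) : ℝ := ∫ x in (0:ℝ)..v, gam a b x

lemma gpr_zero' (a b : ℝ) : gpr a b 0 = 0 := by simp [gpr]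

lemma gpr_continuous (a b : ℝ) : Continuous (gpr a b) :=
  intervalIntegral.continuous_primitive (fun _ _ => (gam_continuous a b).intervalIntegrable _ _) 0

lemma gpr_convex {a b : ℝ} (hab : a < b) (v w : ℝ) :
    gpr a b v + gam a b v * (w - v) ≤ gpr a b w := by
  have hI : ∀ x y : ℝ, IntervalIntegrable (gam a b) volume x y := fun x y =>
    (gam_continuous a b).intervalIntegrable _ _
  have h1 : gpr a b w - gpr a b v = ∫ x in v..w, gam a b x :=
    intervalIntegral.integral_interval_sub_left (hI _ _) (hI _ _)
  rcases le_total v w with h | h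
  · have h2 : ∫ x in v..w, gam a b v ≤ ∫ x in v..w, gam a b x :=
      intervalIntegral.integral_mono_on h (continuous_const.intervalIntegrable _ _) (hI _ _)
        fun x hx => gam_mono hab hx.1
    rw [intervalIntegral.integral_const, smul_eq_mul] at h2
    linarith
  · have h2 : ∫ x in w..v, gam a b x ≤ ∫ x in w..v, gam a b v :=
      intervalIntegral.integral_mono_on h (hI _ _) (continuous_const.intervalIntegrable _ _)
        fun x hx => gam_mono hab hx.2
    rw [intervalIntegral.integral_const, smul_eq_mul] at h2
    rw [intervalIntegral.integral_symm] at h1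
    linarith

lemma gpr_nonneg {a b : ℝ} (ha : 0 ≤ a) (hab : a < b) (v : ℝ) : 0 ≤ gpr a b v := by
  have := gpr_convex hab 0 v
  rw [gpr_zero', gam_zero hab ha] at this
  linarith

lemma gpr_zero {a b : ℝ} (ha : 0 ≤ a) (hab : a < b) {v : ℝ} (hv : v ≤ a) : gpr a b v = 0 := by
  have := gpr_convex hab v 0
  rw [gpr_zero', gam_zero hab hv] at this
  have := gpr_nonneg ha hab v
  linarith

lemma gpr_lower {a b : ℝ} (ha : 0 ≤ a) (hab : a < b) (v : ℝ) :
    3 * Real.pi / 2 * (v - b) ≤ gpr a b v := by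
  have h1 := gpr_convex hab b v
  have h2 := gpr_nonneg ha hab b
  rw [gam_one hab le_rfl] at h1
  linarith

lemma gpr_upper {a b : ℝ} (hab : a < b) (v : ℝ) :
    gpr a b v ≤ 3 * Real.pi / 2 * |v| := by
  have h1 := gpr_convex hab v 0
  rw [gpr_zero'] at h1
  have h2 := gam_le a b v
  have h3 := gam_nonneg a b v
  have h4 := le_abs_self v
  nlinarith [abs_nonneg v]

/-- deviation from the interval `[-ρ, ρ]` -/
def dev (ρ x : ℝ) : ℝ := x - max (-ρ) (min ρ x)

lemma dev_continuous (ρ : ℝ) : Continuous (dev ρ) := by unfold dev; fun_prop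

lemma dev_cases {ρ : ℝ} (hρ : 0 < ρ) (x : ℝ) :
    (x ≤ -ρ ∧ dev ρ x = x + ρ) ∨ (-ρ ≤ x ∧ x ≤ ρ ∧ dev ρ x = 0) ∨ (ρ ≤ x ∧ dev ρ x = x - ρ) := by
  unfold dev
  rcases le_total x (-ρ) with h | h
  · left
    rw [min_eq_right (by linarith), max_eq_left h]
    exact ⟨h, by ring⟩
  · rcases le_total x ρ with h2 | h2
    · right; left
      rw [min_eq_right h2, max_eq_right h]
      exact ⟨h, h2, by ring⟩
    · right; right
      rw [min_eq_left h2, max_eq_right (by linarith)]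
      exact ⟨h2, rfl⟩

lemma dev_zero {ρ : ℝ} (hρ : 0 < ρ) {x : ℝ} (h : |x| ≤ ρ) : dev ρ x = 0 := by
  obtain ⟨h1, h2⟩ := abs_le.1 h
  rcases dev_cases hρ x with ⟨g1, g2⟩ | ⟨g1, g2, g3⟩ | ⟨g1, g2⟩
  · rw [g2]; linarith
  · exact g3
  · rw [g2]; linarith

lemma dev_lip {ρ : ℝ} (hρ : 0 < ρ) (x y : ℝ) : |dev ρ x - dev ρ y| ≤ |x - y| := by
  rw [abs_le]
  rcases abs_cases (x - y) with ⟨h, h'⟩ | ⟨h, h'⟩ <;> rw [h] <;>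
  rcases dev_cases hρ x with ⟨g1, g2⟩ | ⟨g1, g2, g3⟩ | ⟨g1, g2⟩ <;>
  rcases dev_cases hρ y with ⟨k1, k2⟩ | ⟨k1, k2, k3⟩ | ⟨k1, k2⟩ <;>
  constructor <;> linarith

lemma dev_sub {ρ : ℝ} (hρ : 0 < ρ) (x : ℝ) : |x - dev ρ x| ≤ ρ := by
  rw [abs_le]
  rcases dev_cases hρ x with ⟨g1, g2⟩ | ⟨g1, g2, g3⟩ | ⟨g1, g2⟩ <;> constructor <;> linarith

lemma dev_abs {ρ : ℝ} (hρ : 0 < ρ) (x : ℝ) : |dev ρ x| ≤ |x| := by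
  have := dev_lip hρ x 0
  rwa [dev_zero hρ (x := 0) (by simpa using hρ.le), sub_zero, sub_zero] at this

lemma dev_mul {ρ : ℝ} (hρ : 0 < ρ) (x : ℝ) : 0 ≤ dev ρ x * x := by
  rcases dev_cases hρ x with ⟨g1, g2⟩ | ⟨g1, g2, g3⟩ | ⟨g1, g2⟩
  · rw [g2]; nlinarith
  · rw [g3]; simp
  · rw [g2]; nlinarith

lemma dev_convex {ρ : ℝ} (hρ : 0 < ρ) (x η : ℝ) :
    dev ρ x ^ 2 + 2 * dev ρ x * η ≤ dev ρ (x + η) ^ 2 := by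
  rcases dev_cases hρ x with ⟨g1, g2⟩ | ⟨g1, g2, g3⟩ | ⟨g1, g2⟩
  · rcases dev_cases hρ (x + η) with ⟨k1, k2⟩ | ⟨k1, k2, k3⟩ | ⟨k1, k2⟩
    · rw [g2, k2]; nlinarith [sq_nonneg η]
    · rw [g2, k3]; nlinarith [sq_nonneg η]
    · rw [g2, k2]; nlinarith [sq_nonneg η]
  · rw [g3]; nlinarith [sq_nonneg (dev ρ (x + η))]
  · rcases dev_cases hρ (x + η) with ⟨k1, k2⟩ | ⟨k1, k2, k3⟩ | ⟨k1, k2⟩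
    · rw [g2, k2]; nlinarith [sq_nonneg η]
    · rw [g2, k3]; nlinarith [sq_nonneg η]
    · rw [g2, k2]; nlinarith [sq_nonneg η]

lemma dev_concave {ρ : ℝ} (hρ : 0 < ρ) (x η : ℝ) :
    dev ρ (x + η) ^ 2 ≤ dev ρ x ^ 2 + 2 * dev ρ x * η + η ^ 2 := by
  have h1 : dev ρ (x + η) ^ 2 ≤ (dev ρ x + η) ^ 2 := by
    rw [sq_le_sq, abs_le]
    rcases abs_cases (dev ρ x + η) with ⟨h, h'⟩ | ⟨h, h'⟩ <;> rw [h] <;>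
    rcases dev_cases hρ x with ⟨g1, g2⟩ | ⟨g1, g2, g3⟩ | ⟨g1, g2⟩ <;>
    rcases dev_cases hρ (x + η) with ⟨k1, k2⟩ | ⟨k1, k2, k3⟩ | ⟨k1, k2⟩ <;>
    constructor <;> linarith
  nlinarith

lemma dev_lower {ρ : ℝ} (hρ : 0 < ρ) (x : ℝ) : x ^ 2 / 2 - ρ ^ 2 ≤ dev ρ x ^ 2 := by
  have h := dev_sub hρ x
  have h1 : (x - dev ρ x) ^ 2 ≤ ρ ^ 2 := sq_le_sq' (abs_le.1 h).1 (abs_le.1 h).2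
  nlinarith [sq_nonneg (x - 2 * dev ρ x)]

/-- barrier profile -/
def kap (Λ q : ℝ) : ℝ := Λ * q ^ 2 / (1 + q ^ 2)

/-- its derivative -/
def kap' (Λ q : ℝ) : ℝ := 2 * Λ * q / (1 + q ^ 2) ^ 2

lemma kap_continuous (Λ : ℝ) : Continuous (kap Λ) := by
  unfold kap
  refine Continuous.div (by fun_prop) (by fun_prop) fun q => by positivity

lemma kap'_continuous (Λ : ℝ) : Continuous (kap' Λ) := by
  unfold kap'
  refine Continuous.div (by fun_prop) (by fun_prop) fun q => by positivity

lemma kap_nonneg {Λ : ℝ} (hΛ : 0 < Λ) (q : ℝ) : 0 ≤ kap Λ q := by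
  unfold kap; positivity

lemma kap_le {Λ : ℝ} (hΛ : 0 < Λ) (q : ℝ) : kap Λ q ≤ Λ := by
  unfold kap
  rw [div_le_iff₀ (by positivity)]
  nlinarith

lemma kap_zero (Λ : ℝ) : kap Λ 0 = 0 := by simp [kap]

lemma kap_concave {Λ : ℝ} (hΛ : 0 < Λ) (q η : ℝ) :
    kap Λ (q + η) ≤ kap Λ q + kap' Λ q * η + Λ * η ^ 2 := by
  unfold kap kap'
  have h1 : 0 < 1 + q ^ 2 := by positivity
  have h2 : 0 < 1 + (q + η) ^ 2 := by positivity
  have h3 : Λ * q ^ 2 / (1 + q ^ 2) + 2 * Λ * q / (1 + q ^ 2) ^ 2 * η + Λ * η ^ 2 -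
      Λ * (q + η) ^ 2 / (1 + (q + η) ^ 2) =
      Λ * ((q + η) ^ 2 - q ^ 2) ^ 2 / ((1 + q ^ 2) ^ 2 * (1 + (q + η) ^ 2)) +
      Λ * η ^ 2 * (1 - 1 / (1 + q ^ 2) ^ 2) := by
    field_simp
    ring
  have h4 : 0 ≤ 1 - 1 / (1 + q ^ 2) ^ 2 := by
    rw [sub_nonneg, div_le_one (by positivity)]
    nlinarith [sq_nonneg q]
  have h5 : 0 ≤ Λ * ((q + η) ^ 2 - q ^ 2) ^ 2 / ((1 + q ^ 2) ^ 2 * (1 + (q + η) ^ 2)) +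
      Λ * η ^ 2 * (1 - 1 / (1 + q ^ 2) ^ 2) := by positivity
  linarith

lemma kap'_bound {Λ : ℝ} (hΛ : 0 < Λ) (q : ℝ) : |kap' Λ q| ≤ 2 * Λ := by
  unfold kap'
  rw [abs_div, abs_of_pos (show 0 < (1 + q ^ 2) ^ 2 by positivity), div_le_iff₀ (by positivity),
    abs_mul, abs_of_pos (by positivity)]
  have h : |q| ≤ (1 + q ^ 2) ^ 2 := by
    have h' := sq_abs q
    nlinarith [abs_nonneg q, sq_nonneg (|q| - 1), sq_nonneg (q ^ 2)]
  nlinarith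

lemma kap'_mul {Λ : ℝ} (hΛ : 0 < Λ) (q : ℝ) : 0 ≤ kap' Λ q * q := by
  unfold kap'
  have : 2 * Λ * q / (1 + q ^ 2) ^ 2 * q = 2 * Λ * q ^ 2 / (1 + q ^ 2) ^ 2 := by ring
  rw [this]; positivity

lemma kap'_eq_zero {Λ : ℝ} (hΛ : 0 < Λ) {q : ℝ} (h : kap' Λ q = 0) : q = 0 := by
  unfold kap' at h
  rw [div_eq_zero_iff] at h
  rcases h with h | h
  · simpa [hΛ.ne'] using h
  · exact absurd h (by positivity)

lemma kap_hasDerivAt (Λ q : ℝ) : HasDerivAt (kap Λ) (kap' Λ q) q := by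
  unfold kap kap'
  have h0 : (1 + q ^ 2) ≠ 0 := by positivity
  have h1 : HasDerivAt (fun q : ℝ => Λ * q ^ 2) (Λ * (2 * q)) q := by
    simpa using ((hasDerivAt_pow 2 q).const_mul Λ)
  have h2 : HasDerivAt (fun q : ℝ => 1 + q ^ 2) (2 * q) q := by
    simpa using ((hasDerivAt_pow 2 q).const_add 1)
  convert! h1.div h2 h0 using 1
  field_simp
  ring

lemma kap_lip {Λ : ℝ} (hΛ : 0 < Λ) (q q' : ℝ) : |kap Λ q - kap Λ q'| ≤ 2 * Λ * |q - q'| := by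
  have := Convex.norm_image_sub_le_of_norm_hasDerivWithin_le (f := kap Λ) (f' := kap' Λ)
    (s := univ) (C := 2 * Λ) (x := q') (y := q) (fun x _ => (kap_hasDerivAt Λ x).hasDerivWithinAt)
    (fun x _ => kap'_bound hΛ x) convex_univ (mem_univ _) (mem_univ _)
  simpa using this

lemma kap'_lip {Λ : ℝ} (hΛ : 0 < Λ) (q q' : ℝ) : |kap' Λ q - kap' Λ q'| ≤ 6 * Λ * |q - q'| := by
  have hd : ∀ q : ℝ, HasDerivAt (kap' Λ) (2 * Λ * (1 - 3 * q ^ 2) / (1 + q ^ 2) ^ 3) q := by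
    intro q
    unfold kap'
    have h0 : (1 + q ^ 2) ≠ 0 := by positivity
    have h1 : HasDerivAt (fun q : ℝ => 2 * Λ * q) (2 * Λ) q := by
      simpa using ((hasDerivAt_id q).const_mul (2 * Λ))
    have h2 : HasDerivAt (fun q : ℝ => (1 + q ^ 2) ^ 2) (2 * (1 + q ^ 2) * (2 * q)) q := by
      have h2 : HasDerivAt (fun q : ℝ => 1 + q ^ 2) (2 * q) q := by
        simpa using ((hasDerivAt_pow 2 q).const_add 1)
      convert! h2.mul h2 using 1
      · ext x; simp [pow_two]
      · ring
    convert! h1.div h2 (pow_ne_zero 2 h0) using 1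
    field_simp
    ring
  have hb : ∀ q : ℝ, ‖2 * Λ * (1 - 3 * q ^ 2) / (1 + q ^ 2) ^ 3‖ ≤ 6 * Λ := by
    intro q
    rw [norm_div, Real.norm_eq_abs, Real.norm_eq_abs, abs_of_pos (show 0 < (1 + q ^ 2) ^ 3 by positivity),
      div_le_iff₀ (by positivity), abs_mul, abs_of_pos (show 0 < 2 * Λ by positivity)]
    have h1 : |1 - 3 * q ^ 2| ≤ 3 * (1 + q ^ 2) ^ 3 := by
      have h2 : 1 + q ^ 2 ≤ (1 + q ^ 2) ^ 3 := by
        nlinarith [sq_nonneg q, sq_nonneg (q ^ 2), mul_nonneg (sq_nonneg q) (sq_nonneg (q ^ 2))]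
      rw [abs_le]
      constructor <;> nlinarith [sq_nonneg q]
    nlinarith
  have := Convex.norm_image_sub_le_of_norm_hasDerivWithin_le (f := kap' Λ)
    (s := univ) (C := 6 * Λ) (x := q') (y := q) (fun x _ => (hd x).hasDerivWithinAt)
    (fun x _ => hb x) convex_univ (mem_univ _) (mem_univ _)
  simpa using this

/-! ### Oscillation and rotation lemmas -/

/-- The oscillation argument. -/
lemma osc (q p : ℝ → ℝ) (A B : ℝ → ℝ) (a b : ℝ) (ha : 0 ≤ a) (hb : 0 ≤ b) (hab : a * b < 1)
    (hA : ∀ x y, |A x - A y| ≤ a * |x - y|) (hB : ∀ x y, |B x - B y| ≤ b * |x - y|)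
    (hq : ∀ s, HasDerivAt q (A (p s)) s) (hp : ∀ s, HasDerivAt p (B (q s)) s)
    (hq1 : ∀ s, q (s + 1) = q s) (hp1 : ∀ s, p (s + 1) = p s) (s : ℝ) :
    A (p s) = 0 ∧ B (q s) = 0 ∧ q s = q 0 ∧ p s = p 0 := by
  -- oscillation bounds
  have key : ∀ (f g : ℝ → ℝ) (Φ : ℝ → ℝ) (c D : ℝ), 0 ≤ c → (∀ x y, |Φ x - Φ y| ≤ c * |x - y|) →
      (∀ s, HasDerivAt f (Φ (g s)) s) → (∀ s, f (s + 1) = f s) →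
      (∀ s ∈ Icc (0:ℝ) 1, ∀ s' ∈ Icc (0:ℝ) 1, |g s - g s'| ≤ D) →
      (∀ s ∈ Icc (0:ℝ) 1, |Φ (g s)| ≤ c * D) ∧
      ∀ s ∈ Icc (0:ℝ) 1, ∀ s' ∈ Icc (0:ℝ) 1, |f s - f s'| ≤ c * D := by
    intro f g Φ c D hc hΦ hf hf1 hg
    have hfc : Continuous f := continuous_iff_continuousAt.2 fun s => (hf s).continuousAt
    obtain ⟨s0, hs0, h0⟩ := exists_hasDerivAt_eq_zero (f := f) (f' := fun s => Φ (g s))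
      (a := 0) (b := 1) zero_lt_one hfc.continuousOn (by have := hf1 0; simpa using this.symm)
      (fun s _ => hf s)
    have h1 : ∀ s ∈ Icc (0:ℝ) 1, |Φ (g s)| ≤ c * D := by
      intro s hs
      have h2 := hΦ (g s) (g s0)
      rw [h0, sub_zero] at h2
      exact h2.trans (mul_le_mul_of_nonneg_left (hg s hs s0 (Ioo_subset_Icc_self hs0)) hc)
    refine ⟨h1, fun s hs s' hs' => ?_⟩
    have h3 := Convex.norm_image_sub_le_of_norm_hasDerivWithin_le (f := f) (f' := fun s => Φ (g s))
      (s := Icc (0:ℝ) 1) (C := c * D) (x := s') (y := s) (fun x _ => (hf x).hasDerivWithinAt)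
      (fun x hx => h1 x hx) (convex_Icc 0 1) hs' hs
    rw [Real.norm_eq_abs, Real.norm_eq_abs] at h3
    have h4 : |s - s'| ≤ 1 := by
      rw [abs_le]; constructor <;> linarith [hs.1, hs.2, hs'.1, hs'.2]
    have h5 : 0 ≤ c * D := (abs_nonneg _).trans (h1 s hs)
    nlinarith [abs_nonneg (s - s')]
  have hqc : Continuous q := continuous_iff_continuousAt.2 fun s => (hq s).continuousAt
  obtain ⟨Q, hQ⟩ := (isCompact_Icc (a := (0:ℝ)) (b := 1)).exists_bound_of_continuousOn
    hqc.continuousOn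
  have h0 : ∀ s ∈ Icc (0:ℝ) 1, ∀ s' ∈ Icc (0:ℝ) 1, |q s - q s'| ≤ 2 * Q := by
    intro s hs s' hs'
    have h1 := hQ s hs
    have h2 := hQ s' hs'
    have := norm_sub_le (q s) (q s')
    rw [← Real.norm_eq_abs]
    linarith
  have step : ∀ D, (∀ s ∈ Icc (0:ℝ) 1, ∀ s' ∈ Icc (0:ℝ) 1, |q s - q s'| ≤ D) →
      ∀ s ∈ Icc (0:ℝ) 1, ∀ s' ∈ Icc (0:ℝ) 1, |q s - q s'| ≤ (a * b) * D := by
    intro D hD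
    have h1 := (key p q B b D hb hB hp hp1 hD).2
    have h2 := (key q p A a (b * D) ha hA hq hq1 h1).2
    simpa [mul_assoc] using h2
  have hit : ∀ n : ℕ, ∀ s ∈ Icc (0:ℝ) 1, ∀ s' ∈ Icc (0:ℝ) 1, |q s - q s'| ≤ (a * b) ^ n * (2 * Q) := by
    intro n
    induction n with
    | zero => simpa using h0
    | succ n ih =>
      have := step _ ih
      simpa [pow_succ', mul_assoc] using this
  have hzero : ∀ s ∈ Icc (0:ℝ) 1, ∀ s' ∈ Icc (0:ℝ) 1, |q s - q s'| ≤ 0 := by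
    intro s hs s' hs'
    have hl : Tendsto (fun n : ℕ => (a * b) ^ n * (2 * Q)) atTop (𝓝 (0 * (2 * Q))) :=
      (tendsto_pow_atTop_nhds_zero_of_lt_one (by positivity) hab).mul_const _
    rw [zero_mul] at hl
    exact ge_of_tendsto' hl fun n => hit n s hs s' hs'
  obtain ⟨k1, k2⟩ := key p q B b 0 hb hB hp hp1 hzero
  rw [mul_zero] at k1 k2
  obtain ⟨k3, k4⟩ := key q p A a 0 ha hA hq hq1 k2
  rw [mul_zero] at k3 k4
  have hfr : Int.fract s ∈ Icc (0:ℝ) 1 := ⟨Int.fract_nonneg s, (Int.fract_lt_one s).le⟩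
  have hqs : q s = q (Int.fract s) := by
    have h1 : Function.Periodic q 1 := hq1
    rw [← Int.self_sub_floor]
    have := h1.sub_zsmul_eq (x := s) ⌊s⌋
    simpa using this.symm
  have hps : p s = p (Int.fract s) := by
    have h1 : Function.Periodic p 1 := hp1
    rw [← Int.self_sub_floor]
    have := h1.sub_zsmul_eq (x := s) ⌊s⌋
    simpa using this.symm
  have h00 : (0:ℝ) ∈ Icc (0:ℝ) 1 := by simp
  rw [hqs, hps]
  refine ⟨abs_nonpos_iff.1 (k3 _ hfr), abs_nonpos_iff.1 (k1 _ hfr), ?_, ?_⟩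
  · exact sub_eq_zero.1 (abs_nonpos_iff.1 (k4 _ hfr _ h00))
  · exact sub_eq_zero.1 (abs_nonpos_iff.1 (k2 _ hfr _ h00))

section
variable {X : Type*} [NormedAddCommGroup X] [InnerProductSpace ℂ X]

/-- A uniform rotation which is 1-periodic. -/
lemma rotation (w : ℝ → X) (lam : ℝ) (hw : ∀ s, HasDerivAt w (((lam : ℂ) * Complex.I) • w s) s)
    (hw1 : w 1 = w 0) : w 0 = 0 ∨ ∃ n : ℤ, lam = 2 * Real.pi * n := by
  let E : ℝ → ℂ := fun s => Complex.exp (-(lam : ℂ) * Complex.I * s)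
  have hE : ∀ s, HasDerivAt E ((-(lam : ℂ) * Complex.I) * E s) s := by
    intro s
    have h1 : HasDerivAt (fun s : ℝ => (-(lam : ℂ) * Complex.I * s : ℂ)) (-(lam : ℂ) * Complex.I) s := by
      simpa using (Complex.ofRealCLM.hasDerivAt (x := s)).const_mul (-(lam : ℂ) * Complex.I : ℂ)
    convert! h1.cexp using 1
    rw [mul_comm]
  have hd : ∀ s, HasDerivAt (fun s => E s • w s) 0 s := by
    intro s
    convert! (hE s).smul (hw s) using 1
    module
  have h2 := is_const_of_deriv_eq_zero (f := fun s => E s • w s)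
      (fun s => (hd s).differentiableAt) (fun s => (hd s).deriv) 1 0
  simp only [hw1] at h2
  by_cases h0 : w 0 = 0
  · exact Or.inl h0
  · right
    have h3 := smul_left_injective ℂ h0 h2
    simp only [E, Complex.ofReal_one, mul_one, Complex.ofReal_zero, mul_zero, Complex.exp_zero] at h3
    rw [Complex.exp_eq_one_iff] at h3
    obtain ⟨n, hn⟩ := h3
    refine ⟨-n, ?_⟩
    have h4 := congrArg Complex.im hn
    simp at h4
    push_cast
    linarith

end
end Camel
end

section
namespace Camel
open Metric MeasureTheory Filter Topology
set_option linter.unusedSectionVars false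
set_option linter.unusedSimpArgs false

section
variable {X : Type*} [NormedAddCommGroup X] [InnerProductSpace ℂ X]

/-! ### The outer Hamiltonian -/

/-- component orthogonal to `ea, eb` -/
def wpt (ea eb z : X) : X := z - (inner ℂ ea z) • ea - (inner ℂ eb z) • eb

/-- slope of the radial part -/
def rad (ε ρ x : ℝ) : ℝ := 2 * ε * dev ρ x / max x ρ

/-- outer Hamiltonian -/
def outF (ea eb : X) (a b Λ ε ρ : ℝ) (z : X) : ℝ :=
  gpr a b (‖inner ℂ ea z‖ ^ 2 - kap Λ (inner ℂ eb z).re) + ε * dev ρ (inner ℂ eb z).im ^ 2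
    - ε * dev ρ (inner ℂ eb z).re ^ 2 + ε * dev ρ ‖wpt ea eb z‖ ^ 2

/-- slope along the orbit -/
def slo (ea eb : X) (a b Λ : ℝ) (z : X) : ℝ :=
  gam a b (‖inner ℂ ea z‖ ^ 2 - kap Λ (inner ℂ eb z).re)

/-- the force in direction `q` -/
def phi (a b Λ ε ρ u q : ℝ) : ℝ := gam a b (u - kap Λ q) * kap' Λ q + 2 * ε * dev ρ q

/-- gradient of the outer Hamiltonian -/
def outY (ea eb : X) (a b Λ ε ρ : ℝ) (z : X) : X :=
  (((2 * slo ea eb a b Λ z : ℝ) : ℂ) * inner ℂ ea z) • ea +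
  (((- phi a b Λ ε ρ (‖inner ℂ ea z‖ ^ 2) (inner ℂ eb z).re : ℝ) : ℂ) +
    ((2 * ε * dev ρ (inner ℂ eb z).im : ℝ) : ℂ) * Complex.I) • eb +
  ((rad ε ρ ‖wpt ea eb z‖ : ℝ) : ℂ) • wpt ea eb z

variable {ea eb : X} {a b Λ ε ρ : ℝ}

lemma wpt_continuous : Continuous (wpt ea eb) := by unfold wpt; fun_prop

lemma wpt_add (x y : X) : wpt ea eb (x + y) = wpt ea eb x + wpt ea eb y := by
  simp only [wpt, inner_add_right, add_smul]; abel

lemma inner_one (h : ‖ea‖ = 1) : inner ℂ ea ea = (1:ℂ) := by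
  rw [inner_self_eq_norm_sq_to_K, h]; simp

lemma inner_swap (hab : inner ℂ ea eb = 0) : inner ℂ eb ea = 0 := by
  rw [← inner_conj_symm, hab, map_zero]

lemma wpt_a (ha : ‖ea‖ = 1) (hab : inner ℂ ea eb = 0) (x : X) : inner ℂ ea (wpt ea eb x) = 0 := by
  simp only [wpt, inner_sub_right, inner_smul_right, inner_one ha, hab]; simp

lemma wpt_b (hb : ‖eb‖ = 1) (hab : inner ℂ ea eb = 0) (x : X) : inner ℂ eb (wpt ea eb x) = 0 := by
  simp only [wpt, inner_sub_right, inner_smul_right, inner_one hb, inner_swap hab]; simp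

lemma norm_decomp (ha : ‖ea‖ = 1) (hb : ‖eb‖ = 1) (hab : inner ℂ ea eb = 0) (x : X) :
    ‖x‖ ^ 2 = ‖inner ℂ ea x‖ ^ 2 + ((inner ℂ eb x).re ^ 2 + (inner ℂ eb x).im ^ 2) +
      ‖wpt ea eb x‖ ^ 2 := by
  have h1 := norm_sq_comb3 ha hb hab (inner ℂ ea x) (inner ℂ eb x) (wpt ea eb x) (wpt_a ha hab x)
    (wpt_b hb hab x)
  have h2 : ‖inner ℂ eb x‖ ^ 2 = (inner ℂ eb x).re ^ 2 + (inner ℂ eb x).im ^ 2 := by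
    rw [Complex.sq_norm, Complex.normSq_apply]; ring
  rw [← h2, ← h1]
  congr 2
  simp [wpt]

lemma rip_wpt (ha : ‖ea‖ = 1) (hb : ‖eb‖ = 1) (hab : inner ℂ ea eb = 0) (x y : X) :
    rip (wpt ea eb x) y = rip (wpt ea eb x) (wpt ea eb y) := by
  have h1 : inner ℂ (wpt ea eb x) ea = 0 := inner_swap (wpt_a ha hab x)
  have h2 : inner ℂ (wpt ea eb x) eb = 0 := inner_swap (wpt_b hb hab x)
  have h3 : wpt ea eb y = y - (inner ℂ ea y) • ea - (inner ℂ eb y) • eb := rfl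
  unfold rip
  rw [h3, inner_sub_right, inner_sub_right, inner_smul_right, inner_smul_right, h1, h2]
  simp

lemma rad_continuous (hρ : 0 < ρ) : Continuous (rad ε ρ) := by
  unfold rad
  refine Continuous.div (continuous_const.mul (dev_continuous ρ)) (by fun_prop) fun x => ?_
  exact (lt_max_of_lt_right hρ).ne'

lemma rad_nonneg (hρ : 0 < ρ) (hε : 0 < ε) {x : ℝ} (hx : 0 ≤ x) : 0 ≤ rad ε ρ x := by
  have : 0 ≤ dev ρ x := by
    rcases dev_cases hρ x with ⟨g1, g2⟩ | ⟨g1, g2, g3⟩ | ⟨g1, g2⟩ <;> linarith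
  unfold rad
  have : 0 < max x ρ := lt_max_of_lt_right hρ
  positivity

lemma rad_mul (hρ : 0 < ρ) {x : ℝ} (hx : 0 ≤ x) : rad ε ρ x * x = 2 * ε * dev ρ x := by
  unfold rad
  rcases dev_cases hρ x with ⟨g1, g2⟩ | ⟨g1, g2, g3⟩ | ⟨g1, g2⟩
  · linarith
  · simp [g3]
  · rw [max_eq_left g1, div_mul_cancel₀]; linarith

lemma rad_le (hρ : 0 < ρ) (hε : 0 < ε) {x : ℝ} (hx : 0 ≤ x) : rad ε ρ x ≤ 2 * ε := by
  unfold rad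
  rw [div_le_iff₀ (lt_max_of_lt_right hρ)]
  have := le_max_left x ρ
  have : dev ρ x ≤ x := by
    have := dev_abs hρ x
    rw [abs_of_nonneg hx] at this
    exact (le_abs_self _).trans this
  have : dev ρ x ≤ max x ρ := by linarith
  nlinarith

lemma slo_continuous : Continuous (slo ea eb a b Λ) := by
  unfold slo
  refine (gam_continuous a b).comp ?_
  exact Continuous.sub (by fun_prop) ((kap_continuous Λ).comp (Complex.continuous_re.comp (by fun_prop)))

lemma phi_continuous : Continuous fun z : X => phi a b Λ ε ρ (‖inner ℂ ea z‖ ^ 2) (inner ℂ eb z).re := by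
  unfold phi
  have h1 : Continuous fun z : X => (inner ℂ eb z).re := Complex.continuous_re.comp (by fun_prop)
  exact ((slo_continuous (ea := ea) (eb := eb)).mul ((kap'_continuous Λ).comp h1)).add
    (continuous_const.mul ((dev_continuous ρ).comp h1))

lemma outF_continuous : Continuous (outF ea eb a b Λ ε ρ) := by
  unfold outF
  have h1 : Continuous fun z : X => (inner ℂ eb z).re := Complex.continuous_re.comp (by fun_prop)
  have h2 : Continuous fun z : X => (inner ℂ eb z).im := Complex.continuous_im.comp (by fun_prop)
  have hd := dev_continuous ρ
  refine Continuous.add (Continuous.sub (Continuous.add ((gpr_continuous a b).comp ?_) ?_) ?_) ?_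
  · exact Continuous.sub (by fun_prop) ((kap_continuous Λ).comp h1)
  · exact continuous_const.mul ((hd.comp h2).pow 2)
  · exact continuous_const.mul ((hd.comp h1).pow 2)
  · exact continuous_const.mul ((hd.comp (wpt_continuous.norm)).pow 2)

lemma outY_continuous (hρ : 0 < ρ) : Continuous (outY ea eb a b Λ ε ρ) := by
  unfold outY
  have h2 : Continuous fun z : X => (inner ℂ eb z).im := Complex.continuous_im.comp (by fun_prop)
  have hd := dev_continuous ρ
  have hc := Complex.continuous_ofReal
  refine Continuous.add (Continuous.add (Continuous.smul (Continuous.mul ?_ (by fun_prop))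
    continuous_const) (Continuous.smul (Continuous.add ?_ (Continuous.mul ?_ continuous_const))
    continuous_const)) (Continuous.smul ?_ wpt_continuous)
  · exact hc.comp (continuous_const.mul slo_continuous)
  · exact hc.comp phi_continuous.neg
  · exact hc.comp (continuous_const.mul (hd.comp h2))
  · exact hc.comp ((rad_continuous hρ).comp wpt_continuous.norm)

lemma rip_outY (z y : X) : rip (outY ea eb a b Λ ε ρ z) y =
    2 * slo ea eb a b Λ z * ((starRingEnd ℂ) (inner ℂ ea z) * inner ℂ ea y).re
    - phi a b Λ ε ρ (‖inner ℂ ea z‖ ^ 2) (inner ℂ eb z).re * (inner ℂ eb y).re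
    + 2 * ε * dev ρ (inner ℂ eb z).im * (inner ℂ eb y).im
    + rad ε ρ ‖wpt ea eb z‖ * rip (wpt ea eb z) y := by
  unfold outY
  rw [rip_add_left, rip_add_left, Complex.coe_smul, rip_smul_left]
  unfold rip
  simp only [inner_smul_left, map_mul, map_add, Complex.conj_ofReal, Complex.conj_I]
  simp
  ring

lemma rip_outY_self (ha : ‖ea‖ = 1) (hb : ‖eb‖ = 1) (hab : inner ℂ ea eb = 0) (z : X) :
    rip (outY ea eb a b Λ ε ρ z) z =
    2 * slo ea eb a b Λ z * ‖inner ℂ ea z‖ ^ 2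
    - phi a b Λ ε ρ (‖inner ℂ ea z‖ ^ 2) (inner ℂ eb z).re * (inner ℂ eb z).re
    + 2 * ε * dev ρ (inner ℂ eb z).im * (inner ℂ eb z).im
    + rad ε ρ ‖wpt ea eb z‖ * ‖wpt ea eb z‖ ^ 2 := by
  rw [rip_outY, rip_wpt ha hb hab, rip_self]
  congr 4
  rw [mul_comm, Complex.mul_conj, Complex.normSq_eq_norm_sq, Complex.ofReal_re]

lemma outF_semi (ha : ‖ea‖ = 1) (hb : ‖eb‖ = 1) (hab : inner ℂ ea eb = 0) (hab' : a < b)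
    (hΛ : 0 < Λ) (hρ : 0 < ρ) (hε : 0 < ε) (x y : X) :
    outF ea eb a b Λ ε ρ x + rip (outY ea eb a b Λ ε ρ x) y - (3 * Real.pi / 2 * Λ + ε) * ‖y‖ ^ 2 ≤
      outF ea eb a b Λ ε ρ (x + y) := by
  rw [rip_outY, rip_wpt ha hb hab]
  unfold outF slo phi
  rw [wpt_add, inner_add_right, inner_add_right, Complex.add_re, Complex.add_im]
  have hy := norm_decomp ha hb hab y
  set za := (inner ℂ ea x : ℂ)
  set ya := (inner ℂ ea y : ℂ)
  set q := (inner ℂ eb x : ℂ).re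
  set p := (inner ℂ eb x : ℂ).im
  set η := (inner ℂ eb y : ℂ).re
  set ξ := (inner ℂ eb y : ℂ).im
  set w := wpt ea eb x
  set v := wpt ea eb y
  have h1 : ‖za + ya‖ ^ 2 = ‖za‖ ^ 2 + 2 * ((starRingEnd ℂ) za * ya).re + ‖ya‖ ^ 2 := by
    rw [Complex.sq_norm, Complex.sq_norm, Complex.sq_norm, Complex.normSq_apply, Complex.normSq_apply,
      Complex.normSq_apply]
    simp
    ring
  have h2 := gpr_convex hab' (‖za‖ ^ 2 - kap Λ q) (‖za + ya‖ ^ 2 - kap Λ (q + η))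
  have h3 := kap_concave hΛ q η
  have h4 := gam_nonneg a b (‖za‖ ^ 2 - kap Λ q)
  have h5 := gam_le a b (‖za‖ ^ 2 - kap Λ q)
  set γ := gam a b (‖za‖ ^ 2 - kap Λ q)
  have h6 := dev_convex hρ p ξ
  have h7 := dev_concave hρ q η
  have h8 : ε * dev ρ ‖w‖ ^ 2 + rad ε ρ ‖w‖ * rip w v ≤ ε * dev ρ ‖w + v‖ ^ 2 := by
    have g1 := dev_convex hρ ‖w‖ (‖w + v‖ - ‖w‖)
    rw [add_sub_cancel] at g1
    have g2 : rip w v ≤ ‖w‖ * (‖w + v‖ - ‖w‖) := by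
      have := rip_le w (w + v)
      rw [rip_add_right, rip_self] at this
      have := le_abs_self (‖w‖ ^ 2 + rip w v)
      nlinarith
    have g3 := mul_le_mul_of_nonneg_left g2 (rad_nonneg hρ hε (norm_nonneg w))
    rw [← mul_assoc, rad_mul hρ (norm_nonneg w)] at g3
    nlinarith
  have h9 : γ * (2 * ((starRingEnd ℂ) za * ya).re - kap' Λ q * η - Λ * η ^ 2) ≤
      γ * (‖za + ya‖ ^ 2 - kap Λ (q + η) - (‖za‖ ^ 2 - kap Λ q)) :=
    mul_le_mul_of_nonneg_left (by rw [h1]; nlinarith [sq_nonneg ‖ya‖]) h4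
  have h10 : γ * (Λ * η ^ 2) ≤ 3 * Real.pi / 2 * (Λ * η ^ 2) :=
    mul_le_mul_of_nonneg_right h5 (by positivity)
  have h11 := mul_le_mul_of_nonneg_left h6 hε.le
  have h12 := mul_le_mul_of_nonneg_left h7 hε.le
  have h13 : (3 * Real.pi / 2 * Λ + ε) * η ^ 2 ≤ (3 * Real.pi / 2 * Λ + ε) * ‖y‖ ^ 2 := by
    have := Real.pi_pos
    refine mul_le_mul_of_nonneg_left ?_ (by positivity)
    rw [hy]
    nlinarith [sq_nonneg ‖ya‖, sq_nonneg ξ, sq_nonneg ‖v‖]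
  linarith

lemma outF_nonneg_plane (ha : 0 ≤ a) (hab : a < b) (hε : 0 < ε) (hρ : 0 < ρ) (z : X)
    (hz : (inner ℂ eb z).re = 0) : 0 ≤ outF ea eb a b Λ ε ρ z := by
  unfold outF
  have h1 := gpr_nonneg ha hab (‖inner ℂ ea z‖ ^ 2 - kap Λ (inner ℂ eb z).re)
  rw [hz] at *
  rw [dev_zero hρ (x := 0) (by simpa using hρ.le)]
  have : 0 ≤ ε * dev ρ (inner ℂ eb z).im ^ 2 := by positivity
  have : 0 ≤ ε * dev ρ ‖wpt ea eb z‖ ^ 2 := by positivity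
  linarith

lemma outF_lower_plane (hae : ‖ea‖ = 1) (hbe : ‖eb‖ = 1) (habe : inner ℂ ea eb = 0)
    (ha : 0 ≤ a) (hab : a < b) (hε : 0 < ε) (hε1 : 2 * ε ≤ 1) (hρ : 0 < ρ) (z : X)
    (hz : (inner ℂ eb z).re = 0) :
    Real.pi * ‖inner ℂ ea z‖ ^ 2 + ε / 2 * ‖z‖ ^ 2 - (3 * Real.pi / 2 * b + 2 * ε * ρ ^ 2) ≤
      outF ea eb a b Λ ε ρ z := by
  rw [norm_decomp hae hbe habe]
  unfold outF
  have h1 := gpr_lower ha hab (‖inner ℂ ea z‖ ^ 2 - kap Λ (inner ℂ eb z).re)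
  rw [hz] at *
  rw [kap_zero] at *
  rw [dev_zero hρ (x := 0) (by simpa using hρ.le)]
  have h2 := mul_le_mul_of_nonneg_left (dev_lower hρ (inner ℂ eb z).im) hε.le
  have h3 := mul_le_mul_of_nonneg_left (dev_lower hρ ‖wpt ea eb z‖) hε.le
  nlinarith [sq_nonneg ‖inner ℂ ea z‖, Real.pi_gt_three]

/-- plane comparison -/
lemma outF_lower_plane' (ha : 0 ≤ a) (hab : a < b) (hε : 0 < ε) (hρ : 0 < ρ) (z : X)
    (hz : (inner ℂ eb z).re = 0) {m : ℝ} (hm : Real.pi * b ≤ m) :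
    Real.pi * ‖inner ℂ ea z‖ ^ 2 ≤ m + outF ea eb a b Λ ε ρ z := by
  have h0 := outF_nonneg_plane (ea := ea) (Λ := Λ) ha hab hε hρ z hz
  rcases le_total (‖inner ℂ ea z‖ ^ 2) b with h | h
  · have := mul_le_mul_of_nonneg_left h Real.pi_pos.le
    linarith
  · unfold outF
    have h1 := gpr_lower ha hab (‖inner ℂ ea z‖ ^ 2 - kap Λ (inner ℂ eb z).re)
    rw [hz] at *
    rw [kap_zero] at *
    rw [dev_zero hρ (x := 0) (by simpa using hρ.le)]
    have : 0 ≤ ε * dev ρ (inner ℂ eb z).im ^ 2 := by positivity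
    have : 0 ≤ ε * dev ρ ‖wpt ea eb z‖ ^ 2 := by positivity
    nlinarith [Real.pi_pos]

lemma outF_quad (hae : ‖ea‖ = 1) (hbe : ‖eb‖ = 1) (habe : inner ℂ ea eb = 0)
    (hab : a < b) (hε : 0 < ε) (hε1 : 2 * ε ≤ 1) (hρ : 0 < ρ) (hΛ : 0 < Λ) (z : X) :
    outF ea eb a b Λ ε ρ z ≤ 3 * Real.pi / 2 * Λ + (3 * Real.pi / 2 + 1) * ‖z‖ ^ 2 := by
  have hn := norm_decomp hae hbe habe z
  unfold outF
  have h1 := gpr_upper hab (‖inner ℂ ea z‖ ^ 2 - kap Λ (inner ℂ eb z).re)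
  have h2 := kap_nonneg hΛ (inner ℂ eb z).re
  have h3 := kap_le hΛ (inner ℂ eb z).re
  have h4 : |‖inner ℂ ea z‖ ^ 2 - kap Λ (inner ℂ eb z).re| ≤ ‖inner ℂ ea z‖ ^ 2 + Λ := by
    rw [abs_le]; constructor <;> nlinarith [sq_nonneg ‖inner ℂ ea z‖]
  have h5 : ∀ x : ℝ, dev ρ x ^ 2 ≤ x ^ 2 := fun x => by
    rw [sq_le_sq]; exact dev_abs hρ x
  have h6 := h5 (inner ℂ eb z).im
  have h7 := h5 ‖wpt ea eb z‖
  have h8 := Real.pi_pos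
  have h9 := mul_le_mul_of_nonneg_left h4 (show 0 ≤ 3 * Real.pi / 2 by positivity)
  have h10 : ‖inner ℂ ea z‖ ^ 2 ≤ ‖z‖ ^ 2 := by nlinarith [sq_nonneg (inner ℂ eb z).re, sq_nonneg (inner ℂ eb z).im, sq_nonneg ‖wpt ea eb z‖]
  have h11 : ε * dev ρ (inner ℂ eb z).im ^ 2 ≤ (inner ℂ eb z).im ^ 2 := by nlinarith [sq_nonneg (inner ℂ eb z).im]
  have h12 : ε * dev ρ ‖wpt ea eb z‖ ^ 2 ≤ ‖wpt ea eb z‖ ^ 2 := by nlinarith [sq_nonneg ‖wpt ea eb z‖]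
  have h13 : 0 ≤ ε * dev ρ (inner ℂ eb z).re ^ 2 := by positivity
  have h14 := mul_le_mul_of_nonneg_left h10 (show 0 ≤ 3 * Real.pi / 2 by positivity)
  nlinarith [sq_nonneg (inner ℂ eb z).re, sq_nonneg ‖inner ℂ ea z‖]

/-- Vanishing on the moving ball. -/
lemma out_zero (hae : ‖ea‖ = 1) (hbe : ‖eb‖ = 1) (habe : inner ℂ ea eb = 0)
    (ha : 0 ≤ a) (hab : a < b) (hρ : 0 < ρ) (z : X) (hz : ‖z‖ ≤ ρ)
    (hk : ‖inner ℂ ea z‖ ^ 2 - kap Λ (inner ℂ eb z).re ≤ a) :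
    outF ea eb a b Λ ε ρ z = 0 ∧ outY ea eb a b Λ ε ρ z = 0 := by
  have hn := norm_decomp hae hbe habe z
  have hz2 : ‖z‖ ^ 2 ≤ ρ ^ 2 := by
    have := norm_nonneg z
    nlinarith
  have h1 : dev ρ (inner ℂ eb z).im = 0 := dev_zero hρ (abs_le_of_sq_le_sq (by
    nlinarith [sq_nonneg (inner ℂ eb z).re, sq_nonneg ‖wpt ea eb z‖, sq_nonneg ‖inner ℂ ea z‖]) hρ.le)
  have h2 : dev ρ (inner ℂ eb z).re = 0 := dev_zero hρ (abs_le_of_sq_le_sq (by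
    nlinarith [sq_nonneg (inner ℂ eb z).im, sq_nonneg ‖wpt ea eb z‖, sq_nonneg ‖inner ℂ ea z‖]) hρ.le)
  have h3 : dev ρ ‖wpt ea eb z‖ = 0 := dev_zero hρ (abs_le_of_sq_le_sq (by
    nlinarith [sq_nonneg (inner ℂ eb z).im, sq_nonneg (inner ℂ eb z).re, sq_nonneg ‖inner ℂ ea z‖]) hρ.le)
  unfold outF outY slo phi rad
  rw [h1, h2, h3, gpr_zero ha hab hk, gam_zero hab hk]
  simp

lemma outY_lin (hae : ‖ea‖ = 1) (hbe : ‖eb‖ = 1) (habe : inner ℂ ea eb = 0)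
    (hab : a < b) (hb0 : 0 < b) (hε : 0 < ε) (hρ : 0 < ρ) (hΛ : 0 < Λ) (z : X) :
    ‖outY ea eb a b Λ ε ρ z - linA ea eb ε z‖ ≤
      3 * Real.pi * (1 + (b + Λ)) + (3 * Real.pi / 2 * (2 * Λ) + 4 * ε * ρ) + 2 * ε * ρ := by
  have e1 : outY ea eb a b Λ ε ρ z - linA ea eb ε z =
      (((2 * slo ea eb a b Λ z - 3 * Real.pi : ℝ) : ℂ) * inner ℂ ea z) • ea +
      (((- (slo ea eb a b Λ z * kap' Λ (inner ℂ eb z).re) + 2 * ε * ((inner ℂ eb z).re - dev ρ (inner ℂ eb z).re) : ℝ) : ℂ) -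
    ((2 * ε * ((inner ℂ eb z).im - dev ρ (inner ℂ eb z).im) : ℝ) : ℂ) * Complex.I) • eb +
    ((rad ε ρ ‖wpt ea eb z‖ - 2 * ε : ℝ) : ℂ) • wpt ea eb z := by
    have hz : z = inner ℂ ea z • ea + inner ℂ eb z • eb + wpt ea eb z := by simp [wpt]
    have hc : (inner ℂ eb z : ℂ) + (starRingEnd ℂ) (inner ℂ eb z) = 2 * ((inner ℂ eb z).re : ℂ) := by
      rw [Complex.add_conj]; push_cast; ring
    have hl : linA ea eb ε z = ((2 * ε : ℝ) : ℂ) • (inner ℂ ea z • ea + inner ℂ eb z • eb + wpt ea eb z)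
      + (((3 * Real.pi - 2 * ε : ℝ) : ℂ) * inner ℂ ea z) • ea
    - (((2 * ε : ℝ) : ℂ) * (2 * ((inner ℂ eb z).re : ℂ))) • eb := by
      rw [← hz]; unfold linA; rw [hc]
    have hq : (inner ℂ eb z : ℂ) = ((inner ℂ eb z).re : ℂ) + ((inner ℂ eb z).im : ℂ) * Complex.I :=
      (Complex.re_add_im _).symm
    rw [hl]
    unfold outY phi slo
    generalize wpt ea eb z = w
    generalize (inner ℂ ea z : ℂ) = za
    generalize hzb : (inner ℂ eb z : ℂ) = zb at *
    generalize zb.re = q at *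
    generalize zb.im = p at *
    rw [hq]
    push_cast
    module
  rw [e1]
  refine (norm_add_le _ _).trans (add_le_add ((norm_add_le _ _).trans (add_le_add ?_ ?_)) ?_)
  · rw [norm_smul, hae, mul_one, norm_mul, Complex.norm_real, Real.norm_eq_abs]
    have g1 := gam_le a b (‖inner ℂ ea z‖ ^ 2 - kap Λ (inner ℂ eb z).re)
    have g2 := gam_nonneg a b (‖inner ℂ ea z‖ ^ 2 - kap Λ (inner ℂ eb z).re)
    have hp := Real.pi_pos
    by_cases hc : b ≤ ‖inner ℂ ea z‖ ^ 2 - kap Λ (inner ℂ eb z).re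
    · unfold slo
      rw [gam_one hab hc, show 2 * (3 * Real.pi / 2) - 3 * Real.pi = 0 by ring]
      rw [abs_zero, zero_mul]; positivity
    · have h1 : |2 * slo ea eb a b Λ z - 3 * Real.pi| ≤ 3 * Real.pi := by
        unfold slo
        rw [abs_le]; constructor <;> linarith
      have h2 : ‖inner ℂ ea z‖ ≤ 1 + (b + Λ) := by
        have := kap_le hΛ (inner ℂ eb z).re
        nlinarith [sq_nonneg (‖inner ℂ ea z‖ - 1), norm_nonneg (inner ℂ ea z)]
      exact mul_le_mul h1 h2 (norm_nonneg _) (by positivity)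
  · rw [norm_smul, hbe, mul_one]
    refine (norm_sub_le _ _).trans ?_
    rw [norm_mul, Complex.norm_I, mul_one, Complex.norm_real, Complex.norm_real, Real.norm_eq_abs,
      Real.norm_eq_abs]
    have g1 := dev_sub hρ (inner ℂ eb z).re
    have g2 := dev_sub hρ (inner ℂ eb z).im
    have g3 : |slo ea eb a b Λ z * kap' Λ (inner ℂ eb z).re| ≤ 3 * Real.pi / 2 * (2 * Λ) := by
      rw [abs_mul, slo, abs_of_nonneg (gam_nonneg _ _ _)]
      exact mul_le_mul (gam_le _ _ _) (kap'_bound hΛ _) (abs_nonneg _) (by have := Real.pi_pos; positivity)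
    have g4 := abs_add_le (- (slo ea eb a b Λ z * kap' Λ (inner ℂ eb z).re)) (2 * ε * ((inner ℂ eb z).re - dev ρ (inner ℂ eb z).re))
    rw [abs_neg, abs_mul (2 * ε), abs_of_pos (show 0 < 2 * ε by positivity)] at g4
    rw [abs_mul (2 * ε), abs_of_pos (show 0 < 2 * ε by positivity)]
    nlinarith
  · rw [norm_smul, Complex.norm_real, Real.norm_eq_abs]
    have g1 := rad_mul (ε := ε) hρ (norm_nonneg (wpt ea eb z))
    have g2 := rad_le hρ hε (norm_nonneg (wpt ea eb z))
    have g3 := dev_sub hρ ‖wpt ea eb z‖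
    rw [abs_of_nonpos (by linarith)]
    have := (le_abs_self _).trans g3
    nlinarith

end
end Camel
end

section
namespace Camel
open Metric MeasureTheory Filter Topology
set_option linter.unusedSectionVars false
set_option linter.unusedSimpArgs false
set_option linter.unusedVariables false

section
variable {X : Type*} [NormedAddCommGroup X] [InnerProductSpace ℂ X]

/-- Rotations preserve the norm. -/
lemma rot_norm (w : ℝ → X) (l : ℝ → ℝ)
    (hw : ∀ s, HasDerivAt w (((l s : ℂ) * Complex.I) • w s) s) (s : ℝ) : ‖w s‖ = ‖w 0‖ := by
  have hd : ∀ s, HasDerivAt (fun s => (inner ℂ (w s) (w s) : ℂ)) 0 s := by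
    intro s
    convert! (hw s).inner ℂ (hw s) using 1
    rw [inner_smul_left, inner_smul_right]
    simp
  have h := is_const_of_deriv_eq_zero (f := fun s => (inner ℂ (w s) (w s) : ℂ))
    (fun s => (hd s).differentiableAt) (fun s => (hd s).deriv) s 0
  simp only [inner_self_eq_norm_sq_to_K] at h
  have h2 : ‖w s‖ ^ 2 = ‖w 0‖ ^ 2 := by
    have := congrArg Complex.re h
    simpa [← Complex.ofReal_pow] using this
  exact (pow_left_inj₀ (norm_nonneg _) (norm_nonneg _) two_ne_zero).1 h2

variable {ea eb : X} {a b Λ ε ρ : ℝ}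

lemma outY_a (ha : ‖ea‖ = 1) (hab : inner ℂ ea eb = 0) (z : X) :
    inner ℂ ea (outY ea eb a b Λ ε ρ z) = ((2 * slo ea eb a b Λ z : ℝ) : ℂ) * inner ℂ ea z := by
  unfold outY
  simp only [inner_add_right, inner_smul_right, inner_one ha, hab, wpt_a ha hab]
  simp

lemma outY_b (hb : ‖eb‖ = 1) (hab : inner ℂ ea eb = 0) (z : X) :
    inner ℂ eb (outY ea eb a b Λ ε ρ z) =
  (((- phi a b Λ ε ρ (‖inner ℂ ea z‖ ^ 2) (inner ℂ eb z).re : ℝ) : ℂ) +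
    ((2 * ε * dev ρ (inner ℂ eb z).im : ℝ) : ℂ) * Complex.I) := by
  unfold outY
  simp only [inner_add_right, inner_smul_right, inner_one hb, inner_swap hab, wpt_b hb hab]
  simp

lemma outY_w (ha : ‖ea‖ = 1) (hb : ‖eb‖ = 1) (hab : inner ℂ ea eb = 0) (z : X) :
    wpt ea eb (outY ea eb a b Λ ε ρ z) = ((rad ε ρ ‖wpt ea eb z‖ : ℝ) : ℂ) • wpt ea eb z := by
  have h : wpt ea eb (outY ea eb a b Λ ε ρ z) = outY ea eb a b Λ ε ρ z -
    (inner ℂ ea (outY ea eb a b Λ ε ρ z)) • ea - (inner ℂ eb (outY ea eb a b Λ ε ρ z)) • eb := rfl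
  rw [h, outY_a ha hab, outY_b hb hab]
  unfold outY
  abel

lemma phi_lip (hab : a < b) (hΛ : 0 < Λ) (hρ : 0 < ρ) (hε : 0 < ε) (u q q' : ℝ) :
    |phi a b Λ ε ρ u q - phi a b Λ ε ρ u q'| ≤
      (3 * Real.pi / 2 / (b - a) * (2 * Λ) * (2 * Λ) + 3 * Real.pi / 2 * (6 * Λ) + 2 * ε) * |q - q'| := by
  unfold phi
  have h0 : 0 < b - a := by linarith
  have hp := Real.pi_pos
  have e : gam a b (u - kap Λ q) * kap' Λ q + 2 * ε * dev ρ q -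
      (gam a b (u - kap Λ q') * kap' Λ q' + 2 * ε * dev ρ q') =
      (gam a b (u - kap Λ q) - gam a b (u - kap Λ q')) * kap' Λ q +
      gam a b (u - kap Λ q') * (kap' Λ q - kap' Λ q') + 2 * ε * (dev ρ q - dev ρ q') := by ring
  rw [e]
  have h1 : |(gam a b (u - kap Λ q) - gam a b (u - kap Λ q')) * kap' Λ q| ≤
      3 * Real.pi / 2 / (b - a) * (2 * Λ) * (2 * Λ) * |q - q'| := by
    rw [abs_mul]
    have g1 := gam_lip hab (u - kap Λ q) (u - kap Λ q')
    have g2 : |u - kap Λ q - (u - kap Λ q')| ≤ 2 * Λ * |q - q'| := by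
      rw [show u - kap Λ q - (u - kap Λ q') = -(kap Λ q - kap Λ q') by ring, abs_neg]
      exact kap_lip hΛ q q'
    have g3 : |gam a b (u - kap Λ q) - gam a b (u - kap Λ q')| ≤
        3 * Real.pi / 2 / (b - a) * (2 * Λ * |q - q'|) :=
      g1.trans (mul_le_mul_of_nonneg_left g2 (by positivity))
    calc _ ≤ 3 * Real.pi / 2 / (b - a) * (2 * Λ * |q - q'|) * (2 * Λ) :=
          mul_le_mul g3 (kap'_bound hΛ q) (abs_nonneg _) (by positivity)
      _ = _ := by ring
  have h2 : |gam a b (u - kap Λ q') * (kap' Λ q - kap' Λ q')| ≤ 3 * Real.pi / 2 * (6 * Λ) * |q - q'| := by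
    rw [abs_mul, abs_of_nonneg (gam_nonneg _ _ _), mul_assoc]
    exact mul_le_mul (gam_le _ _ _) (kap'_lip hΛ q q') (abs_nonneg _) (by positivity)
  have h3 : |2 * ε * (dev ρ q - dev ρ q')| ≤ 2 * ε * |q - q'| := by
    rw [abs_mul, abs_of_pos (by positivity)]
    exact mul_le_mul_of_nonneg_left (dev_lip hρ q q') (by positivity)
  have h4 := abs_add_le ((gam a b (u - kap Λ q) - gam a b (u - kap Λ q')) * kap' Λ q +
      gam a b (u - kap Λ q') * (kap' Λ q - kap' Λ q')) (2 * ε * (dev ρ q - dev ρ q'))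
  have h5 := abs_add_le ((gam a b (u - kap Λ q) - gam a b (u - kap Λ q')) * kap' Λ q)
      (gam a b (u - kap Λ q') * (kap' Λ q - kap' Λ q'))
  linarith

set_option maxHeartbeats 1000000 in
/-- Periodic orbits of the outer Hamiltonian have action at most `m`. -/
theorem outer_orbit (ha : ‖ea‖ = 1) (hb : ‖eb‖ = 1) (hab : inner ℂ ea eb = 0) (ha0 : 0 ≤ a)
    (hab' : a < b) (hΛ : 0 < Λ) (hρ : 0 < ρ) (hε : 0 < ε) (hε1 : 2 * ε ≤ 1)
    (hsm : (2 * ε) * (3 * Real.pi / 2 / (b - a) * (2 * Λ) * (2 * Λ) + 3 * Real.pi / 2 * (6 * Λ) + 2 * ε) < 1)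
    {m : ℝ} (hm : Real.pi * b ≤ m) (x : ℝ → X)
    (hx : ∀ s, HasDerivAt x (Complex.I • outY ea eb a b Λ ε ρ (x s)) s)
    (hx1 : ∀ s, x (s + 1) = x s) (s : ℝ) :
    rip (outY ea eb a b Λ ε ρ (x s)) (x s) / 2 - outF ea eb a b Λ ε ρ (x s) ≤ m := by
  have hp := Real.pi_pos
  have h0 : 0 < b - a := by linarith
  have hza : ∀ s, HasDerivAt (fun s => (inner ℂ ea (x s) : ℂ))
      ((((2 * slo ea eb a b Λ (x s) : ℝ) : ℂ) * Complex.I) • inner ℂ ea (x s)) s := by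
    intro s
    convert! (hasDerivAt_const s ea).inner ℂ (hx s) using 1
    rw [inner_smul_right, outY_a ha hab, inner_zero_left, smul_eq_mul]
    ring
  have hzb : ∀ s, HasDerivAt (fun s => (inner ℂ eb (x s) : ℂ))
      (Complex.I * (((- phi a b Λ ε ρ (‖inner ℂ ea (x s)‖ ^ 2) (inner ℂ eb (x s)).re : ℝ) : ℂ) +
    ((2 * ε * dev ρ (inner ℂ eb (x s)).im : ℝ) : ℂ) * Complex.I)) s := by
    intro s
    convert! (hasDerivAt_const s eb).inner ℂ (hx s) using 1
    rw [inner_smul_right, outY_b hb hab, inner_zero_left, add_zero]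
  have hw : ∀ s, HasDerivAt (fun s => wpt ea eb (x s))
      (((rad ε ρ ‖wpt ea eb (x s)‖ : ℝ) * Complex.I : ℂ) • wpt ea eb (x s)) s := by
    intro s
    have h1 := ((hx s).sub (((hasDerivAt_const s ea).inner ℂ (hx s)).smul_const ea)).sub
      (((hasDerivAt_const s eb).inner ℂ (hx s)).smul_const eb)
    convert! h1 using 1
    have h2 := outY_w (a := a) (b := b) (Λ := Λ) (ε := ε) (ρ := ρ) ha hb hab (x s)
    rw [mul_comm, mul_smul, ← h2]
    simp only [inner_zero_left, add_zero, inner_smul_right, wpt]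
    module
  have hu := rot_norm (fun s => (inner ℂ ea (x s) : ℂ)) _ hza
  have hwn := rot_norm (fun s => wpt ea eb (x s)) _ hw
  have hq : ∀ s, HasDerivAt (fun s => (inner ℂ eb (x s)).re) (-(2 * ε * dev ρ (inner ℂ eb (x s)).im)) s := by
    intro s
    have h1 := Complex.reCLM.hasFDerivAt.comp_hasDerivAt s (hzb s)
    convert! h1 using 1
    simp
  have hpp : ∀ s, HasDerivAt (fun s => (inner ℂ eb (x s)).im)
      (-(phi a b Λ ε ρ (‖inner ℂ ea (x 0)‖ ^ 2) (inner ℂ eb (x s)).re)) s := by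
    intro s
    have h1 := Complex.imCLM.hasFDerivAt.comp_hasDerivAt s (hzb s)
    convert! h1 using 1
    have := hu s
    simp [this]
  set u := ‖inner ℂ ea (x 0)‖ ^ 2 with hudef
  have hosc := osc (fun s => (inner ℂ eb (x s)).re) (fun s => (inner ℂ eb (x s)).im)
    (fun p => -(2 * ε * dev ρ p)) (fun q => -(phi a b Λ ε ρ u q)) (2 * ε)
    (3 * Real.pi / 2 / (b - a) * (2 * Λ) * (2 * Λ) + 3 * Real.pi / 2 * (6 * Λ) + 2 * ε)
    (by positivity) (by positivity) hsm
    (fun x y => by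
      rw [show -(2 * ε * dev ρ x) - -(2 * ε * dev ρ y) = -((2 * ε) * (dev ρ x - dev ρ y)) by ring,
        abs_neg, abs_mul, abs_of_pos (show 0 < 2 * ε by positivity)]
      exact mul_le_mul_of_nonneg_left (dev_lip hρ x y) (by positivity))
    (fun x y => by
      rw [← neg_sub', abs_neg]
      exact phi_lip hab' hΛ hρ hε u x y)
    hq hpp (fun s => by simp only [hx1]) (fun s => by simp only [hx1])
  have hus : ∀ s, ‖inner ℂ ea (x s)‖ ^ 2 = u := fun s => by
    have := hu s
    rw [this]
  obtain ⟨k1, k2, k3, k4⟩ := hosc s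
  have hslo : ∀ s, slo ea eb a b Λ (x s) = slo ea eb a b Λ (x 0) := fun s => by
    unfold slo
    rw [hus, (hosc s).2.2.1]
  -- dev vanish
  have d1 : dev ρ (inner ℂ eb (x s)).im = 0 := by
    have : 2 * ε * dev ρ (inner ℂ eb (x s)).im = 0 := by linarith
    simpa [hε.ne'] using this
  have d2 : phi a b Λ ε ρ u (inner ℂ eb (x s)).re = 0 := by linarith
  set q := (inner ℂ eb (x s)).re with hqdef
  set γ := slo ea eb a b Λ (x s) with hγ
  have hγ' : γ = gam a b (u - kap Λ q) := by rw [hγ, slo, hus]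
  have d3 : γ * (kap' Λ q * q) + 2 * ε * (dev ρ q * q) = 0 := by
    have : phi a b Λ ε ρ u q * q = 0 := by rw [d2, zero_mul]
    rw [phi, ← hγ'] at this
    linarith
  have g0 : 0 ≤ γ := by rw [hγ']; exact gam_nonneg _ _ _
  have g1 : γ ≤ 3 * Real.pi / 2 := by rw [hγ']; exact gam_le _ _ _
  have d4 : 0 ≤ γ * (kap' Λ q * q) := mul_nonneg g0 (kap'_mul hΛ q)
  have d5 : 0 ≤ 2 * ε * (dev ρ q * q) := mul_nonneg (by positivity) (dev_mul hρ q)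
  have d6 : dev ρ q = 0 := by
    have : 2 * ε * (dev ρ q * q) = 0 := by linarith
    have h2 : dev ρ q = 0 ∨ q = 0 := by simpa [hε.ne'] using this
    rcases h2 with h2 | h2
    · exact h2
    · rw [h2]; exact dev_zero hρ (by simpa using hρ.le)
  have d7 : γ * (kap' Λ q * q) = 0 := by linarith
  -- w part
  have hradw : rad ε ρ ‖wpt ea eb (x s)‖ * ‖wpt ea eb (x s)‖ ^ 2 = 0 := by
    rw [hwn s]
    rcases rotation (fun s => wpt ea eb (x s)) (rad ε ρ ‖wpt ea eb (x 0)‖)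
      (fun s => by have := hw s; rw [hwn s] at this; exact this)
      (by have := hx1 0; rw [zero_add] at this; simp only [this]) with h | ⟨n, hn⟩
    · rw [h]; simp
    · have r1 := rad_le hρ hε (norm_nonneg (wpt ea eb (x 0)))
      have r2 := rad_nonneg hρ hε (norm_nonneg (wpt ea eb (x 0)))
      have hn0 : n = 0 := by
        have n1 : (n:ℝ) < 1 := by
          by_contra hc
          push Not at hc
          nlinarith [Real.pi_gt_three]
        have n2 : (-1:ℝ) < n := by
          by_contra hc
          push Not at hc
          nlinarith [Real.pi_gt_three]
        have n1' : n < 1 := by exact_mod_cast n1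
        have n2' : -1 < n := by exact_mod_cast n2
        omega
      rw [hn, hn0]; simp
  have hval : rip (outY ea eb a b Λ ε ρ (x s)) (x s) / 2 - outF ea eb a b Λ ε ρ (x s) ≤
      γ * u - gpr a b (u - kap Λ q) := by
    rw [rip_outY_self ha hb hab, hradw, hus s, d2, d1, outF, hus s, d1, d6]
    have : 0 ≤ ε * dev ρ ‖wpt ea eb (x s)‖ ^ 2 := by positivity
    linarith
  refine hval.trans ?_
  have hgp := gpr_nonneg ha0 hab' (u - kap Λ q)
  have hm0 : 0 ≤ m := by nlinarith
  have hu0 : 0 ≤ u := by positivity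
  rcases rotation (fun s => (inner ℂ ea (x s) : ℂ)) (2 * slo ea eb a b Λ (x 0))
      (fun s => by have := hza s; rw [hslo s] at this; exact this)
      (by have := hx1 0; rw [zero_add] at this; simp only [this]) with h | ⟨n, hn⟩
  · have : u = 0 := by rw [hudef, h]; simp
    rw [this] at hgp ⊢
    linarith
  · rw [← hslo s, ← hγ] at hn
    have n1 : (n:ℝ) < 2 := by
      by_contra hc
      push Not at hc
      nlinarith
    have n2 : (-1:ℝ) < n := by
      by_contra hc
      push Not at hc
      nlinarith
    have n1' : n < 2 := by exact_mod_cast n1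
    have n2' : -1 < n := by exact_mod_cast n2
    obtain hn0 | hn0 : n = 0 ∨ n = 1 := by omega
    · have : γ = 0 := by rw [hn0] at hn; simpa using hn
      rw [this]; linarith
    · have hγp : γ = Real.pi := by rw [hn0] at hn; push_cast at hn; linarith
      have hq0 : q = 0 := by
        have h2 : kap' Λ q = 0 ∨ q = 0 := by simpa [hγp, hp.ne'] using d7
        rcases h2 with h2 | h2
        · exact kap'_eq_zero hΛ h2
        · exact h2
      have hub : u < b := by
        by_contra hc
        push Not at hc
        rw [hq0, kap_zero, sub_zero, gam_one hab' hc] at hγ'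
        linarith
      rw [hγp]
      nlinarith

end
end Camel
end

section
namespace Camel
open Metric MeasureTheory Filter Topology
open scoped ContDiff
set_option linter.unusedSectionVars false
set_option linter.unusedSimpArgs false
set_option linter.unusedVariables false

/-- Profile of the inner Hamiltonian. -/
structure Prof (f h : ℝ → ℝ) (v1 v2 m : ℝ) : Prop where
  hv1 : 0 < v1
  smooth : ContDiff ℝ ∞ h
  der : ∀ v, HasDerivAt f (h v) v
  nonneg : ∀ v, 0 ≤ h v
  lt : ∀ v, h v < Real.pi
  z1 : ∀ v, v ≤ v1 → h v = 0
  z2 : ∀ v, v2 ≤ v → h v = 0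
  f1 : ∀ v, v ≤ v1 → f v = 0
  f2 : ∀ v, v2 ≤ v → f v = m
  f0 : ∀ v, 0 ≤ f v
  fm : ∀ v, f v ≤ m

lemma exists_prof (c v2 : ℝ) (hc : 0 < c) (hcv : c < v2) :
    ∃ f h v1 m, Prof f h v1 v2 m ∧ Real.pi * c ≤ m := by
  have hp := Real.pi_pos
  set η := (v2 - c) / 6 with hη
  have hη0 : 0 < η := by rw [hη]; linarith
  set μ := Real.pi * c / ((v2 + c) / 2) with hμ
  have hμ0 : 0 < μ := by rw [hμ]; have : 0 < v2 := by linarith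
                         positivity
  have hμ1 : μ < Real.pi := by
    rw [hμ, div_lt_iff₀ (by linarith)]
    nlinarith
  let h : ℝ → ℝ := fun v => μ * Real.smoothTransition ((v - η) / η) * Real.smoothTransition ((v2 - v) / η)
  have hsm : ContDiff ℝ ∞ h := by
    have h1 : ContDiff ℝ ∞ fun v : ℝ => (v - η) / η := by fun_prop
    have h2 : ContDiff ℝ ∞ fun v : ℝ => (v2 - v) / η := by fun_prop
    exact (contDiff_const.mul (Real.smoothTransition.contDiff.comp h1)).mul
      (Real.smoothTransition.contDiff.comp h2)
  have hcont : Continuous h := hsm.continuous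
  have hnn : ∀ v, 0 ≤ h v := fun v => mul_nonneg (mul_nonneg hμ0.le (Real.smoothTransition.nonneg _))
    (Real.smoothTransition.nonneg _)
  have hle : ∀ v, h v ≤ μ := fun v => by
    have a1 := Real.smoothTransition.le_one ((v - η) / η)
    have a2 := Real.smoothTransition.le_one ((v2 - v) / η)
    have a3 := Real.smoothTransition.nonneg ((v - η) / η)
    have a4 := Real.smoothTransition.nonneg ((v2 - v) / η)
    have : Real.smoothTransition ((v - η) / η) * Real.smoothTransition ((v2 - v) / η) ≤ 1 := by nlinarith
    simp only [h]
    rw [mul_assoc]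
    nlinarith
  have hz1 : ∀ v, v ≤ η → h v = 0 := fun v hv => by
    simp only [h]
    rw [Real.smoothTransition.zero_of_nonpos (div_nonpos_of_nonpos_of_nonneg (by linarith) hη0.le)]
    simp
  have hz2 : ∀ v, v2 ≤ v → h v = 0 := fun v hv => by
    simp only [h]
    rw [Real.smoothTransition.zero_of_nonpos (x := (v2 - v) / η) (div_nonpos_of_nonpos_of_nonneg (by linarith) hη0.le)]
    simp
  have hI : ∀ x y : ℝ, IntervalIntegrable h volume x y := fun x y => hcont.intervalIntegrable _ _
  let f : ℝ → ℝ := fun v => ∫ x in (0:ℝ)..v, h x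
  have hder : ∀ v, HasDerivAt f (h v) v := fun v =>
    intervalIntegral.integral_hasDerivAt_right (hI _ _)
      (hcont.stronglyMeasurableAtFilter _ _) hcont.continuousAt
  have hmono : Monotone f := monotone_of_hasDerivAt_nonneg hder hnn
  have f0 : f 0 = 0 := by simp [f]
  have hf1 : ∀ v, v ≤ η → f v = 0 := by
    intro v hv
    simp only [f]
    rw [intervalIntegral.integral_congr (g := fun _ => (0:ℝ))]
    · simp
    · intro x hx
      refine hz1 x (hx.2.trans ?_)
      exact max_le hη0.le hv
  have hf2 : ∀ v, v2 ≤ v → f v = f v2 := by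
    intro v hv
    have h1 : f v - f v2 = ∫ x in v2..v, h x :=
      intervalIntegral.integral_interval_sub_left (hI _ _) (hI _ _)
    rw [intervalIntegral.integral_congr (g := fun _ => (0:ℝ))] at h1
    · simp at h1; linarith
    · intro x hx
      rw [uIcc_of_le hv] at hx
      exact hz2 x hx.1
  refine ⟨f, h, η, f v2, ⟨hη0, hsm, hder, hnn, fun v => (hle v).trans_lt hμ1, hz1, hz2, hf1, hf2,
    fun v => ?_, fun v => ?_⟩, ?_⟩
  · rcases le_total v η with hv | hv
    · rw [hf1 v hv]
    · rw [← hf1 η le_rfl]; exact hmono hv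
  · rcases le_total v v2 with hv | hv
    · exact hmono hv
    · rw [hf2 v hv]
  · have k1 : 2 * η ≤ v2 - η := by rw [hη]; linarith
    have k2 : f (v2 - η) - f (2 * η) = ∫ x in (2 * η)..(v2 - η), h x :=
      intervalIntegral.integral_interval_sub_left (hI _ _) (hI _ _)
    rw [intervalIntegral.integral_congr (g := fun _ => μ)] at k2
    · rw [intervalIntegral.integral_const, smul_eq_mul] at k2
      have k3 : f (v2 - η) ≤ f v2 := hmono (by linarith)
      have k4 : 0 ≤ f (2 * η) := by rw [← f0]; exact hmono (by linarith)
      have k5 : (v2 - η - 2 * η) * μ = Real.pi * c := by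
        rw [hη, hμ]
        have : v2 + c ≠ 0 := by linarith
        field_simp
        ring
      linarith
    · intro x hx
      rw [uIcc_of_le k1] at hx
      simp only [h]
      rw [Real.smoothTransition.one_of_one_le, Real.smoothTransition.one_of_one_le]
      · ring
      · rw [one_le_div hη0]; linarith [hx.2]
      · rw [one_le_div hη0]; linarith [hx.1]

section
variable {X : Type*} [NormedAddCommGroup X] [InnerProductSpace ℂ X]

/-- A smooth family of symplectomorphisms. -/
structure Fam (Ψ g : ℝ → X → X) : Prop where
  sm : ContDiff ℝ ∞ (fun p : ℝ × X => Ψ p.1 p.2)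
  smg : ContDiff ℝ ∞ (fun p : ℝ × X => g p.1 p.2)
  left : ∀ t x, g t (Ψ t x) = x
  right : ∀ t x, Ψ t (g t x) = x
  symp : ∀ t x v w, rip (Complex.I • fderiv ℝ (Ψ t) x v) (fderiv ℝ (Ψ t) x w) = rip (Complex.I • v) w

/-- inner Hamiltonian -/
def inK (f : ℝ → ℝ) (g : ℝ → X → X) (b : X) (t : ℝ) (z : X) : ℝ := f (‖g t z - b‖ ^ 2)

/-- gradient of the round Hamiltonian -/
def rnd (h : ℝ → ℝ) (b y : X) : X := (2 * h (‖y - b‖ ^ 2)) • (y - b)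

/-- inner gradient -/
def inY (h : ℝ → ℝ) (Ψ g : ℝ → X → X) (b : X) (t : ℝ) (z : X) : X :=
  -(Complex.I • fderiv ℝ (Ψ t) (g t z) (Complex.I • rnd h b (g t z)))

variable {Ψ g : ℝ → X → X} {f h : ℝ → ℝ} {v1 v2 m : ℝ} {b : X}

lemma contDiff_I_smul {E : Type*} [NormedAddCommGroup E] [NormedSpace ℝ E] {n : WithTop ℕ∞} {u : E → X}
    (hu : ContDiff ℝ n u) :
    ContDiff ℝ n fun x => Complex.I • u x := hu.const_smul Complex.I

lemma contDiff_norm_sq' {E : Type*} [NormedAddCommGroup E] [NormedSpace ℝ E] {n : WithTop ℕ∞} {u : E → X}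
    (hu : ContDiff ℝ n u) :
    ContDiff ℝ n fun x => ‖u x‖ ^ 2 := hu.norm_sq ℂ

lemma Fam.sm_t (F : Fam Ψ g) (t : ℝ) : ContDiff ℝ ∞ (Ψ t) :=
  F.sm.comp (contDiff_const.prodMk contDiff_id)

lemma Fam.smg_t (F : Fam Ψ g) (t : ℝ) : ContDiff ℝ ∞ (g t) :=
  F.smg.comp (contDiff_const.prodMk contDiff_id)

lemma rnd_contDiff (P : Prof f h v1 v2 m) : ContDiff ℝ ∞ (rnd h b) := by
  unfold rnd
  have h1 : ContDiff ℝ ∞ fun y : X => y - b := contDiff_id.sub contDiff_const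
  exact (contDiff_const.mul (P.smooth.comp (contDiff_norm_sq' h1))).smul h1

lemma inY_contDiff (F : Fam Ψ g) (P : Prof f h v1 v2 m) :
    ContDiff ℝ ∞ fun p : ℝ × X => inY h Ψ g b p.1 p.2 := by
  unfold inY
  have h1 : ContDiff ℝ ∞ fun p : ℝ × X => fderiv ℝ (Ψ p.1) (g p.1 p.2) := by
    refine ContDiff.fderiv (f := fun (p : ℝ × X) (x : X) => Ψ p.1 x) (m := ∞) (n := ∞)
      ?_ F.smg (by simp)
    exact F.sm.comp ((contDiff_fst.comp contDiff_fst).prodMk contDiff_snd)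
  exact (contDiff_I_smul (h1.clm_apply (contDiff_I_smul ((rnd_contDiff P).comp F.smg)))).neg

lemma inK_continuous (F : Fam Ψ g) (P : Prof f h v1 v2 m) :
    Continuous fun p : ℝ × X => inK f g b p.1 p.2 := by
  unfold inK
  have : Continuous f := continuous_iff_continuousAt.2 fun v => (P.der v).continuousAt
  have := F.smg.continuous
  fun_prop

lemma inY_zero {t : ℝ} {z : X} (hz : rnd h b (g t z) = 0) : inY h Ψ g b t z = 0 := by
  unfold inY; rw [hz]; simp

lemma rnd_zero (P : Prof f h v1 v2 m) {y : X} (hy : v2 ≤ ‖y - b‖ ^ 2) : rnd h b y = 0 := by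
  unfold rnd; rw [P.z2 _ hy]; simp

lemma rip_inY (F : Fam Ψ g) (t : ℝ) (z w : X) :
    rip (inY h Ψ g b t z) w = rip (rnd h b (g t z)) (fderiv ℝ (g t) z w) := by
  have h1 : fderiv ℝ (Ψ t) (g t z) (fderiv ℝ (g t) z w) = w := by
    have h2 : HasFDerivAt (fun z => Ψ t (g t z)) ((fderiv ℝ (Ψ t) (g t z)).comp (fderiv ℝ (g t) z)) z :=
      ((F.sm_t t).differentiable (by simp) _).hasFDerivAt.comp z
        ((F.smg_t t).differentiable (by simp) _).hasFDerivAt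
    have h3 : HasFDerivAt (fun z => Ψ t (g t z)) (ContinuousLinearMap.id ℝ X) z := by
      have : (fun z => Ψ t (g t z)) = id := funext fun z => F.right t z
      rw [this]; exact hasFDerivAt_id z
    have h4 := h2.unique h3
    exact congrArg (fun L : X →L[ℝ] X => L w) h4
  have h5 := F.symp t (g t z) (Complex.I • rnd h b (g t z)) (fderiv ℝ (g t) z w)
  rw [h1, smul_smul, Complex.I_mul_I, neg_one_smul, rip_neg_left] at h5
  unfold inY
  rw [rip_neg_left, h5, neg_neg]

lemma hasFDerivAt_symp_inj (F : Fam Ψ g) (t : ℝ) (y v : X) (hv : fderiv ℝ (Ψ t) y v = 0) : v = 0 := by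
  have h1 := F.symp t y v (Complex.I • v)
  rw [hv, smul_zero, rip_zero_left, rip_I_I, rip_self] at h1
  have : ‖v‖ = 0 := by simpa using h1.symm
  simpa using this

/-- derivative of the inner Hamiltonian along lines -/
lemma inK_deriv (F : Fam Ψ g) (P : Prof f h v1 v2 m) (t : ℝ) (z w : X) (s : ℝ) :
    HasDerivAt (fun s : ℝ => inK f g b t (z + s • w)) (rip (inY h Ψ g b t (z + s • w)) w) s := by
  rw [rip_inY F]
  unfold inK rnd
  have h1 : HasDerivAt (fun s : ℝ => z + s • w) w s := by
    simpa using ((hasDerivAt_id s).smul_const w).const_add z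
  have h2 : HasDerivAt (fun s : ℝ => g t (z + s • w)) (fderiv ℝ (g t) (z + s • w) w) s :=
    ((F.smg_t t).differentiable (by simp) _).hasFDerivAt.comp_hasDerivAt s h1
  have h3 := h2.sub_const b
  have h4 : HasDerivAt (fun s : ℝ => ‖g t (z + s • w) - b‖ ^ 2)
      (2 * rip (g t (z + s • w) - b) (fderiv ℝ (g t) (z + s • w) w)) s := by
    have h5 := Complex.reCLM.hasFDerivAt.comp_hasDerivAt s (h3.inner ℂ h3)
    convert! h5 using 1
    · ext s'
      simp only [Function.comp, Complex.reCLM_apply]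
      exact (rip_self _).symm
    · rw [Complex.reCLM_apply, Complex.add_re]
      have := rip_comm (g t (z + s • w) - b) (fderiv ℝ (g t) (z + s • w) w)
      unfold rip at *
      linarith
  have h6 := (P.der (‖g t (z + s • w) - b‖ ^ 2)).comp s h4
  convert! h6 using 1
  rw [rip_smul_left]; ring

/-- compactness bounds -/
lemma inY_bounds [FiniteDimensional ℝ X] (F : Fam Ψ g) (P : Prof f h v1 v2 m) {ρ0 : ℝ} (hρ0 : 0 ≤ ρ0)
    (hv2 : v2 = ρ0 ^ 2) :
    ∃ L : ℝ, 0 ≤ L ∧ ∀ t ∈ Icc (0:ℝ) 1, ∀ z, ‖inY h Ψ g b t z‖ ≤ L ∧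
      ∀ z', ‖inY h Ψ g b t z - inY h Ψ g b t z'‖ ≤ L * ‖z - z'‖ := by
  have hpr : ProperSpace X := FiniteDimensional.proper ℝ X
  have hY := inY_contDiff (b := b) F P
  have hD : Continuous fun p : ℝ × X => fderiv ℝ (inY h Ψ g b p.1) p.2 := by
    refine (ContDiff.fderiv (f := fun (p : ℝ × X) (x : X) => inY h Ψ g b p.1 x) (m := ∞) (n := 0)
      ?_ contDiff_snd (by simp)).continuous
    exact hY.comp ((contDiff_fst.comp contDiff_fst).prodMk contDiff_snd)
  have hK : IsCompact (Icc (0:ℝ) 1 ×ˢ closedBall b ρ0) := isCompact_Icc.prod (isCompact_closedBall b ρ0)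
  have hsub : Continuous fun p : ℝ × X => (p.1, Ψ p.1 p.2) := continuous_fst.prodMk F.sm.continuous
  obtain ⟨L1, hL1⟩ := hK.exists_bound_of_continuousOn (hY.continuous.comp hsub).continuousOn
  obtain ⟨L2, hL2⟩ := hK.exists_bound_of_continuousOn (hD.comp hsub).continuousOn
  have e1 : ∀ t z, ρ0 ≤ ‖g t z - b‖ → inY h Ψ g b t z = 0 := fun t z hz =>
    inY_zero (rnd_zero P (by rw [hv2]; exact pow_le_pow_left₀ hρ0 hz 2))
  refine ⟨max 0 (max L1 L2), le_max_left _ _, fun t ht z => ⟨?_, fun z' => ?_⟩⟩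
  · by_cases hz : ρ0 ≤ ‖g t z - b‖
    · rw [e1 t z hz, norm_zero]; exact le_max_left _ _
    · push Not at hz
      have := hL1 (t, g t z) ⟨ht, by rw [mem_closedBall, dist_eq_norm]; exact hz.le⟩
      simp only [Function.comp, F.right] at this
      exact this.trans ((le_max_left _ _).trans (le_max_right _ _))
  · have hdt : ContDiff ℝ ∞ (inY h Ψ g b t) := hY.comp (contDiff_const.prodMk contDiff_id)
    refine Convex.norm_image_sub_le_of_norm_fderiv_le (𝕜 := ℝ) (s := univ)
      (fun x _ => hdt.differentiable (by simp) x) (fun x _ => ?_) convex_univ (mem_univ _) (mem_univ _)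
    by_cases hz : ρ0 < ‖g t x - b‖
    · have hev : inY h Ψ g b t =ᶠ[𝓝 x] fun _ => 0 := by
        have hc : Continuous fun x => ‖g t x - b‖ := by
          have := (F.smg_t t).continuous
          fun_prop
        filter_upwards [hc.continuousAt.eventually (lt_mem_nhds hz)] with y hy
        exact e1 t y hy.le
      rw [hev.fderiv_eq]
      simp
    · push Not at hz
      have := hL2 (t, g t x) ⟨ht, by rw [mem_closedBall, dist_eq_norm]; exact hz⟩
      simp only [Function.comp, F.right] at this
      exact this.trans ((le_max_right _ _).trans (le_max_right _ _))

lemma inK_semi (F : Fam Ψ g) (P : Prof f h v1 v2 m) {L : ℝ} (t : ℝ)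
    (hL : ∀ z z', ‖inY h Ψ g b t z - inY h Ψ g b t z'‖ ≤ L * ‖z - z'‖) (hL0 : 0 ≤ L) (x y : X) :
    inK f g b t x + rip (inY h Ψ g b t x) y - L * ‖y‖ ^ 2 ≤ inK f g b t (x + y) := by
  have hd := inK_deriv (b := b) F P t x y
  obtain ⟨s, hs, h1⟩ := exists_hasDerivAt_eq_slope (fun s : ℝ => inK f g b t (x + s • y)) _
    (zero_lt_one) (fun s _ => (hd s).continuousAt.continuousWithinAt) (fun s _ => hd s)
  simp only [one_smul, zero_smul, add_zero, sub_zero, div_one] at h1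
  have h2 := hL (x + s • y) x
  rw [add_sub_cancel_left, norm_smul, Real.norm_eq_abs, abs_of_pos hs.1] at h2
  have h3 := rip_le (inY h Ψ g b t (x + s • y) - inY h Ψ g b t x) y
  rw [rip_sub_left] at h3
  have h4 := (abs_le.1 h3).1
  have h5 : ‖inY h Ψ g b t (x + s • y) - inY h Ψ g b t x‖ * ‖y‖ ≤ L * ‖y‖ ^ 2 := by
    have h6 : L * (s * ‖y‖) ≤ L * ‖y‖ :=
      mul_le_mul_of_nonneg_left (by nlinarith [norm_nonneg y, hs.2]) hL0
    have h7 := mul_le_mul_of_nonneg_right (h2.trans h6) (norm_nonneg y)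
    linarith [h7, sq (‖y‖)]
  linarith

end
end Camel
end

section
namespace Camel
open Metric MeasureTheory Filter Topology
open scoped ContDiff
set_option linter.unusedSectionVars false
set_option linter.unusedSimpArgs false
set_option linter.unusedVariables false

section
variable {X : Type*} [NormedAddCommGroup X] [InnerProductSpace ℂ X]
variable {Ψ g : ℝ → X → X} {f h : ℝ → ℝ} {v1 v2 m : ℝ} {b : X} {ea eb : X}

lemma smoothTransition_deriv_nonpos {v : ℝ} (hv : v ≤ 0) : deriv Real.smoothTransition v = 0 := by
  apply IsLocalMin.deriv_eq_zero
  refine Eventually.of_forall fun y => ?_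
  rw [Real.smoothTransition.zero_of_nonpos hv]
  exact Real.smoothTransition.nonneg y

lemma hasDerivAt_norm_sq_sub {y : ℝ → X} {y' : X} {s : ℝ} (b : X) (hy : HasDerivAt y y' s) :
    HasDerivAt (fun s => ‖y s - b‖ ^ 2) (2 * rip (y s - b) y') s := by
  have h3 := hy.sub_const b
  have h5 := Complex.reCLM.hasFDerivAt.comp_hasDerivAt s (h3.inner ℂ h3)
  convert! h5 using 1
  · ext s'
    simp only [Function.comp, Complex.reCLM_apply]
    exact (rip_self _).symm
  · rw [Complex.reCLM_apply, Complex.add_re]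
    have := rip_comm (y s - b) y'
    unfold rip at *
    linarith

/-- Dichotomy for the orbits. -/
lemma inner_orbit (F : Fam Ψ g) (P : Prof f h v1 v2 m) (O : X → X) (R' : ℝ) (hR' : 0 < R') (t : ℝ)
    (hO : ∀ z, ‖g t z - b‖ ≤ R' → O z = 0) (x : ℝ → X)
    (hx : ∀ s, HasDerivAt x (Complex.I • (inY h Ψ g b t (x s) + O (x s))) s)
    (hx1 : ∀ s, x (s + 1) = x s) :
    (∀ s, R' ≤ ‖g t (x s) - b‖) ∨
    (∀ s, ‖g t (x s) - b‖ < R' ∧ rnd h b (g t (x s)) = 0) := by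
  set y : ℝ → X := fun s => g t (x s) with hydef
  have hy : ∀ s, HasDerivAt y (fderiv ℝ (g t) (x s) (Complex.I • (inY h Ψ g b t (x s) + O (x s)))) s :=
    fun s => ((F.smg_t t).differentiable (by simp) _).hasFDerivAt.comp_hasDerivAt s (hx s)
  have hyin : ∀ s, ‖y s - b‖ < R' → HasDerivAt y (Complex.I • rnd h b (y s)) s := by
    intro s hs
    have h1 := hy s
    set y' := fderiv ℝ (g t) (x s) (Complex.I • (inY h Ψ g b t (x s) + O (x s)))
    have h2 : HasDerivAt (fun s => Ψ t (y s)) (fderiv ℝ (Ψ t) (y s) y') s :=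
      ((F.sm_t t).differentiable (by simp) _).hasFDerivAt.comp_hasDerivAt s h1
    have h3 : (fun s => Ψ t (y s)) = x := funext fun s => F.right t (x s)
    rw [h3] at h2
    have h4 := h2.unique (hx s)
    rw [hO (x s) hs.le, add_zero, inY, smul_neg, smul_smul, Complex.I_mul_I, neg_one_smul, neg_neg] at h4
    have h5 : fderiv ℝ (Ψ t) (y s) (y' - Complex.I • rnd h b (y s)) = 0 := by
      rw [map_sub, h4, sub_self]
    have h6 := hasFDerivAt_symp_inj F t _ _ h5
    rw [← sub_eq_zero.1 h6]
    exact h1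
  have hNin : ∀ s, ‖y s - b‖ < R' → HasDerivAt (fun s => ‖y s - b‖ ^ 2) 0 s := by
    intro s hs
    have h1 := hasDerivAt_norm_sq_sub b (hyin s hs)
    convert! h1 using 1
    have : Complex.I • rnd h b (y s) = (2 * h (‖y s - b‖ ^ 2)) • (Complex.I • (y s - b)) := by
      unfold rnd; rw [smul_comm]
    rw [this, rip_smul_right, rip_comm, rip_I_self]
    simp
  have hE : ∀ s, HasDerivAt (fun s => Real.smoothTransition (R' ^ 2 - ‖y s - b‖ ^ 2)) 0 s := by
    intro s
    have hst : ∀ v, HasDerivAt Real.smoothTransition (deriv Real.smoothTransition v) v := fun v =>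
      ((Real.smoothTransition.contDiff (n := 1)).differentiable (by simp) v).hasDerivAt
    by_cases hs : ‖y s - b‖ < R'
    · have h1 := (hst (R' ^ 2 - ‖y s - b‖ ^ 2)).comp s ((hNin s hs).const_sub (R' ^ 2))
      convert! h1 using 1
      simp
    · push Not at hs
      have h1 := (hst (R' ^ 2 - ‖y s - b‖ ^ 2)).comp s
        ((hasDerivAt_norm_sq_sub b (hy s)).const_sub (R' ^ 2))
      convert! h1 using 1
      rw [smoothTransition_deriv_nonpos (by nlinarith), zero_mul]
  have hEc : ∀ s s', Real.smoothTransition (R' ^ 2 - ‖y s - b‖ ^ 2) =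
      Real.smoothTransition (R' ^ 2 - ‖y s' - b‖ ^ 2) :=
    is_const_of_deriv_eq_zero (fun s => (hE s).differentiableAt) (fun s => (hE s).deriv)
  by_cases hc : ∀ s, R' ≤ ‖y s - b‖
  · exact Or.inl hc
  right
  push Not at hc
  obtain ⟨s0, hs0⟩ := hc
  have hin : ∀ s, ‖y s - b‖ < R' := by
    intro s
    by_contra hs
    push Not at hs
    have h1 := hEc s0 s
    rw [Real.smoothTransition.zero_of_nonpos (x := R' ^ 2 - ‖y s - b‖ ^ 2) (by nlinarith)] at h1
    have h2 := Real.smoothTransition.pos_of_pos (x := R' ^ 2 - ‖y s0 - b‖ ^ 2)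
      (by nlinarith [norm_nonneg (y s0 - b)])
    linarith
  have hN : ∀ s, ‖y s - b‖ ^ 2 = ‖y 0 - b‖ ^ 2 := fun s =>
    is_const_of_deriv_eq_zero (f := fun s => ‖y s - b‖ ^ 2) (fun s => (hNin s (hin s)).differentiableAt)
      (fun s => (hNin s (hin s)).deriv) s 0
  have hrot := rotation (fun s => y s - b) (2 * h (‖y 0 - b‖ ^ 2)) (fun s => by
      have h1 := (hyin s (hin s)).sub_const b
      convert! h1 using 1
      rw [rnd, hN s, mul_comm, mul_smul, Complex.coe_smul])
    (by have := hx1 0; rw [zero_add] at this; simp only [hydef, this])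
  intro s
  refine ⟨hin s, ?_⟩
  unfold rnd
  rcases hrot with h1 | ⟨n, hn⟩
  · have h2 := hN s
    rw [h1] at h2
    have h3 : ‖y s - b‖ = 0 := by simpa using h2
    have h4 : y s - b = 0 := by simpa using h3
    show (2 * h (‖y s - b‖ ^ 2)) • (y s - b) = 0
    rw [h4, smul_zero]
  · have k1 := P.nonneg (‖y 0 - b‖ ^ 2)
    have k2 := P.lt (‖y 0 - b‖ ^ 2)
    have hp := Real.pi_pos
    have n1 : (n:ℝ) < 1 := by
      by_contra hc
      push Not at hc
      nlinarith
    have n2 : (-1:ℝ) < n := by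
      by_contra hc
      push Not at hc
      nlinarith
    have n1' : n < 1 := by exact_mod_cast n1
    have n2' : -1 < n := by exact_mod_cast n2
    have n0 : n = 0 := by omega
    show (2 * h (‖y s - b‖ ^ 2)) • (y s - b) = 0
    rw [hN s, hn, n0]; simp

/-- Parameters of the barrier. -/
lemma barrier [FiniteDimensional ℝ X] (ha : ‖ea‖ = 1) (hb : ‖eb‖ = 1) (hab : inner ℂ ea eb = 0)
    (F : Fam Ψ g) {r1 R' : ℝ} (hr1 : 0 < r1)
    (hav : ∀ t ∈ Icc (0:ℝ) 1, ∀ x ∈ closedBall b R', (inner ℂ eb (Ψ t x)).re = 0 → ‖Ψ t x‖ < r1) :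
    ∃ ρ Λ : ℝ, 0 < ρ ∧ 0 < Λ ∧ ∀ t ∈ Icc (0:ℝ) 1, ∀ x ∈ closedBall b R', ‖Ψ t x‖ ≤ ρ ∧
      ‖inner ℂ ea (Ψ t x)‖ ^ 2 - kap Λ (inner ℂ eb (Ψ t x)).re ≤ r1 ^ 2 := by
  have hpr : ProperSpace X := FiniteDimensional.proper ℝ X
  have hK : IsCompact (Icc (0:ℝ) 1 ×ˢ closedBall b R') := isCompact_Icc.prod (isCompact_closedBall b R')
  have hc := F.sm.continuous
  obtain ⟨ρ0, hρ0⟩ := hK.exists_bound_of_continuousOn hc.continuousOn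
  set ρ := max ρ0 1 with hρdef
  have hρ : 0 < ρ := lt_max_of_lt_right one_pos
  have hZ : IsCompact ((Icc (0:ℝ) 1 ×ˢ closedBall b R') ∩ {p | r1 ≤ ‖Ψ p.1 p.2‖}) :=
    hK.inter_right (isClosed_le continuous_const hc.norm)
  have hqc : Continuous fun p : ℝ × X => |(inner ℂ eb (Ψ p.1 p.2)).re| :=
    (Complex.continuous_re.comp (Continuous.inner continuous_const hc)).abs
  obtain ⟨δ, hδ, hδ1⟩ : ∃ δ > 0, ∀ p ∈ (Icc (0:ℝ) 1 ×ˢ closedBall b R') ∩ {p | r1 ≤ ‖Ψ p.1 p.2‖},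
      δ ≤ |(inner ℂ eb (Ψ p.1 p.2)).re| := by
    rcases ((Icc (0:ℝ) 1 ×ˢ closedBall b R') ∩ {p | r1 ≤ ‖Ψ p.1 p.2‖}).eq_empty_or_nonempty with h | h
    · exact ⟨1, one_pos, fun p hp => by rw [h] at hp; exact absurd hp (notMem_empty p)⟩
    · obtain ⟨p0, hp0, hmin⟩ := hZ.exists_isMinOn h hqc.continuousOn
      refine ⟨|(inner ℂ eb (Ψ p0.1 p0.2)).re|, ?_, fun p hp => hmin hp⟩
      rw [gt_iff_lt, abs_pos]
      intro h0
      have := hav p0.1 hp0.1.1 p0.2 hp0.1.2 h0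
      have h2 : r1 ≤ ‖Ψ p0.1 p0.2‖ := hp0.2
      linarith
  refine ⟨ρ, ρ ^ 2 * (1 + δ ^ 2) / δ ^ 2, hρ, by positivity, fun t ht x hx => ?_⟩
  have hn : ‖Ψ t x‖ ≤ ρ := (hρ0 (t, x) ⟨ht, hx⟩).trans (le_max_left _ _)
  refine ⟨hn, ?_⟩
  have hd := norm_decomp ha hb hab (Ψ t x)
  have hle : ‖inner ℂ ea (Ψ t x)‖ ^ 2 ≤ ‖Ψ t x‖ ^ 2 := by
    nlinarith [sq_nonneg (inner ℂ eb (Ψ t x)).re, sq_nonneg (inner ℂ eb (Ψ t x)).im,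
      sq_nonneg ‖wpt ea eb (Ψ t x)‖]
  have hΛ : 0 < ρ ^ 2 * (1 + δ ^ 2) / δ ^ 2 := by positivity
  by_cases hc : r1 ≤ ‖Ψ t x‖
  · have h1 := hδ1 (t, x) ⟨⟨ht, hx⟩, hc⟩
    simp only at h1
    have h2 : ρ ^ 2 ≤ kap (ρ ^ 2 * (1 + δ ^ 2) / δ ^ 2) (inner ℂ eb (Ψ t x)).re := by
      set q := (inner ℂ eb (Ψ t x)).re
      have h3 : δ ^ 2 ≤ q ^ 2 := by rw [← sq_abs q]; exact pow_le_pow_left₀ hδ.le h1 2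
      unfold kap
      rw [le_div_iff₀ (by positivity), div_mul_eq_mul_div, le_div_iff₀ (by positivity)]
      have : 0 < ρ ^ 2 := by positivity
      nlinarith
    have h3 : ‖Ψ t x‖ ^ 2 ≤ ρ ^ 2 := pow_le_pow_left₀ (norm_nonneg _) hn 2
    nlinarith [sq_nonneg r1]
  · push Not at hc
    have h3 : ‖Ψ t x‖ ^ 2 ≤ r1 ^ 2 := pow_le_pow_left₀ (norm_nonneg _) hc.le 2
    have := kap_nonneg hΛ (inner ℂ eb (Ψ t x)).re
    linarith

/-- a uniform neighbourhood of the moving centre -/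
lemma centre_nhd (F : Fam Ψ g) (b : X) {v : ℝ} (hv : 0 < v) :
    ∃ δ > 0, ∀ t ∈ Icc (0:ℝ) 1, ∀ x, ‖x - Ψ t b‖ ≤ δ → ‖g t x - b‖ < v := by
  have hc : Continuous fun p : ℝ × X => ‖g p.1 (Ψ p.1 b + p.2) - b‖ := by
    have h1 : Continuous fun p : ℝ × X => Ψ p.1 b := F.sm.continuous.comp (continuous_fst.prodMk continuous_const)
    have h2 : Continuous fun p : ℝ × X => g p.1 (Ψ p.1 b + p.2) :=
      F.smg.continuous.comp (continuous_fst.prodMk (h1.add continuous_snd))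
    exact (h2.sub continuous_const).norm
  have hU : IsOpen {p : ℝ × X | ‖g p.1 (Ψ p.1 b + p.2) - b‖ < v} := isOpen_lt hc continuous_const
  obtain ⟨u, w, hu, hw, hIu, h0w, hsub⟩ := generalized_tube_lemma (isCompact_Icc (a := (0:ℝ)) (b := 1))
    (isCompact_singleton (x := (0:X))) hU (by
      rintro ⟨t, y⟩ ⟨ht, hy⟩
      rw [mem_singleton_iff] at hy
      simp only at hy
      simp [hy, F.left, hv])
  obtain ⟨δ, hδ, hball⟩ := Metric.isOpen_iff.1 hw 0 (h0w rfl)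
  refine ⟨δ / 2, by positivity, fun t ht x hx => ?_⟩
  have h1 : x - Ψ t b ∈ w := hball (by rw [mem_ball, dist_zero_right]; linarith)
  have h2 : (t, x - Ψ t b) ∈ {p : ℝ × X | ‖g p.1 (Ψ p.1 b + p.2) - b‖ < v} := hsub ⟨hIu ht, h1⟩
  simpa using h2

set_option maxHeartbeats 4000000 in
/-- The camel theorem in complex notation. -/
theorem camel_X [FiniteDimensional ℝ X] (ha : ‖ea‖ = 1) (hb : ‖eb‖ = 1) (hab : inner ℂ ea eb = 0)
    (F : Fam Ψ g) {r R : ℝ} (hr : 0 < r) (hrR : r < R) (b : X)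
    (h0 : ∀ x ∈ ball b R, (inner ℂ eb (Ψ 0 x)).re < 0)
    (h1 : ∀ x ∈ ball b R, 0 < (inner ℂ eb (Ψ 1 x)).re)
    (hav : ∀ t ∈ Icc (0:ℝ) 1, ∀ x ∈ ball b R, (inner ℂ eb (Ψ t x)).re = 0 → ‖Ψ t x‖ < r) : False := by
  have hpr : ProperSpace X := FiniteDimensional.proper ℝ X
  have hcomp : CompleteSpace X := FiniteDimensional.complete ℝ X
  have hp := Real.pi_pos
  obtain ⟨r2, hr2, hr2R⟩ := exists_between hrR
  obtain ⟨R2, hR2, hR2R⟩ := exists_between hr2R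
  obtain ⟨R1, hR1, hR1R⟩ := exists_between hR2R
  have hr20 : 0 < r2 := by linarith
  have hR20 : 0 < R2 := by linarith
  have hR10 : 0 < R1 := by linarith
  have hrr : r ^ 2 < r2 ^ 2 := by nlinarith
  -- inner
  obtain ⟨f, h, v1, m, P, hm⟩ := exists_prof (r2 ^ 2) (R2 ^ 2) (by positivity) (by nlinarith)
  obtain ⟨L, hL0, hL⟩ := inY_bounds (b := b) F P hR20.le rfl
  -- outer
  have hcb : closedBall b R1 ⊆ ball b R := closedBall_subset_ball hR1R
  obtain ⟨ρ, Λ, hρ, hΛ, hbar⟩ := barrier (b := b) (R' := R1) ha hb hab F hr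
    (fun t ht x hx => hav t ht x (hcb hx))
  set A := 3 * Real.pi / 2 / (r2 ^ 2 - r ^ 2) * (2 * Λ) * (2 * Λ) + 3 * Real.pi / 2 * (6 * Λ) with hA
  have hsub : 0 < r2 ^ 2 - r ^ 2 := by linarith
  have hA0 : 0 < A := by positivity
  set ε := 1 / (2 * (A + 2)) with hεdef
  have hε : 0 < ε := by positivity
  have hε2 : 2 * ε * (A + 2) = 1 := by rw [hεdef]; field_simp
  have hε1 : 2 * ε ≤ 1 := by nlinarith
  have hsm : (2 * ε) * (A + 2 * ε) < 1 := by nlinarith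
  set OF := outF ea eb (r ^ 2) (r2 ^ 2) Λ ε ρ with hOF
  set OY := outY ea eb (r ^ 2) (r2 ^ 2) Λ ε ρ with hOY
  have hz : ∀ t ∈ Icc (0:ℝ) 1, ∀ z, ‖g t z - b‖ ≤ R1 → OF z = 0 ∧ OY z = 0 := by
    intro t ht z hz
    have hb1 := hbar t ht (g t z) (by rw [mem_closedBall, dist_eq_norm]; exact hz)
    rw [F.right] at hb1
    exact out_zero ha hb hab (by positivity) hrr hρ z hb1.1 hb1.2
  -- far points
  have hfar : ∀ t z, R2 ≤ ‖g t z - b‖ → inK f g b t z = m := fun t z hz =>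
    P.f2 _ (pow_le_pow_left₀ hR20.le hz 2)
  obtain ⟨δ, hδ, hδz⟩ := centre_nhd F b (v := min (Real.sqrt v1) R1)
    (lt_min (Real.sqrt_pos.2 P.hv1) hR10)
  have hcc : Continuous fun t => Ψ t b := F.sm.continuous.comp (continuous_id.prodMk continuous_const)
  obtain ⟨Cc, hCc⟩ := (isCompact_Icc (a := (0:ℝ)) (b := 1)).exists_bound_of_continuousOn hcc.continuousOn
  have hm0 : 0 ≤ m := by
    have : 0 ≤ Real.pi * r2 ^ 2 := by positivity
    linarith
  have hK0 : ∀ t z, 0 ≤ inK f g b t z := fun t z => P.f0 _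
  set C := (m + 3 * Real.pi / 2 * Λ + (3 * Real.pi / 2 + 1) * (2 * Cc ^ 2 + 2)) +
    (3 * Real.pi / 2 * r2 ^ 2 + 2 * ε * ρ ^ 2) with hC
  have hC0 : 0 < C := by positivity
  have hend : ∀ t, t = 0 ∨ t = 1 → ∀ z, (inner ℂ eb z).re = 0 →
      Real.pi * ‖inner ℂ ea z‖ ^ 2 ≤ inK f g b t z + OF z := by
    intro t ht z hz0
    have hge : R ≤ ‖g t z - b‖ := by
      by_contra hc
      push Not at hc
      have hin : g t z ∈ ball b R := by rw [mem_ball, dist_eq_norm]; exact hc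
      rcases ht with rfl | rfl
      · have := h0 (g 0 z) hin
        rw [F.right, hz0] at this
        exact lt_irrefl _ this
      · have := h1 (g 1 z) hin
        rw [F.right, hz0] at this
        exact lt_irrefl _ this
    rw [hfar t z (by linarith)]
    exact outF_lower_plane' (by positivity) hrr hε hρ z hz0 hm
  have H : IsHam ea eb (fun t z => inK f g b t z + OF z) (fun t z => inY h Ψ g b t z + OY z)
      (fun t => Ψ t b) C δ (ε / 2) (L + (3 * Real.pi / 2 * Λ + ε)) := by
    refine ⟨ha, hb, hab, ?_, ?_, hcc, hC0, hδ, by positivity, by positivity, ?_, ?_, ?_, ?_, ?_, ?_, ?_,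
      hend 0 (Or.inl rfl), hend 1 (Or.inr rfl)⟩
    · exact (inK_continuous F P).add (outF_continuous.comp continuous_snd)
    · exact (inY_contDiff F P).continuous.add ((outY_continuous hρ).comp continuous_snd)
    · intro t ht x y
      have s1 := inK_semi F P t (fun z z' => (hL t ht z).2 z') hL0 x y
      have s2 := outF_semi (ea := ea) (eb := eb) (Λ := Λ) (ε := ε) (ρ := ρ) ha hb hab hrr hΛ hρ hε x y
      rw [rip_add_left]
      linarith
    · intro t ht x hx
      have k1 := hδz t ht x hx
      have k2 := k1.trans_le (min_le_left _ _)
      have k3 := k1.trans_le (min_le_right _ _)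
      show inK f g b t x + OF x = 0
      rw [(hz t ht x k3.le).1, add_zero]
      refine P.f1 _ ?_
      have := Real.sq_sqrt P.hv1.le
      nlinarith [norm_nonneg (g t x - b)]
    · intro t ht x
      have k1 : inK f g b t x ≤ m := P.fm _
      have k2 := outF_quad (a := r ^ 2) (b := r2 ^ 2) ha hb hab hrr hε hε1 hρ hΛ x
      have k3 := hCc t ht
      have k4 : ‖x‖ ≤ ‖x - Ψ t b‖ + Cc := by
        have := norm_add_le (x - Ψ t b) (Ψ t b)
        rw [sub_add_cancel] at this
        linarith
      have k5 : ‖x‖ ^ 2 ≤ 2 * ‖x - Ψ t b‖ ^ 2 + 2 * Cc ^ 2 := by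
        nlinarith [norm_nonneg x, sq_nonneg (‖x - Ψ t b‖ - Cc), norm_nonneg (x - Ψ t b)]
      have k6 := mul_le_mul_of_nonneg_left k5 (show 0 ≤ 3 * Real.pi / 2 + 1 by positivity)
      have k7 : (3 * Real.pi / 2 + 1) * 2 ≤ C := by
        have q1 : 0 ≤ (3 * Real.pi / 2 + 1) * (2 * Cc ^ 2) := by positivity
        have q2 : 0 ≤ 3 * Real.pi / 2 * Λ := by positivity
        have q3 : 0 ≤ 3 * Real.pi / 2 * r2 ^ 2 + 2 * ε * ρ ^ 2 := by positivity
        rw [hC]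
        linarith
      have k8 := mul_le_mul_of_nonneg_right k7 (sq_nonneg ‖x - Ψ t b‖)
      have k9 : m + 3 * Real.pi / 2 * Λ + (3 * Real.pi / 2 + 1) * (2 * Cc ^ 2) ≤ C := by
        have q3 : 0 ≤ 3 * Real.pi / 2 * r2 ^ 2 + 2 * ε * ρ ^ 2 := by positivity
        rw [hC]
        linarith
      show inK f g b t x + OF x ≤ _
      linarith
    · exact h0 b (mem_ball_self (by linarith))
    · exact h1 b (mem_ball_self (by linarith))
    · intro t ht x hx
      exact add_nonneg (hK0 t x) (outF_nonneg_plane (by positivity) hrr hε hρ x hx)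
    · intro t ht x hx
      have k1 := outF_lower_plane (Λ := Λ) (a := r ^ 2) (b := r2 ^ 2) ha hb hab (by positivity) hrr hε hε1 hρ x hx
      have k2 := hK0 t x
      have k3 : 3 * Real.pi / 2 * r2 ^ 2 + 2 * ε * ρ ^ 2 ≤ C := by
        rw [hC]
        have : 0 ≤ m + 3 * Real.pi / 2 * Λ + (3 * Real.pi / 2 + 1) * (2 * Cc ^ 2 + 2) := by positivity
        linarith
      show _ ≤ inK f g b t x + OF x
      linarith
  obtain ⟨t, ht, x, hx, hx1, hpos⟩ := H.orbit hε hε1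
    (L + (3 * Real.pi * (1 + (r2 ^ 2 + Λ)) + (3 * Real.pi / 2 * (2 * Λ) + 4 * ε * ρ) + 2 * ε * ρ))
    (fun t ht x => by
      have k1 := outY_lin (a := r ^ 2) (b := r2 ^ 2) ha hb hab hrr (by positivity) hε hρ hΛ x
      have k2 := (hL t ht x).1
      rw [add_sub_assoc]
      exact (norm_add_le _ _).trans (add_le_add k2 k1))
  have hle : ∀ s, rip (inY h Ψ g b t (x s) + OY (x s)) (x s) / 2 - (inK f g b t (x s) + OF (x s)) ≤ 0 := by
    intro s
    rcases inner_orbit F P OY R1 hR10 t (fun z hz' => (hz t ht z hz').2) x hx hx1 with hout | hin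
    · have hY0 : ∀ s, inY h Ψ g b t (x s) = 0 := fun s =>
        inY_zero (rnd_zero P (pow_le_pow_left₀ hR20.le (by linarith [hout s]) 2))
      have k := outer_orbit ha hb hab (by positivity) hrr hΛ hρ hε hε1 hsm hm x
        (fun s => by have := hx s; simp only [hY0, zero_add] at this; exact this) hx1 s
      rw [hY0 s, zero_add, hfar t (x s) (by linarith [hout s])]
      linarith
    · obtain ⟨k1, k2⟩ := hin s
      rw [inY_zero k2, (hz t ht (x s) k1.le).2, (hz t ht (x s) k1.le).1, add_zero, add_zero, rip_zero_left]
      linarith [hK0 t (x s)]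
  have : ∫ s in (0:ℝ)..1, (rip (inY h Ψ g b t (x s) + OY (x s)) (x s) / 2 - (inK f g b t (x s) + OF (x s))) ≤ 0 := by
    have h2 := intervalIntegral.integral_nonneg (μ := volume) (a := (0:ℝ)) (b := 1) (f := fun s =>
      -(rip (inY h Ψ g b t (x s) + OY (x s)) (x s) / 2 - (inK f g b t (x s) + OF (x s)))) zero_le_one
      (fun s _ => by have := hle s; linarith)
    rw [intervalIntegral.integral_neg] at h2
    linarith
  exact absurd hpos (not_lt.2 this)

end
end Camel
end

section
namespace Camel
open Metric MeasureTheory Filter Topology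
open scoped ContDiff
set_option linter.unusedSectionVars false
set_option linter.unusedSimpArgs false
set_option linter.unusedVariables false

section
variable {X : Type*} [NormedAddCommGroup X] [InnerProductSpace ℂ X]
variable {Ψ : ℝ → X → X}

/-- The inverse of a smooth family of symplectic bijections is a smooth family. -/
theorem exists_fam [FiniteDimensional ℝ X]
    (hs : ContDiff ℝ ∞ (fun p : ℝ × X => Ψ p.1 p.2))
    (hbij : ∀ t, Function.Bijective (Ψ t))
    (hsymp : ∀ t x v w, rip (Complex.I • fderiv ℝ (Ψ t) x v) (fderiv ℝ (Ψ t) x w) = rip (Complex.I • v) w) :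
    ∃ g, Fam Ψ g := by
  have hcomp : CompleteSpace X := FiniteDimensional.complete ℝ X
  set Φ : ℝ × X → ℝ × X := fun p => (p.1, Ψ p.1 p.2) with hΦ
  have hΦs : ContDiff ℝ ∞ Φ := contDiff_fst.prodMk hs
  have hd : ∀ p : ℝ × X, HasFDerivAt Φ ((ContinuousLinearMap.fst ℝ ℝ X).prod
      (fderiv ℝ (fun p : ℝ × X => Ψ p.1 p.2) p)) p := fun p =>
    hasFDerivAt_fst.prodMk ((hs.differentiable (by simp)) p).hasFDerivAt
  have hpart : ∀ (p : ℝ × X) (v : X), fderiv ℝ (Ψ p.1) p.2 v =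
      fderiv ℝ (fun p : ℝ × X => Ψ p.1 p.2) p (0, v) := by
    intro p v
    have h1 : HasFDerivAt (fun p : ℝ × X => Ψ p.1 p.2) _ (p.1, p.2) :=
      ((hs.differentiable (by simp)) p).hasFDerivAt
    have h2 := h1.comp p.2 (hasFDerivAt_prodMk_right p.1 p.2)
    have h3 : HasFDerivAt (Ψ p.1) _ p.2 := h2
    rw [h3.fderiv]
    simp
  have hinj : ∀ p : ℝ × X, Function.Injective ((ContinuousLinearMap.fst ℝ ℝ X).prod
      (fderiv ℝ (fun p : ℝ × X => Ψ p.1 p.2) p)) := by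
    intro p
    rw [injective_iff_map_eq_zero]
    rintro ⟨s, v⟩ h
    have h1 := congrArg Prod.fst h
    have h2 := congrArg Prod.snd h
    simp only [ContinuousLinearMap.prod_apply, ContinuousLinearMap.coe_fst', Prod.fst_zero, Prod.snd_zero] at h1 h2
    subst h1
    rw [← hpart] at h2
    have h3 := hsymp p.1 p.2 v (Complex.I • v)
    rw [h2, smul_zero, rip_zero_left, rip_I_I, rip_self] at h3
    have : v = 0 := norm_eq_zero.1 (pow_eq_zero_iff (two_ne_zero) |>.1 h3.symm)
    rw [this]; rfl
  let e : ℝ × X → (ℝ × X) ≃L[ℝ] (ℝ × X) := fun p =>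
    (LinearEquiv.ofInjectiveEndo _ (hinj p)).toContinuousLinearEquiv
  have he : ∀ p, ((e p : (ℝ × X) ≃L[ℝ] (ℝ × X)) : (ℝ × X) →L[ℝ] (ℝ × X)) =
      (ContinuousLinearMap.fst ℝ ℝ X).prod (fderiv ℝ (fun p : ℝ × X => Ψ p.1 p.2) p) := by
    intro p
    ext v <;> rfl
  have hd' : ∀ p, HasFDerivAt Φ ((e p : (ℝ × X) ≃L[ℝ] (ℝ × X)) : (ℝ × X) →L[ℝ] (ℝ × X)) p := fun p => by
    rw [he]; exact hd p
  have hopen : IsOpenMap Φ := isOpenMap_of_hasStrictFDerivAt_equiv (f' := e) fun p =>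
    hΦs.contDiffAt.hasStrictFDerivAt' (hd' p) (by simp)
  have hb : Function.Bijective Φ := by
    constructor
    · rintro ⟨t, x⟩ ⟨s, y⟩ h
      have h1 : t = s := congrArg Prod.fst h
      have h2 : Ψ t x = Ψ s y := congrArg Prod.snd h
      subst h1
      rw [(hbij t).1 h2]
    · rintro ⟨t, y⟩
      obtain ⟨x, hx⟩ := (hbij t).2 y
      exact ⟨(t, x), by rw [hΦ]; simp [hx]⟩
  let hm : (ℝ × X) ≃ₜ (ℝ × X) :=
    (Equiv.ofBijective Φ hb).toHomeomorphOfContinuousOpen hΦs.continuous hopen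
  have hsym : ContDiff ℝ ∞ (hm.symm : ℝ × X → ℝ × X) := hm.contDiff_symm (f₀' := e) hd' hΦs
  have hr : ∀ p, Φ (hm.symm p) = p := fun p => hm.apply_symm_apply p
  have hl : ∀ p, hm.symm (Φ p) = p := fun p => hm.symm_apply_apply p
  have hright : ∀ t x, Ψ t (hm.symm (t, x)).2 = x := by
    intro t x
    have h := hr (t, x)
    have h1 : (hm.symm (t, x)).1 = t := congrArg Prod.fst h
    have h2 : Ψ (hm.symm (t, x)).1 (hm.symm (t, x)).2 = x := congrArg Prod.snd h
    rwa [h1] at h2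
  exact ⟨fun t x => (hm.symm (t, x)).2, hs, contDiff_snd.comp hsym,
    fun t x => congrArg Prod.snd (hl (t, x)), hright, hsymp⟩

end

/-- Complex coordinate space, carrying only its complex inner product structure. -/
def XX (n : ℕ) : Type := EuclideanSpace ℂ (Fin n)

instance instNAG (n : ℕ) : NormedAddCommGroup (XX n) :=
  inferInstanceAs (NormedAddCommGroup (EuclideanSpace ℂ (Fin n)))

instance instIPS (n : ℕ) : InnerProductSpace ℂ (XX n) :=
  inferInstanceAs (InnerProductSpace ℂ (EuclideanSpace ℂ (Fin n)))

instance instFDC (n : ℕ) : FiniteDimensional ℂ (XX n) :=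
  inferInstanceAs (FiniteDimensional ℂ (EuclideanSpace ℂ (Fin n)))

instance instFDR (n : ℕ) : FiniteDimensional ℝ (XX n) := FiniteDimensional.complexToReal (XX n)

/-- make a vector -/
def XX.mk {n : ℕ} (f : Fin n → ℂ) : XX n := WithLp.toLp 2 f

/-- coordinate -/
def XX.c {n : ℕ} (x : XX n) (j : Fin n) : ℂ := WithLp.ofLp (p := 2) (V := Fin n → ℂ) x j

@[simp] lemma XX.mk_c {n : ℕ} (f : Fin n → ℂ) (j : Fin n) : (XX.mk f).c j = f j := rfl

lemma XX.ext' {n : ℕ} {x y : XX n} (h : ∀ j, x.c j = y.c j) : x = y :=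
  PiLp.ext (p := 2) (α := fun _ : Fin n => ℂ) h

@[simp] lemma XX.add_c {n : ℕ} (x y : XX n) (j : Fin n) : (x + y).c j = x.c j + y.c j := rfl

@[simp] lemma XX.smul_c {n : ℕ} (a : ℂ) (x : XX n) (j : Fin n) : (a • x).c j = a * x.c j := rfl

@[simp] lemma XX.rsmul_c {n : ℕ} (a : ℝ) (x : XX n) (j : Fin n) : (a • x).c j = a * x.c j := rfl

lemma XX.inner_eq {n : ℕ} (x y : XX n) : inner ℂ x y = ∑ j, y.c j * starRingEnd ℂ (x.c j) := by
  have := PiLp.inner_apply (𝕜 := ℂ) (f := fun _ : Fin n => ℂ) x y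
  exact this

lemma XX.norm_sq {n : ℕ} (x : XX n) : ‖x‖ ^ 2 = ∑ j, ‖x.c j‖ ^ 2 :=
  EuclideanSpace.norm_sq_eq (𝕜 := ℂ) (n := Fin n) x

/-- basis vector -/
def XX.bas {n : ℕ} (k : Fin n) : XX n := XX.mk (Pi.single k 1)

lemma XX.bas_inner {n : ℕ} (k : Fin n) (x : XX n) : inner ℂ (XX.bas k) x = x.c k := by
  rw [XX.inner_eq]
  simp [XX.bas, Pi.single_apply, apply_ite]

lemma XX.bas_norm {n : ℕ} (k : Fin n) : ‖XX.bas k‖ = 1 := by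
  have h : inner ℂ (XX.bas k) (XX.bas k) = (1 : ℂ) := by rw [XX.bas_inner]; simp [XX.bas]
  have h2 := inner_self_eq_norm_sq (𝕜 := ℂ) (XX.bas k)
  rw [h] at h2
  simp at h2
  have := norm_nonneg (XX.bas k)
  nlinarith

lemma sum_pairs (n : ℕ) (f : ℕ → ℝ) :
    ∑ k ∈ Finset.range (2 * n), f k = ∑ j ∈ Finset.range n, (f (2 * j) + f (2 * j + 1)) := by
  induction n with
  | zero => simp
  | succ n ih => rw [Nat.mul_succ, Finset.sum_range_succ, Finset.sum_range_succ, ih, Finset.sum_range_succ]; ring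

lemma sum_pairs_fin (n : ℕ) (f : Fin (2 * n) → ℝ) :
    ∑ k, f k = ∑ j : Fin n, (f ⟨2 * j.val, by omega⟩ + f ⟨2 * j.val + 1, by omega⟩) := by
  have h := sum_pairs n (fun k => if h : k < 2 * n then f ⟨k, h⟩ else 0)
  rw [← Fin.sum_univ_eq_sum_range, ← Fin.sum_univ_eq_sum_range (fun j => _)] at h
  have h1 : ∑ k, f k = ∑ i : Fin (2 * n), (if h : i.val < 2 * n then f ⟨i.val, h⟩ else 0) := by
    refine Finset.sum_congr rfl fun i _ => ?_
    rw [dif_pos i.2]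
  rw [h1, h]
  refine Finset.sum_congr rfl fun i _ => ?_
  rw [dif_pos (by omega), dif_pos (by omega)]

/-- The identification of real and complex coordinates, as a linear equivalence. -/
def thetaL (n : ℕ) : EuclideanSpace ℝ (Fin (2 * n)) ≃ₗ[ℝ] XX n where
  toFun x := XX.mk fun j => ⟨x ⟨2 * j.val, by omega⟩, x ⟨2 * j.val + 1, by omega⟩⟩
  map_add' x y := by
    refine XX.ext' fun j => ?_
    apply Complex.ext <;> simp
  map_smul' a x := by
    refine XX.ext' fun j => ?_
    apply Complex.ext <;> simp
  invFun y := WithLp.toLp 2 fun k => if k.val % 2 = 0 then (y.c ⟨k.val / 2, by omega⟩).re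
    else (y.c ⟨k.val / 2, by omega⟩).im
  left_inv x := by
    ext k
    rcases Nat.mod_two_eq_zero_or_one k.val with h | h
    · have : 2 * (k.val / 2) = k.val := by omega
      simp [h, this]
    · have : 2 * (k.val / 2) + 1 = k.val := by omega
      simp [h, this]
  right_inv y := by
    refine XX.ext' fun j => ?_
    have h1 : (2 * j.val + 1) / 2 = j.val := by omega
    have h2 : (2 * j.val + 1) % 2 = 1 := by omega
    apply Complex.ext <;> simp [h1, h2]

lemma thetaL_c {n : ℕ} (x : EuclideanSpace ℝ (Fin (2 * n))) (j : Fin n) :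
    (thetaL n x).c j = ⟨x ⟨2 * j.val, by omega⟩, x ⟨2 * j.val + 1, by omega⟩⟩ := rfl

lemma thetaL_norm {n : ℕ} (x : EuclideanSpace ℝ (Fin (2 * n))) : ‖thetaL n x‖ = ‖x‖ := by
  have h : ‖thetaL n x‖ ^ 2 = ‖x‖ ^ 2 := by
    rw [XX.norm_sq, EuclideanSpace.norm_sq_eq, sum_pairs_fin]
    refine Finset.sum_congr rfl fun j _ => ?_
    rw [thetaL_c, Complex.sq_norm, Complex.normSq_mk, Real.norm_eq_abs, Real.norm_eq_abs, sq_abs, sq_abs]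
    ring
  exact (pow_left_inj₀ (norm_nonneg _) (norm_nonneg _) two_ne_zero).1 h

/-- The identification of real and complex coordinates, as an isometry. -/
def theta (n : ℕ) : EuclideanSpace ℝ (Fin (2 * n)) ≃ₗᵢ[ℝ] XX n := ⟨thetaL n, thetaL_norm⟩

lemma theta_c {n : ℕ} (x : EuclideanSpace ℝ (Fin (2 * n))) (j : Fin n) :
    (theta n x).c j = ⟨x ⟨2 * j.val, by omega⟩, x ⟨2 * j.val + 1, by omega⟩⟩ := rfl

lemma theta_rip {n : ℕ} (v w : EuclideanSpace ℝ (Fin (2 * n))) :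
    rip (Complex.I • theta n v) (theta n w) = - ∑ i : Fin n, (v ⟨2 * i.val + 1, by omega⟩ *
      w ⟨2 * i.val, by omega⟩ - w ⟨2 * i.val + 1, by omega⟩ * v ⟨2 * i.val, by omega⟩) := by
  unfold rip
  rw [XX.inner_eq, Complex.re_sum, ← Finset.sum_neg_distrib]
  refine Finset.sum_congr rfl fun j _ => ?_
  rw [XX.smul_c, theta_c, theta_c]
  simp
  ring

end Camel
end

/-- **The symplectic camel theorem.** Let `n ≥ 2` and `r, R > 0`.  Suppose there is a
smooth family `(ψ_t)_{t∈[0,1]}` of diffeomorphisms of `ℝ^{2n}` whose derivatives preserve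
the standard symplectic form, and an open Euclidean ball `B` of radius `R`, such that
`ψ₀(B) ⊂ P₋ = {qₙ < 0}`, `ψ₁(B) ⊂ P₊ = {qₙ > 0}`, and for all `t ∈ [0,1]` the image
`ψ_t(B)` avoids the punctured hyperplane `P_r = {qₙ = 0} ∖ B_r(0)` (i.e. any point of
`ψ_t(B)` with vanishing `qₙ`-coordinate has norm `< r`).  Then `R ≤ r`.
The `qₙ`-coordinate corresponds to the index `2n−2`. -/
theorem symplectic_camel (n : ℕ) (hn : 2 ≤ n) (r R : ℝ) (hr : 0 < r) (hR : 0 < R)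
    (ψ : ℝ → EuclideanSpace ℝ (Fin (2 * n)) → EuclideanSpace ℝ (Fin (2 * n)))
    (hsmooth : ContDiffOn ℝ (⊤ : ℕ∞) (fun p => ψ p.1 p.2) (Icc (0:ℝ) 1 ×ˢ univ))
    (hdiffeo : ∀ t ∈ Icc (0:ℝ) 1, ContDiff ℝ (⊤ : ℕ∞) (ψ t) ∧
      ∃ g, ContDiff ℝ (⊤ : ℕ∞) g ∧ Function.LeftInverse g (ψ t) ∧ Function.RightInverse g (ψ t))
    (hsymp : ∀ t ∈ Icc (0:ℝ) 1, ∀ x v w,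
      stdSymplecticForm n (fderiv ℝ (ψ t) x v) (fderiv ℝ (ψ t) x w) = stdSymplecticForm n v w)
    (b : EuclideanSpace ℝ (Fin (2 * n)))
    (h0 : ∀ x ∈ Metric.ball b R, (ψ 0 x) ⟨2 * n - 2, by omega⟩ < 0)
    (h1 : ∀ x ∈ Metric.ball b R, 0 < (ψ 1 x) ⟨2 * n - 2, by omega⟩)
    (havoid : ∀ t ∈ Icc (0:ℝ) 1, ∀ x ∈ Metric.ball b R,
      (ψ t x) ⟨2 * n - 2, by omega⟩ = 0 → ‖ψ t x‖ < r) :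
    R ≤ r := by
  by_contra hcon
  push Not at hcon
  have hθ : ∀ t, Real.smoothTransition t ∈ Icc (0:ℝ) 1 := fun t =>
    ⟨Real.smoothTransition.nonneg t, Real.smoothTransition.le_one t⟩
  let Ψ : ℝ → Camel.XX n → Camel.XX n := fun t x =>
    Camel.theta n (ψ (Real.smoothTransition t) ((Camel.theta n).symm x))
  have hs : ContDiff ℝ (⊤ : ℕ∞) (fun p : ℝ × Camel.XX n => Ψ p.1 p.2) := by
    have h2 : ContDiff ℝ (⊤ : ℕ∞) (fun p : ℝ × Camel.XX n =>
        (Real.smoothTransition p.1, (Camel.theta n).symm p.2)) :=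
      (Real.smoothTransition.contDiff.comp contDiff_fst).prodMk
        ((Camel.theta n).symm.contDiff.comp contDiff_snd)
    exact (Camel.theta n).contDiff.comp (hsmooth.comp_contDiff h2 fun p => ⟨hθ p.1, mem_univ _⟩)
  have hbij : ∀ t, Function.Bijective (Ψ t) := by
    intro t
    obtain ⟨-, g, -, hl, hr'⟩ := hdiffeo _ (hθ t)
    have hb1 : Function.Bijective (ψ (Real.smoothTransition t)) := ⟨hl.injective, hr'.surjective⟩
    exact (Camel.theta n).bijective.comp
      (hb1.comp (Camel.theta n).symm.bijective)
  have hfd : ∀ t x v, fderiv ℝ (Ψ t) x v = Camel.theta n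
      (fderiv ℝ (ψ (Real.smoothTransition t)) ((Camel.theta n).symm x) ((Camel.theta n).symm v)) := by
    intro t x v
    have hd := (((hdiffeo _ (hθ t)).1.differentiable (by simp)) ((Camel.theta n).symm x)).hasFDerivAt
    have e1 : HasFDerivAt (Camel.theta n).symm _ x :=
      (Camel.theta n).symm.toContinuousLinearEquiv.hasFDerivAt
    have e2 : HasFDerivAt (Camel.theta n) _
        (ψ (Real.smoothTransition t) ((Camel.theta n).symm x)) :=
      (Camel.theta n).toContinuousLinearEquiv.hasFDerivAt
    have h3 : HasFDerivAt (Ψ t) _ x := e2.comp x (hd.comp x e1)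
    rw [h3.fderiv]
    rfl
  have hrip : ∀ v w : EuclideanSpace ℝ (Fin (2 * n)),
      Camel.rip (Complex.I • Camel.theta n v) (Camel.theta n w) = - stdSymplecticForm n v w :=
    fun v w => Camel.theta_rip v w
  have hsy : ∀ t x v w, Camel.rip (Complex.I • fderiv ℝ (Ψ t) x v) (fderiv ℝ (Ψ t) x w) =
      Camel.rip (Complex.I • v) w := by
    intro t x v w
    rw [hfd, hfd, hrip, hsymp _ (hθ t), ← hrip, LinearIsometryEquiv.apply_symm_apply,
      LinearIsometryEquiv.apply_symm_apply]
  obtain ⟨g, F⟩ := Camel.exists_fam hs hbij hsy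
  have hco : ∀ x : EuclideanSpace ℝ (Fin (2 * n)),
      (inner ℂ (Camel.XX.bas (⟨n - 1, by omega⟩ : Fin n)) (Camel.theta n x)).re =
        x ⟨2 * n - 2, by omega⟩ := by
    intro x
    rw [Camel.XX.bas_inner, Camel.theta_c]
    have : 2 * (n - 1) = 2 * n - 2 := by omega
    simp only [this]
  have hball : ∀ x : Camel.XX n, x ∈ Metric.ball (Camel.theta n b) R →
      (Camel.theta n).symm x ∈ Metric.ball b R := by
    intro x hx
    rw [Metric.mem_ball] at hx ⊢
    rw [← (Camel.theta n).dist_map, LinearIsometryEquiv.apply_symm_apply]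
    exact hx
  refine Camel.camel_X (ea := Camel.XX.bas (⟨0, by omega⟩ : Fin n))
    (eb := Camel.XX.bas (⟨n - 1, by omega⟩ : Fin n)) (Camel.XX.bas_norm _) (Camel.XX.bas_norm _) ?_
    F hr hcon (Camel.theta n b) ?_ ?_ ?_
  · rw [Camel.XX.bas_inner]
    have : (⟨0, by omega⟩ : Fin n) ≠ ⟨n - 1, by omega⟩ := by
      intro h
      have := congrArg Fin.val h
      simp only at this
      omega
    simp [Camel.XX.bas, this]
  · intro x hx
    have := h0 _ (hball x hx)
    rw [← hco] at this
    simpa only [Ψ, Real.smoothTransition.zero] using this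
  · intro x hx
    have := h1 _ (hball x hx)
    rw [← hco] at this
    simpa only [Ψ, Real.smoothTransition.one] using this
  · intro t _ x hx hx0
    have k := havoid _ (hθ t) _ (hball x hx) (by rw [← hco]; exact hx0)
    show ‖Camel.theta n (ψ (Real.smoothTransition t) ((Camel.theta n).symm x))‖ < r
    rw [LinearIsometryEquiv.norm_map]
    exact k
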